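/- arXiv:1901.06668 — 3 statements merged into one kernel-verified Lean document; each statement's English description precedes it below -/
import Mathlib

section
/- Let (S, n) be a regular local ring of dimension 4, let x, y, u, v be a regular system of parameters for S, and set a := x·u + y·v. Then for every finitely generated S-module N with Supp N = V(aS), one has cd((u,v)S, N) = 2. -/
universe u

open CategoryTheory

/-- The cohomological dimension `cd(I, M)`: the supremum (in `WithBot ℕ∞`, so that the
supremum of the empty set is `⊥ = -∞`) of the set of indices `i` with `H^i_I(M) ≠ 0`. -/
noncomputable def cohomologicalDim {R : Type u} [CommRing R] (I : Ideal R)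
    (M : ModuleCat.{u} R) : WithBot ℕ∞ :=
  sSup ((fun i : ℕ => ((i : ℕ∞) : WithBot ℕ∞)) ''
    {i : ℕ | Nontrivial ((localCohomology I i).obj M)})


namespace CdAux

open IsLocalRing

lemma exists_nat_dim (R : Type*) [CommRing R] [IsNoetherianRing R] [IsLocalRing R] :
    ∃ k : ℕ, ringKrullDim R = k := by
  have h1 := ringKrullDim_ne_top (R := R)
  have h2 := ringKrullDim_ne_bot (R := R)
  obtain ⟨a, ha⟩ := WithBot.ne_bot_iff_exists.mp h2
  rw [← ha] at h1 ⊢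
  have h3 : a ≠ ⊤ := fun h => h1 (by rw [h]; rfl)
  obtain ⟨k, hk⟩ := ENat.ne_top_iff_exists.mp h3
  exact ⟨k, by rw [← hk]; rfl⟩

lemma exists_prime_dim (R : Type*) [CommRing R] [IsNoetherianRing R] [IsLocalRing R] :
    ∃ q : Ideal R, q.IsPrime ∧ ringKrullDim R ≤ ringKrullDim (R ⧸ q) := by
  let l := LTSeries.longestOf (PrimeSpectrum R)
  refine ⟨l.head.asIdeal, l.head.2, ?_⟩
  rw [ringKrullDim, Order.krullDim_eq_length_of_finiteDimensionalOrder, ringKrullDim_quotient]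
  have hm : ∀ i, l i ∈ PrimeSpectrum.zeroLocus (l.head.asIdeal : Set R) := fun i => by
    rw [PrimeSpectrum.mem_zeroLocus]
    exact l.monotone (Fin.zero_le i)
  let l' : LTSeries (PrimeSpectrum.zeroLocus (l.head.asIdeal : Set R)) :=
    { length := l.length
      toFun := fun i => ⟨l i, hm i⟩
      step := fun i => l.step i }
  exact Order.LTSeries.length_le_krullDim l'

lemma dim_le_length {R : Type*} [CommRing R] [IsNoetherianRing R] [IsLocalRing R] (l : List R)
    (h : maximalIdeal R = Ideal.ofList l) : ringKrullDim R ≤ l.length := by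
  refine (ringKrullDim_le_spanFinrank_maximalIdeal R).trans ?_
  rw [h]
  have : {r | r ∈ l}.Finite := l.finite_toSet
  have h1 := Submodule.spanFinrank_span_le_ncard_of_finite (R := R) this
  have h2 : {r | r ∈ l}.ncard ≤ l.length := by
    classical
    have : {r | r ∈ l} = (l.toFinset : Set R) := by ext; simp
    rw [this, Set.ncard_coe_finset]
    exact l.toFinset_card_le
  exact_mod_cast h1.trans h2

lemma quot_step {R : Type*} [CommRing R] [IsNoetherianRing R] [IsLocalRing R] (r : R) (l : List R)
    (h : maximalIdeal R = Ideal.ofList (r :: l)) (hd : ringKrullDim R = (l.length + 1 : ℕ)) :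
    ∃ _ : IsLocalRing (R ⧸ Ideal.span {r}),
      maximalIdeal (R ⧸ Ideal.span {r}) =
        Ideal.ofList (l.map (Ideal.Quotient.mk (Ideal.span {r}))) ∧
      ringKrullDim (R ⧸ Ideal.span {r}) = l.length := by
  have hr : r ∈ maximalIdeal R := by
    rw [h]; exact Ideal.subset_span (by simp)
  have hle : Ideal.span {r} ≤ maximalIdeal R := by
    rw [Ideal.span_le]; simpa using hr
  have : Nontrivial (R ⧸ Ideal.span {r}) := Ideal.Quotient.nontrivial_iff.mpr
    (fun e => (maximalIdeal.isMaximal R).ne_top (top_le_iff.mp (e ▸ hle)))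
  have hloc : IsLocalRing (R ⧸ Ideal.span {r}) :=
    IsLocalRing.of_surjective' (Ideal.Quotient.mk _) Ideal.Quotient.mk_surjective
  have hmax : maximalIdeal (R ⧸ Ideal.span {r}) =
        Ideal.ofList (l.map (Ideal.Quotient.mk (Ideal.span {r}))) := by
    have : maximalIdeal (R ⧸ Ideal.span {r}) =
        (maximalIdeal R).map (Ideal.Quotient.mk (Ideal.span {r})) := by
      symm
      refine IsLocalRing.eq_maximalIdeal ?_
      refine (Ideal.map_eq_top_or_isMaximal_of_surjective _ Ideal.Quotient.mk_surjective
        (maximalIdeal.isMaximal R)).resolve_left ?_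
      intro e
      have := congrArg (Ideal.comap (Ideal.Quotient.mk (Ideal.span {r}))) e
      rw [Ideal.comap_map_of_surjective _ Ideal.Quotient.mk_surjective, ← RingHom.ker_eq_comap_bot,
        Ideal.mk_ker, Ideal.comap_top, sup_eq_left.mpr hle] at this
      exact (maximalIdeal.isMaximal R).ne_top this
    rw [this, h, Ideal.map_ofList]
    simp
  refine ⟨hloc, hmax, le_antisymm ?_ ?_⟩
  · simpa using dim_le_length _ hmax
  · have h1 := Ideal.height_le_ringKrullDim_quotient_add_one hr
    rw [maximalIdeal_height_eq_ringKrullDim, hd] at h1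
    obtain ⟨k, hk⟩ := exists_nat_dim (R ⧸ Ideal.span {r})
    rw [hk] at h1 ⊢
    have : l.length + 1 ≤ k + 1 := by exact_mod_cast h1
    exact_mod_cast (by omega : l.length ≤ k)

lemma isDomain_of_list (n : ℕ) : ∀ {R : Type u} [CommRing R] [IsNoetherianRing R] [IsLocalRing R]
    (l : List R), l.length = n → maximalIdeal R = Ideal.ofList l → ringKrullDim R = n →
      IsDomain R := by
  induction n with
  | zero =>
    intro R _ _ _ l hl h hd
    obtain rfl := List.length_eq_zero_iff.mp hl
    have : IsField R := by
      rw [IsLocalRing.isField_iff_maximalIdeal_eq, h]; simp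
    exact this.isDomain
  | succ n ih =>
    intro R _ _ _ l hl h hd
    obtain ⟨r, l, rfl⟩ := List.exists_cons_of_length_eq_add_one hl
    have hl : l.length = n := by simpa using hl
    obtain ⟨hloc, hmax, hdim⟩ := quot_step r l h (by rw [hd, hl])
    have hdom : IsDomain (R ⧸ Ideal.span {r}) := ih _ (by simpa using hl) hmax (by rw [hdim, hl])
    have hr : r ∈ maximalIdeal R := by
      rw [h]; exact Ideal.subset_span (by simp)
    obtain ⟨q, hq, hqd⟩ := exists_prime_dim R
    have hrq : r ∉ q := by
      intro hrq
      have : Ideal.span {r} ≤ q := by rw [Ideal.span_le]; simpa using hrq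
      have := ringKrullDim_le_of_surjective (Ideal.Quotient.factor this)
        (Ideal.Quotient.factor_surjective this)
      have := hqd.trans this
      rw [hd, hdim, hl] at this
      have : n + 1 ≤ n := by exact_mod_cast this
      omega
    have : Nontrivial (R ⧸ q) := Ideal.Quotient.nontrivial_iff.mpr hq.ne_top
    have hlocq : IsLocalRing (R ⧸ q) :=
      IsLocalRing.of_surjective' (Ideal.Quotient.mk _) Ideal.Quotient.mk_surjective
    have hle : q ≤ Ideal.span {r} := by
      intro z hz
      by_contra hz'
      have hr' : Ideal.Quotient.mk q r ∈ maximalIdeal (R ⧸ q) := by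
        rw [mem_maximalIdeal, mem_nonunits_iff]
        intro hu
        rw [mem_maximalIdeal] at hr
        have : IsLocalHom (Ideal.Quotient.mk q) :=
          IsLocalHom.of_surjective _ Ideal.Quotient.mk_surjective
        exact hr (isUnit_of_map_unit _ _ hu)
      have h1 := Ideal.height_le_ringKrullDim_quotient_add_one hr'
      rw [maximalIdeal_height_eq_ringKrullDim] at h1
      let f : R ⧸ Ideal.span {r} →+* (R ⧸ q) ⧸ Ideal.span {Ideal.Quotient.mk q r} :=
        Ideal.Quotient.lift _ ((Ideal.Quotient.mk _).comp (Ideal.Quotient.mk q)) (by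
          intro a ha
          obtain ⟨b, rfl⟩ := Ideal.mem_span_singleton'.mp ha
          rw [RingHom.comp_apply, Ideal.Quotient.eq_zero_iff_mem, map_mul]
          exact Ideal.mul_mem_left _ _ (Ideal.mem_span_singleton_self _))
      have hf : Function.Surjective f := Ideal.Quotient.lift_surjective_of_surjective _ _
        (Ideal.Quotient.mk_surjective.comp Ideal.Quotient.mk_surjective)
      have h2 := ringKrullDim_succ_le_of_surjective f hf
        (r := Ideal.Quotient.mk _ z) (mem_nonZeroDivisors_of_ne_zero
          (by rwa [Ne, Ideal.Quotient.eq_zero_iff_mem])) (by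
            simp only [f, Ideal.Quotient.lift_mk, RingHom.comp_apply]
            rw [Ideal.Quotient.eq_zero_iff_mem.mpr hz, map_zero])
      have h3 := (hqd.trans h1).trans h2
      rw [hd, hdim, hl] at h3
      have : n + 1 ≤ n := by exact_mod_cast h3
      omega
    have hqb : q = ⊥ := by
      refine Submodule.eq_bot_of_le_smul_of_le_jacobson_bot (maximalIdeal R) q
        (IsNoetherian.noetherian q) ?_ (IsLocalRing.maximalIdeal_le_jacobson ⊥)
      intro z hz
      obtain ⟨b, rfl⟩ := Ideal.mem_span_singleton'.mp (hle hz)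
      have hb : b ∈ q := (hq.mem_or_mem hz).resolve_right hrq
      rw [mul_comm]
      exact Submodule.smul_mem_smul hr hb
    subst hqb
    exact (Ideal.Quotient.isDomain_iff_prime (⊥ : Ideal R)).mpr hq |>.toNontrivial |> fun _ =>
      (IsDomain.of_bot_isPrime R)



/-- `u, v` is a (weakly) regular sequence. -/
def PairReg {B : Type*} [CommRing B] (u v : B) : Prop :=
  (∀ b, u * b = 0 → b = 0) ∧ (∀ b c, v * b = u * c → ∃ d, b = u * d)

lemma PairReg.pow_left {B : Type*} [CommRing B] {u v : B} (h : PairReg u v) (n : ℕ) :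
    ∀ b, u ^ n * b = 0 → b = 0 := by
  induction n with
  | zero => intro b hb; simpa using hb
  | succ n ih => intro b hb; exact h.1 _ (ih _ (by rw [← hb]; ring))

lemma PairReg.pow {B : Type*} [CommRing B] {u v : B} (h : PairReg u v) (m n : ℕ) :
    ∀ b c, v ^ m * b = u ^ n * c → ∃ d, b = u ^ n * d := by
  have h1 : ∀ m, ∀ b c, v ^ m * b = u * c → ∃ d, b = u * d := by
    intro m
    induction m with
    | zero => intro b c hb; exact ⟨c, by simpa using hb⟩
    | succ m ih =>
      intro b c hb
      obtain ⟨d, hd⟩ := h.2 (v ^ m * b) c (by rw [← hb]; ring)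
      exact ih _ _ hd
  induction n with
  | zero => intro b c _; exact ⟨b, by simp⟩
  | succ n ih =>
    intro b c hb
    obtain ⟨d, rfl⟩ := h1 m b (u ^ n * c) (by rw [hb]; ring)
    obtain ⟨e, rfl⟩ := ih d c (by
      rw [← sub_eq_zero]; apply h.1; linear_combination hb)
    exact ⟨e, by ring⟩

lemma PairReg.colon {B : Type*} [CommRing B] {u v : B} (h : PairReg u v) (n k : ℕ) (f a b : B)
    (hf : (u * v) ^ k * f = u ^ (n + k) * a + v ^ (n + k) * b) :
    ∃ c d, f = u ^ n * c + v ^ n * d := by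
  obtain ⟨b', rfl⟩ := h.pow (n + k) k b (v ^ k * f - u ^ n * a) (by
    rw [mul_pow, pow_add] at hf; linear_combination -hf)
  have h1 := h.pow_left k (v ^ k * f - u ^ n * a - v ^ (n + k) * b') (by
    rw [mul_pow, pow_add u] at hf; linear_combination hf)
  obtain ⟨d, hd⟩ := h.pow k n (f - v ^ n * b') a (by rw [pow_add] at h1; linear_combination h1)
  exact ⟨d, b', by linear_combination hd⟩

lemma pairReg_of_list {R : Type u} [CommRing R] [IsNoetherianRing R] [IsLocalRing R]
    (a b : R) (l : List R) (h : maximalIdeal R = Ideal.ofList (a :: b :: l))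
    (hd : ringKrullDim R = (l.length + 2 : ℕ)) : PairReg a b := by
  have hdom : IsDomain R := isDomain_of_list _ _ rfl h (by rw [hd]; rfl)
  obtain ⟨hloc, hmax, hdim⟩ := quot_step a (b :: l) h (by rw [hd]; rfl)
  have hdom' : IsDomain (R ⧸ Ideal.span {a}) := isDomain_of_list _ _ rfl hmax (by simpa using hdim)
  refine ⟨fun c hc => ?_, fun c d hc => ?_⟩
  · refine (mul_eq_zero.mp hc).resolve_left ?_
    rintro rfl
    have : maximalIdeal R = Ideal.ofList (b :: l) := by
      rw [h, Ideal.ofList_cons]; simp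
    have := dim_le_length _ this
    rw [hd] at this
    have : l.length + 2 ≤ l.length + 1 := by exact_mod_cast this
    omega
  · have hc' : Ideal.Quotient.mk (Ideal.span {a}) b * Ideal.Quotient.mk (Ideal.span {a}) c = 0 := by
      rw [← map_mul, Ideal.Quotient.eq_zero_iff_mem, hc]
      exact Ideal.mul_mem_right _ _ (Ideal.mem_span_singleton_self _)
    have hc2 := (mul_eq_zero.mp hc').resolve_left (by
      intro hb
      rw [List.map_cons, Ideal.ofList_cons, hb] at hmax
      have : maximalIdeal (R ⧸ Ideal.span {a}) = Ideal.ofList (l.map (Ideal.Quotient.mk _)) := by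
        rw [hmax]; simp
      have := dim_le_length _ this
      rw [hdim] at this
      simp only [List.length_map, List.length_cons] at this
      have : l.length + 1 ≤ l.length := by exact_mod_cast this
      omega)
    rw [Ideal.Quotient.eq_zero_iff_mem] at hc2
    obtain ⟨e, rfl⟩ := Ideal.mem_span_singleton'.mp hc2
    exact ⟨e, mul_comm _ _⟩

open TensorProduct in
lemma exists_map {S : Type*} [CommRing S] {N : Type*} [AddCommGroup N] [Module S N]
    [Module.Finite S N] (p : PrimeSpectrum S) (hp : p ∈ Module.support S N) :
    ∃ φ : N →ₗ[S] S ⧸ p.asIdeal, φ ≠ 0 := by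
  rw [Module.mem_support_iff_nontrivial_residueField_tensorProduct] at hp
  set K := p.asIdeal.ResidueField
  have : ∃ z : N, (1 : K) ⊗ₜ[S] z ≠ 0 := by
    by_contra! hz
    obtain ⟨w, hw⟩ := exists_ne (0 : K ⊗[S] N)
    apply hw
    induction w with
    | zero => rfl
    | add x y hx hy =>
      have : ∀ w : K ⊗[S] N, w = 0 := by
        intro w
        induction w with
        | zero => rfl
        | add x y hx hy => rw [hx, hy, add_zero]
        | tmul a b =>
          have := congrArg (fun t => a • t) (hz b)
          simpa [TensorProduct.smul_tmul'] using this
      exact this _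
    | tmul a b =>
      have := congrArg (fun t => a • t) (hz b)
      simpa [TensorProduct.smul_tmul'] using this
  obtain ⟨z, hz⟩ := this
  obtain ⟨f, hf⟩ : ∃ f : Module.Dual K (K ⊗[S] N), f (1 ⊗ₜ z) ≠ 0 := by
    by_contra! h
    exact hz ((Module.forall_dual_apply_eq_zero_iff K _).mp h)
  let g : N →ₗ[S] K := (f.restrictScalars S) ∘ₗ (TensorProduct.mk S K N 1)
  obtain ⟨s, hs⟩ := (inferInstance : Module.Finite S N)
  classical
  obtain ⟨b, hb⟩ := IsLocalization.exist_integer_multiples_of_finset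
    (nonZeroDivisors (S ⧸ p.asIdeal)) (s.image g)
  let g' : N →ₗ[S] K := (LinearMap.lsmul (S ⧸ p.asIdeal) K b.1).restrictScalars S ∘ₗ g
  let ι : (S ⧸ p.asIdeal) →ₗ[S] K := (Algebra.linearMap (S ⧸ p.asIdeal) K).restrictScalars S
  have hι : Function.Injective ι := IsFractionRing.injective (S ⧸ p.asIdeal) K
  have hg' : ∀ n, g' n ∈ LinearMap.range ι := by
    intro n
    have : n ∈ Submodule.span S (s : Set N) := hs ▸ Submodule.mem_top
    suffices Submodule.span S (s : Set N) ≤ (LinearMap.range ι).comap g' from this ‹_›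
    rw [Submodule.span_le]
    intro m hm
    obtain ⟨c, hc⟩ := hb (g m) (Finset.mem_image_of_mem _ hm)
    exact ⟨c, hc⟩
  let e := LinearEquiv.ofInjective ι hι
  refine ⟨e.symm.toLinearMap ∘ₗ g'.codRestrict _ hg', fun h0 => ?_⟩
  have h1 := LinearMap.congr_fun h0 z
  simp only [LinearMap.comp_apply, LinearEquiv.coe_coe, LinearMap.zero_apply,
    LinearEquiv.map_eq_zero_iff] at h1
  have h2 : g' z = 0 := congrArg Subtype.val h1
  have h3 : algebraMap (S ⧸ p.asIdeal) K b.1 * f (1 ⊗ₜ z) = 0 := by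
    rw [← Algebra.smul_def]; exact h2
  have h4 := (mul_eq_zero.mp h3).resolve_right hf
  have h5 : (b.1 : S ⧸ p.asIdeal) = 0 := hι (by rw [map_zero]; exact h4)
  exact nonZeroDivisors.coe_ne_zero b h5

lemma lower_algebra {S : Type u} [CommRing S] [IsNoetherianRing S] [IsLocalRing S]
    (x y u v : S)
    (hgen : IsLocalRing.maximalIdeal S = Ideal.span {x, y, u, v})
    (hdim : ringKrullDim S = 4)
    (N : Type*) [AddCommGroup N] [Module S N] (hfg : Module.Finite S N)
    (hsupp : Module.support S N =
      PrimeSpectrum.zeroLocus (Ideal.span {x * u + y * v} : Set S)) :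
    ∃ (z : N) (n : ℕ), ∀ (k : ℕ) (a b : N),
      (u * v) ^ k • z ≠ u ^ (n + k) • a + v ^ (n + k) • b := by
  have h0 : maximalIdeal S = Ideal.ofList [x, y, u, v] := by
    rw [hgen, Ideal.ofList]; congr 1; ext; simp
  obtain ⟨hl1, hm1, hd1⟩ := quot_step x [y, u, v] h0 (by rw [hdim]; rfl)
  simp only [List.map_cons, List.map_nil] at hm1
  let T := S ⧸ Ideal.span {x}
  let y' : T := Ideal.Quotient.mk _ y
  obtain ⟨hl2, hm2, hd2⟩ := quot_step _ _ hm1 (by rw [hd1]; rfl)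
  simp only [List.map_cons, List.map_nil] at hm2
  let B := T ⧸ Ideal.span {y'}
  change IsLocalRing B at hl2
  let π : S →+* B := (Ideal.Quotient.mk (Ideal.span {y'})).comp (Ideal.Quotient.mk (Ideal.span {x}))
  have hπ : Function.Surjective π :=
    Ideal.Quotient.mk_surjective.comp Ideal.Quotient.mk_surjective
  change maximalIdeal B = Ideal.ofList [π u, π v] at hm2
  change ringKrullDim B = _ at hd2
  have hB : IsDomain B := isDomain_of_list _ _ rfl hm2 (by rw [hd2]; rfl)
  have hreg : PairReg (π u) (π v) := pairReg_of_list _ _ [] hm2 (by rw [hd2]; rfl)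
  have hx : π x = 0 := by
    have : Ideal.Quotient.mk (Ideal.span {x}) x = 0 := by
      rw [Ideal.Quotient.eq_zero_iff_mem]; exact Ideal.mem_span_singleton_self _
    simp only [π, RingHom.comp_apply, this, map_zero]
  have hy : π y = 0 := by
    change Ideal.Quotient.mk (Ideal.span {y'}) y' = 0
    rw [Ideal.Quotient.eq_zero_iff_mem]; exact Ideal.mem_span_singleton_self _
  let p : PrimeSpectrum S := ⟨RingHom.ker π, RingHom.ker_isPrime π⟩
  have hp : p ∈ Module.support S N := by
    rw [hsupp, PrimeSpectrum.mem_zeroLocus]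
    change Ideal.span {x * u + y * v} ≤ RingHom.ker π
    rw [Ideal.span_le, Set.singleton_subset_iff]
    simp [RingHom.mem_ker, hx, hy]
  obtain ⟨φ, hφ⟩ := exists_map p hp
  obtain ⟨z, hz⟩ : ∃ z, φ z ≠ 0 := by
    by_contra! h
    exact hφ (LinearMap.ext h)
  let e : S ⧸ p.asIdeal ≃+* B := RingHom.quotientKerEquivOfSurjective hπ
  have he : ∀ (s : S) (m : N), e (φ (s • m)) = π s * e (φ m) := by
    intro s m
    rw [map_smul, Algebra.smul_def, map_mul]
    rfl
  have hez : e (φ z) ≠ 0 := by simpa using hz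
  have hkrull := Ideal.iInf_pow_eq_bot_of_isLocalRing (maximalIdeal B)
    (maximalIdeal.isMaximal B).ne_top
  have : ∃ n, e (φ z) ∉ maximalIdeal B ^ n := by
    by_contra! h
    apply hez
    rw [← Ideal.mem_bot, ← hkrull, Ideal.mem_iInf]
    exact h
  obtain ⟨n, hn⟩ := this
  refine ⟨z, n, fun k a b hab => hn ?_⟩
  have h1 := congrArg (fun t => e (φ t)) hab
  simp only [map_add] at h1
  rw [he, he, he] at h1
  simp only [map_pow, map_mul] at h1
  obtain ⟨c, d, hcd⟩ := hreg.colon n k _ _ _ h1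
  rw [hcd]
  have hu : π u ∈ maximalIdeal B := by rw [hm2]; exact Ideal.subset_span (by simp)
  have hv : π v ∈ maximalIdeal B := by rw [hm2]; exact Ideal.subset_span (by simp)
  exact Ideal.add_mem _ (Ideal.mul_mem_right _ _ (Ideal.pow_mem_pow hu n))
    (Ideal.mul_mem_right _ _ (Ideal.pow_mem_pow hv n))

lemma pairReg_uv {S : Type u} [CommRing S] [IsNoetherianRing S] [IsLocalRing S]
    (x y u v : S)
    (hgen : IsLocalRing.maximalIdeal S = Ideal.span {x, y, u, v})
    (hdim : ringKrullDim S = 4) : PairReg u v := by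
  refine pairReg_of_list u v [x, y] ?_ (by rw [hdim]; rfl)
  rw [hgen, Ideal.ofList]
  congr 1
  ext t
  simp only [Set.mem_insert_iff, Set.mem_singleton_iff, List.mem_cons, List.not_mem_nil, or_false,
    Set.mem_ofPred_eq]
  tauto



open CategoryTheory CategoryTheory.Limits

section Koszul

variable {S : Type u} [CommRing S]

/-- Objects of the Koszul complex on two elements. -/
def kX (S : Type u) [CommRing S] : ℕ → ModuleCat.{u} S
  | 0 => ModuleCat.of S S
  | 1 => ModuleCat.of S (S × S)
  | 2 => ModuleCat.of S S
  | _ + 3 => ModuleCat.of S PUnit.{u + 1}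

/-- First Koszul differential. -/
def kd1 (a b : S) : S × S →ₗ[S] S := LinearMap.coprod (LinearMap.lsmul S S a) (LinearMap.lsmul S S b)

/-- Second Koszul differential. -/
def kd2 (a b : S) : S →ₗ[S] S × S := LinearMap.prod (LinearMap.lsmul S S b) (LinearMap.lsmul S S (-a))

lemma kd1_apply (a b : S) (p : S × S) : kd1 a b p = a * p.1 + b * p.2 := by simp [kd1]

lemma kd2_apply (a b : S) (s : S) : kd2 a b s = (b * s, -a * s) := by simp [kd2]

/-- Differentials of the Koszul complex. -/
def kd (a b : S) : (i j : ℕ) → (kX S i ⟶ kX S j)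
  | 1, 0 => ModuleCat.ofHom (kd1 a b)
  | 2, 1 => ModuleCat.ofHom (kd2 a b)
  | _, _ => 0

/-- The Koszul complex on two elements. -/
def kos (a b : S) : ChainComplex (ModuleCat.{u} S) ℕ where
  X := kX S
  d := kd a b
  shape i j h := by
    match i, j with
    | 1, 0 => exact absurd rfl h
    | 2, 1 => exact absurd rfl h
    | 0, _ => rfl
    | 1, _ + 1 => rfl
    | 2, 0 => rfl
    | 2, _ + 2 => rfl
    | _ + 3, _ => rfl
  d_comp_d' i j k hij hjk := by
    obtain rfl : i = j + 1 := hij.symm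
    obtain rfl : j = k + 1 := hjk.symm
    match k with
    | 0 =>
      change ModuleCat.ofHom (kd2 a b) ≫ ModuleCat.ofHom (kd1 a b) = 0
      ext
      change kd1 a b (kd2 a b 1) = 0
      rw [kd1_apply, kd2_apply]; ring
    | k + 1 =>
      change (0 : kX S (k + 3) ⟶ kX S (k + 2)) ≫ _ = 0
      simp

lemma kos_projective (a b : S) (i : ℕ) : Projective ((kos a b).X i) := by
  match i with
  | 0 => exact ModuleCat.projective_of_free (M := ModuleCat.of S S) (Module.Basis.singleton Unit S)
  | 1 =>
    have : Module.Projective S (S × S) := inferInstance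
    exact (IsProjective.iff_projective (R := S) (S × S)).mp this
  | 2 => exact ModuleCat.projective_of_free (M := ModuleCat.of S S) (Module.Basis.singleton Unit S)
  | i + 3 =>
    have : Module.Projective S PUnit.{u + 1} := inferInstance
    exact (IsProjective.iff_projective (R := S) PUnit.{u+1}).mp this

lemma kos_isZero (a b : S) (i : ℕ) : IsZero ((kos a b).X (i + 3)) :=
  ModuleCat.isZero_of_subsingleton (ModuleCat.of S PUnit.{u + 1})

/-- augmentation -/
def kaug (a b : S) : (kos a b).X 0 ⟶ ModuleCat.of S (S ⧸ Ideal.span {a, b}) :=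
  ModuleCat.ofHom (X := S) (Submodule.mkQ (Ideal.span {a, b}))

lemma kd_aug (a b : S) : (kos a b).d 1 0 ≫ kaug a b = 0 := by
  change ModuleCat.ofHom (kd1 a b) ≫ ModuleCat.ofHom _ = 0
  refine ModuleCat.hom_ext (LinearMap.ext fun (p : S × S) => ?_)
  change Submodule.mkQ (Ideal.span {a, b}) (kd1 a b p) = 0
  rw [Submodule.mkQ_apply, Submodule.Quotient.mk_eq_zero, kd1_apply, Ideal.mem_span_pair]
  exact ⟨p.1, p.2, by ring⟩

/-- Condition for exactness of the Koszul complex. -/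
def KosReg (a b : S) : Prop :=
  (∀ c, a * c = 0 → c = 0) ∧ (∀ c d, b * c = a * d → ∃ e, c = a * e)

lemma kos_exact1 (a b : S) (h : KosReg a b) : (kos a b).ExactAt 1 := by
  rw [HomologicalComplex.exactAt_iff' _ 2 1 0 (by simp) (by simp),
    ShortComplex.moduleCat_exact_iff]
  intro (p : S × S) (hp : kd1 a b p = 0)
  rw [kd1_apply] at hp
  obtain ⟨e, he⟩ := h.2 p.2 (-p.1) (by linear_combination hp)
  have h1 : p.1 + b * e = 0 := h.1 _ (by rw [he] at hp; linear_combination hp)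
  refine ⟨(-e : S), ?_⟩
  change kd2 a b (-e) = p
  rw [kd2_apply]
  ext
  · simp only []; linear_combination -h1
  · simp only []; linear_combination -he

lemma kos_exact2 (a b : S) (h : KosReg a b) : (kos a b).ExactAt 2 := by
  rw [HomologicalComplex.exactAt_iff' _ 3 2 1 (by simp) (by simp),
    ShortComplex.moduleCat_exact_iff]
  intro (s : S) (hs : kd2 a b s = 0)
  rw [kd2_apply, Prod.mk_eq_zero] at hs
  have : s = 0 := h.1 s (by linear_combination -hs.2)
  subst this
  exact ⟨0, map_zero _⟩

lemma kos_exact (a b : S) (h : KosReg a b) (n : ℕ) : (kos a b).ExactAt (n + 1) := by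
  match n with
  | 0 => exact kos_exact1 a b h
  | 1 => exact kos_exact2 a b h
  | n + 2 =>
    rw [HomologicalComplex.exactAt_iff]
    exact ShortComplex.exact_of_isZero_X₂ _ (kos_isZero a b n)

/-- The map from the Koszul complex to the quotient. -/
noncomputable def kπ (a b : S) : kos a b ⟶
    (ChainComplex.single₀ (ModuleCat.{u} S)).obj (ModuleCat.of S (S ⧸ Ideal.span {a, b})) :=
  (ChainComplex.toSingle₀Equiv _ _).symm ⟨kaug a b, kd_aug a b⟩

lemma kπ_f_zero (a b : S) : (kπ a b).f 0 = kaug a b := by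
  simp [kπ]

lemma kos_exact0 (a b : S) : (ShortComplex.mk _ _ (kd_aug a b)).Exact := by
  rw [ShortComplex.moduleCat_exact_iff]
  intro (s : S) (hs : Submodule.mkQ (Ideal.span {a, b}) s = 0)
  rw [Submodule.mkQ_apply, Submodule.Quotient.mk_eq_zero, Ideal.mem_span_pair] at hs
  obtain ⟨c, d, hcd⟩ := hs
  refine ⟨((c, d) : S × S), ?_⟩
  change kd1 a b (c, d) = s
  rw [kd1_apply, ← hcd]
  ring

lemma kaug_epi (a b : S) : Epi (kaug a b) := by
  rw [ModuleCat.epi_iff_surjective]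
  exact Submodule.mkQ_surjective _

/-- The Koszul resolution. -/
noncomputable def kres (a b : S) (h : KosReg a b) :
    ProjectiveResolution (ModuleCat.of S (S ⧸ Ideal.span {a, b})) where
  complex := kos a b
  projective := kos_projective a b
  π := kπ a b
  quasiIso := ⟨fun n => by
    cases n
    · rw [ChainComplex.quasiIsoAt₀_iff, ShortComplex.quasiIso_iff_of_zeros']
      · refine (ShortComplex.exact_and_epi_g_iff_of_iso ?_).2
          ⟨kos_exact0 a b, kaug_epi a b⟩
        refine ShortComplex.isoMk (Iso.refl _) (Iso.refl _) (Iso.refl _) ?_ ?_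
        · exact (Category.id_comp _).trans (Category.comp_id _).symm
        · change 𝟙 _ ≫ kaug a b = (kπ a b).f 0 ≫ 𝟙 _
          rw [kπ_f_zero]
          exact (Category.id_comp _).trans (Category.comp_id _).symm
      all_goals rfl
    · rw [quasiIsoAt_iff_exactAt']
      · exact kos_exact a b h _
      · apply ChainComplex.exactAt_succ_single_obj⟩

/-- Maps of Koszul complexes, objectwise. -/
def kmapf (c d : S) : (i : ℕ) → (kX S i ⟶ kX S i)
  | 0 => 𝟙 _
  | 1 => ModuleCat.ofHom (X := S × S) (Y := S × S)
      (LinearMap.prodMap (LinearMap.lsmul S S c) (LinearMap.lsmul S S d))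
  | 2 => ModuleCat.ofHom (X := S) (Y := S) (LinearMap.lsmul S S (c * d))
  | _ + 3 => 0

/-- Maps of Koszul complexes. -/
def kmap (a b c d : S) : kos (a * c) (b * d) ⟶ kos a b where
  f := kmapf c d
  comm' i j hij := by
    obtain rfl : i = j + 1 := hij.symm
    match j with
    | 0 =>
      refine ModuleCat.hom_ext (LinearMap.ext fun (p : S × S) => ?_)
      change kd1 a b (c * p.1, d * p.2) = kd1 (a * c) (b * d) p
      simp only [kd1_apply]; ring
    | 1 =>
      refine ModuleCat.hom_ext (LinearMap.ext fun (p : S) => ?_)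
      change kd2 a b ((c * d) * p) =
        (c * (kd2 (a * c) (b * d) p).1, d * (kd2 (a * c) (b * d) p).2)
      simp only [kd2_apply]
      ext
      · simp only []; ring
      · simp only []; ring
    | j + 2 => exact (kos_isZero _ _ j).eq_of_src _ _

end Koszul


section Derived

variable {C D : Type*} [Category* C] [Category* D] [Abelian C] [Abelian D]

lemma isIso_π (K : ChainComplex D ℕ) (h : IsZero (K.X 3)) : IsIso (K.homologyπ 2) :=
  K.isIso_homologyπ 3 2 (by simp) (h.eq_of_src _ _)

/-- The inclusion of homology in top degree. -/
noncomputable def gtop (K : ChainComplex D ℕ) (h : IsZero (K.X 3)) : K.homology 2 ⟶ K.X 2 :=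
  have := isIso_π K h
  inv (K.homologyπ 2) ≫ K.iCycles 2

lemma gtop_comp (K : ChainComplex D ℕ) (h : IsZero (K.X 3)) : gtop K h ≫ K.d 2 1 = 0 := by
  simp [gtop]

lemma gtop_exact (K : ChainComplex D ℕ) (h : IsZero (K.X 3)) :
    (ShortComplex.mk _ _ (gtop_comp K h)).Exact := by
  have := isIso_π K h
  have h1 : (ShortComplex.mk (K.iCycles 2) (K.d 2 1) (by simp)).Exact :=
    ShortComplex.exact_of_f_is_kernel _ (K.cyclesIsKernel 2 1 (by simp))
  refine ShortComplex.exact_of_iso ?_ h1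
  exact ShortComplex.isoMk (asIso (K.homologyπ 2)) (Iso.refl _) (Iso.refl _)
    (by simp [gtop]) (by simp)

lemma gtop_nat (K L : ChainComplex D ℕ) (hK : IsZero (K.X 3)) (hL : IsZero (L.X 3)) (φ : K ⟶ L) :
    HomologicalComplex.homologyMap φ 2 ≫ gtop L hL = gtop K hK ≫ φ.f 2 := by
  have := isIso_π K hK
  have := isIso_π L hL
  rw [← cancel_epi (K.homologyπ 2)]
  simp [gtop]

variable [HasProjectiveResolutions C]

lemma fc_isZero (K : ChainComplex C ℕ) (i : ℕ) (h : IsZero (K.X i)) (F : C ⥤ D) [F.Additive] :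
    IsZero (((F.mapHomologicalComplex (ComplexShape.down ℕ)).obj K).X i) := F.map_isZero h

/-- Top derived functor embedding. -/
noncomputable def tau {X : C} (P : ProjectiveResolution X) (hP : IsZero (P.complex.X 3))
    (F : C ⥤ D) [F.Additive] : (F.leftDerived 2).obj X ⟶
      ((F.mapHomologicalComplex (ComplexShape.down ℕ)).obj P.complex).X 2 :=
  (P.isoLeftDerivedObj F 2).hom ≫
    gtop ((F.mapHomologicalComplex (ComplexShape.down ℕ)).obj P.complex) (fc_isZero _ _ hP F)

lemma tau_comp {X : C} (P : ProjectiveResolution X) (hP : IsZero (P.complex.X 3))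
    (F : C ⥤ D) [F.Additive] : tau P hP F ≫
      ((F.mapHomologicalComplex (ComplexShape.down ℕ)).obj P.complex).d 2 1 = 0 := by
  have := gtop_comp ((F.mapHomologicalComplex _).obj P.complex) (fc_isZero _ _ hP F)
  refine (Category.assoc _ _ _).trans ?_
  exact (congrArg (fun t => (P.isoLeftDerivedObj F 2).hom ≫ t) this).trans comp_zero

lemma tau_exact {X : C} (P : ProjectiveResolution X) (hP : IsZero (P.complex.X 3))
    (F : C ⥤ D) [F.Additive] : (ShortComplex.mk _ _ (tau_comp P hP F)).Exact := by
  refine ShortComplex.exact_of_iso (Iso.symm ?_)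
    (gtop_exact ((F.mapHomologicalComplex _).obj P.complex) (fc_isZero _ _ hP F))
  refine ShortComplex.isoMk (P.isoLeftDerivedObj F 2) (Iso.refl _) (Iso.refl _) ?_ ?_
  · exact (Category.comp_id _).symm
  · exact (Category.id_comp _).trans (Category.comp_id _).symm

lemma tau_nat {X Y : C} (f : X ⟶ Y) (P : ProjectiveResolution X) (Q : ProjectiveResolution Y)
    (hP : IsZero (P.complex.X 3)) (hQ : IsZero (Q.complex.X 3))
    (φ : P.complex ⟶ Q.complex) (comm : φ.f 0 ≫ Q.π.f 0 = P.π.f 0 ≫ f)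
    (F : C ⥤ D) [F.Additive] :
    (F.leftDerived 2).map f ≫ tau Q hQ F =
      tau P hP F ≫ ((F.mapHomologicalComplex (ComplexShape.down ℕ)).map φ).f 2 := by
  have h1 := ProjectiveResolution.isoLeftDerivedObj_hom_naturality f P Q φ comm F 2
  have h2 := gtop_nat _ _ (fc_isZero _ _ hP F) (fc_isZero _ _ hQ F)
    ((F.mapHomologicalComplex (ComplexShape.down ℕ)).map φ)
  refine (Category.assoc _ _ _).symm.trans ?_
  refine Eq.trans ?_ (Category.assoc _ _ _).symm
  refine (congrArg (fun t => t ≫ gtop _ (fc_isZero _ _ hQ F)) h1).trans ?_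
  refine (Category.assoc _ _ _).trans ?_
  exact congrArg (fun t => (P.isoLeftDerivedObj F 2).hom ≫ t) h2

lemma leftDerived_zero {X : C} (P : ProjectiveResolution X) (i : ℕ) (hP : IsZero (P.complex.X i))
    (F : C ⥤ D) [F.Additive] : IsZero ((F.leftDerived i).obj X) := by
  refine IsZero.of_iso ?_ (P.isoLeftDerivedObj F i)
  change IsZero (HomologicalComplex.homology _ i)
  rw [← HomologicalComplex.exactAt_iff_isZero_homology, HomologicalComplex.exactAt_iff]
  exact ShortComplex.exact_of_isZero_X₂ _ (F.map_isZero hP)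

end Derived

section ExtKos

open Opposite

variable {S : Type u} [CommRing S]

lemma ext_zero {X : ModuleCat.{u} S} (P : ProjectiveResolution X) (i : ℕ)
    (hP : IsZero (P.complex.X i)) (N : ModuleCat.{u} S) :
    IsZero (((Ext S (ModuleCat.{u} S) i).obj (op X)).obj N) :=
  (leftDerived_zero P i hP ((linearYoneda S (ModuleCat.{u} S)).obj N).rightOp).unop

/-- The map from cochains to `Ext`. -/
noncomputable def toExt {X : ModuleCat.{u} S} (P : ProjectiveResolution X)
    (hP : IsZero (P.complex.X 3)) (N : ModuleCat.{u} S) :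
    ModuleCat.of S (P.complex.X 2 ⟶ N) ⟶ ((Ext S (ModuleCat.{u} S) 2).obj (op X)).obj N :=
  (tau P hP ((linearYoneda S (ModuleCat.{u} S)).obj N).rightOp).unop

lemma toExt_eq_zero {X : ModuleCat.{u} S} (P : ProjectiveResolution X)
    (hP : IsZero (P.complex.X 3)) (N : ModuleCat.{u} S) (f : P.complex.X 2 ⟶ N)
    (hf : toExt P hP N f = 0) : ∃ g : P.complex.X 1 ⟶ N, P.complex.d 2 1 ≫ g = f := by
  have := (tau_exact P hP ((linearYoneda S (ModuleCat.{u} S)).obj N).rightOp).unop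
  rw [ShortComplex.moduleCat_exact_iff] at this
  exact this f hf

lemma toExt_nat {X Y : ModuleCat.{u} S} (f : X ⟶ Y) (P : ProjectiveResolution X)
    (Q : ProjectiveResolution Y)
    (hP : IsZero (P.complex.X 3)) (hQ : IsZero (Q.complex.X 3))
    (φ : P.complex ⟶ Q.complex) (comm : φ.f 0 ≫ Q.π.f 0 = P.π.f 0 ≫ f) (N : ModuleCat.{u} S)
    (g : Q.complex.X 2 ⟶ N) :
    ((Ext S (ModuleCat.{u} S) 2).map f.op).app N (toExt Q hQ N g) =
      toExt P hP N (φ.f 2 ≫ g) := by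
  have := congrArg Quiver.Hom.unop
    (tau_nat f P Q hP hQ φ comm ((linearYoneda S (ModuleCat.{u} S)).obj N).rightOp)
  exact ConcreteCategory.congr_hom this g

end ExtKos


section Final

open Opposite localCohomology

variable {S : Type u} [CommRing S]

lemma q_anti (a b : S) {m n : ℕ} (h : m ≤ n) :
    Ideal.span {a ^ n, b ^ n} ≤ Ideal.span {a ^ m, b ^ m} := by
  rw [Ideal.span_le]
  intro t ht
  rcases ht with rfl | rfl
  · exact Ideal.mem_of_dvd _ (pow_dvd_pow a h) (Ideal.subset_span (by simp))
  · exact Ideal.mem_of_dvd _ (pow_dvd_pow b h) (Ideal.subset_span (by simp))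

/-- The diagram of ideals `(a^n, b^n)`. -/
def qDiag (a b : S) : ℕᵒᵖ ⥤ Ideal S where
  obj t := Ideal.span {a ^ unop t, b ^ unop t}
  map w := ⟨⟨q_anti a b w.unop.down.down⟩⟩

lemma q_le_pow (a b : S) (n : ℕ) : Ideal.span {a ^ n, b ^ n} ≤ Ideal.span {a, b} ^ n := by
  rw [Ideal.span_le]
  intro t ht
  rcases ht with rfl | rfl
  · exact Ideal.pow_mem_pow (Ideal.subset_span (by simp)) n
  · exact Ideal.pow_mem_pow (Ideal.subset_span (by simp)) n

lemma le_rad_q (a b : S) (n : ℕ) :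
    Ideal.span {a, b} ≤ (Ideal.span {a ^ n, b ^ n}).radical := by
  rw [Ideal.span_le]
  intro t ht
  rcases ht with rfl | rfl
  · exact ⟨n, Ideal.subset_span (by simp)⟩
  · exact ⟨n, Ideal.subset_span (by simp)⟩

/-- Lift of `qDiag`. -/
def qToRad (a b : S) : ℕᵒᵖ ⥤ SelfLERadical (Ideal.span {a, b}) :=
  ObjectProperty.lift _ (qDiag a b) fun k => le_rad_q a b (unop k)

lemma q_initial [hR : IsNoetherian S S] (a b : S) : Functor.Initial (qToRad a b) where
  out J' := by
    apply +allowSynthFailures zigzag_isConnected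
    · obtain ⟨k, hk⟩ := Ideal.exists_pow_le_of_le_radical_of_fg J'.2 (isNoetherian_def.mp hR _)
      exact ⟨CostructuredArrow.mk
        (⟨⟨⟨(q_le_pow a b k).trans hk⟩⟩⟩ : (qToRad a b).obj (op k) ⟶ J')⟩
    · intro j1 j2
      apply Relation.ReflTransGen.single
      rcases le_total (unop j1.left) (unop j2.left) with h | h
      · right; exact ⟨CostructuredArrow.homMk (homOfLE h).op rfl⟩
      · left; exact ⟨CostructuredArrow.homMk (homOfLE h).op rfl⟩

/-- Local cohomology through the diagram `(a^n, b^n)`. -/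
noncomputable def lcIso [IsNoetherian S S] (a b : S) (i : ℕ) :
    localCohomology (Ideal.span {a, b}) i ≅ ofDiagram.{u, 0} (qDiag a b) i :=
  have := q_initial a b
  (isoSelfLERadical _ i).symm ≪≫
    (localCohomology.isoOfFinal.{u, u, 0} (qToRad a b)
      (selfLERadicalDiagram.{u} (Ideal.span {a, b})) i).symm ≪≫
      HasColimit.isoOfNatIso.{0, 0, u + 1, u + 1} (Iso.refl.{u + 1, u + 1} _)

/-- Evaluated version. -/
noncomputable def lcObjIso [IsNoetherian S S] (a b : S) (i : ℕ) (N : ModuleCat.{u} S) :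
    (localCohomology (Ideal.span {a, b}) i).obj N ≅
      colimit (diagram (qDiag a b) i ⋙ (evaluation _ _).obj N) :=
  (lcIso a b i).app N ≪≫ colimitObjIsoColimitCompEvaluation (diagram (qDiag a b) i) N

lemma PairReg.kosReg {a b : S} (h : PairReg a b) (n : ℕ) : KosReg (a ^ n) (b ^ n) :=
  ⟨h.pow_left n, h.pow n n⟩

lemma lc_zero [IsNoetherian S S] (a b : S) (h : PairReg a b) (i : ℕ) (N : ModuleCat.{u} S) :
    IsZero ((localCohomology (Ideal.span {a, b}) (i + 3)).obj N) := by
  refine IsZero.of_iso ?_ (lcObjIso a b (i + 3) N)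
  rw [IsZero.iff_id_eq_zero]
  refine colimit.hom_ext fun j => ?_
  refine IsZero.eq_of_src ?_ _ _
  exact ext_zero (kres _ _ (h.kosReg (unop (unop j)))) (i + 3) (kos_isZero _ _ i) N

/-- Maps of Koszul complexes, with equalities. -/
def kmap' (a b c d a' b' : S) (ha : a' = a * c) (hb : b' = b * d) : kos a' b' ⟶ kos a b where
  f := kmapf c d
  comm' i j hij := by
    subst ha hb
    exact (kmap a b c d).comm' i j hij

lemma lc_two [IsNoetherian S S] (a b : S) (h : PairReg a b) (N : ModuleCat.{u} S)
    (z : N) (n : ℕ) (hz : ∀ (k : ℕ) (c d : N),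
      (a * b) ^ k • z ≠ a ^ (n + k) • c + b ^ (n + k) • d) :
    Nontrivial ((localCohomology (Ideal.span {a, b}) 2).obj N) := by
  by_contra hnt
  rw [not_nontrivial_iff_subsingleton] at hnt
  have hz0 : IsZero (colimit (diagram (qDiag a b) 2 ⋙ (evaluation _ _).obj N)) :=
    IsZero.of_iso (ModuleCat.isZero_of_subsingleton _) (lcObjIso a b 2 N).symm
  have hsub := ModuleCat.subsingleton_of_isZero hz0
  let Fd := diagram (qDiag a b) 2 ⋙ (evaluation _ _).obj N
  let P (m : ℕ) := kres _ _ (h.kosReg m)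
  have hP (m : ℕ) : IsZero ((P m).complex.X 3) := kos_isZero _ _ 0
  let f : (P n).complex.X 2 ⟶ N := ModuleCat.ofHom (X := S) (LinearMap.toSpanSingleton S N z)
  let e : Fd.obj (op (op n)) := toExt (P n) (hP n) N f
  have := preservesFilteredColimitsOfSize_shrink.{0, u, 0, u} (forget (ModuleCat.{u} S))
  have : PreservesColimitsOfShape ((ℕᵒᵖ)ᵒᵖ) (forget (ModuleCat.{u} S)) :=
    PreservesFilteredColimitsOfSize.preserves_filtered_colimits _
  obtain ⟨j, w, hj⟩ := Concrete.colimit_rep_eq_zero S Fd (op (op n)) e (hsub.elim _ _)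
  obtain ⟨⟨m⟩⟩ := j
  have hnm : n ≤ m := w.unop.unop.down.down
  obtain ⟨k, rfl⟩ := Nat.exists_eq_add_of_le hnm
  let φ : (P (n + k)).complex ⟶ (P n).complex :=
    kmap' (a ^ n) (b ^ n) (a ^ k) (b ^ k) _ _ (pow_add _ _ _) (pow_add _ _ _)
  let q := (ringModIdeals (qDiag a b)).map w.unop
  have comm : φ.f 0 ≫ (P n).π.f 0 = (P (n + k)).π.f 0 ≫ q := by
    change φ.f 0 ≫ (kπ _ _).f 0 = (kπ _ _).f 0 ≫ q
    rw [kπ_f_zero, kπ_f_zero]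
    rfl
  have h1 := toExt_nat q (P (n + k)) (P n) (hP _) (hP _) φ comm N f
  have h2 : toExt (P (n + k)) (hP _) N (φ.f 2 ≫ f) = 0 := h1.symm.trans hj
  obtain ⟨g, hg⟩ := toExt_eq_zero _ _ _ _ h2
  let g' : S × S →ₗ[S] N := g.hom
  have h3 : g' (kd2 (a ^ (n + k)) (b ^ (n + k)) 1) = ((a ^ k * b ^ k) * 1) • z :=
    ConcreteCategory.congr_hom hg (1 : S)
  refine hz k (-g' (0, 1)) (g' (1, 0)) ?_
  rw [kd2_apply] at h3
  have h4 : ((b ^ (n + k) * 1, -a ^ (n + k) * 1) : S × S) =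
      b ^ (n + k) • (1, 0) - a ^ (n + k) • (0, 1) := by
    ext <;> simp
  rw [h4, map_sub, map_smul, map_smul] at h3
  rw [mul_pow, ← mul_one (a ^ k * b ^ k), ← h3, smul_neg]
  abel

end Final

end CdAux

/-- Let `(S, n)` be a regular local ring of dimension 4 with regular system of
parameters `x, y, u, v`, and set `a := x*u + y*v`.  Then for every finitely generated `S`-module
`N` with `Supp N = V(aS)`, one has `cd((u,v)S, N) = 2`. -/
theorem cd_eq_two_of_support_eq {S : Type u} [CommRing S] [IsNoetherianRing S] [IsLocalRing S]
    (x y u v : S)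
    (hgen : IsLocalRing.maximalIdeal S = Ideal.span {x, y, u, v})
    (hdim : ringKrullDim S = 4)
    (N : ModuleCat.{u} S) (hfg : Module.Finite S N)
    (hsupp : Module.support S N =
      PrimeSpectrum.zeroLocus (Ideal.span {x * u + y * v} : Set S)) :
    cohomologicalDim (Ideal.span {u, v}) N = 2 := by
  have hpr := CdAux.pairReg_uv x y u v hgen hdim
  obtain ⟨z, n, hz⟩ := CdAux.lower_algebra x y u v hgen hdim N hfg hsupp
  have h2 := CdAux.lc_two u v hpr N z n hz
  unfold cohomologicalDim
  refine le_antisymm (sSup_le ?_) (le_sSup ⟨2, h2, rfl⟩)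
  rintro _ ⟨i, hi, rfl⟩
  by_cases hi3 : i ≤ 2
  · have : ((i : ℕ∞)) ≤ 2 := by exact_mod_cast hi3
    exact WithBot.coe_le_coe.mpr this
  · exfalso
    obtain ⟨k, rfl⟩ := Nat.exists_eq_add_of_le' (show 3 ≤ i by omega)
    have hs := ModuleCat.subsingleton_of_isZero (CdAux.lc_zero u v hpr k N)
    have hi' : Nontrivial ((localCohomology (Ideal.span {u, v}) (k + 3)).obj N) := hi
    exact not_nontrivial_iff_subsingleton.mpr hs hi'
end

section
/- Let (S, n) be a regular local ring of dimension 4, let x, y, u, v be a regular system of parameters for S, and set a := x·u + y·v. Then for every finitely generated S-module N with Supp N = V(aS), the support of the S-module H^2_{(u,v)S}(N) is exactly {n}. -/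
universe u
namespace Work

open IsLocalRing

theorem dim_le_length {A : Type u} [CommRing A] [IsNoetherianRing A] [IsLocalRing A] (l : List A)
    (h : maximalIdeal A = Ideal.ofList l) : ringKrullDim A ≤ l.length := by
  classical
  refine (ringKrullDim_le_spanFinrank_maximalIdeal A).trans ?_
  have h2 : maximalIdeal A = Submodule.span A (l.toFinset : Set A) := by
    rw [h, Ideal.ofList]; simp [Ideal.span]
  rw [h2]
  have := Submodule.spanFinrank_span_le_ncard_of_finite (R := A) (l.toFinset.finite_toSet)
  rw [Set.ncard_coe_finset] at this
  exact_mod_cast this.trans (List.toFinset_card_le l)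

theorem dim_quot {A : Type u} [CommRing A] [IsNoetherianRing A] [IsLocalRing A] (x : A)
    (hx : x ∈ maximalIdeal A) : ringKrullDim A ≤ ringKrullDim (A ⧸ Ideal.span {x}) + 1 := by
  have := ringKrullDim_le_ringKrullDim_quotient_add_card (R := A) {x}
    (by rw [IsLocalRing.ringJacobson_eq_maximalIdeal]; simpa using hx)
  rw [Finset.coe_singleton, Finset.card_singleton] at this
  exact_mod_cast this

theorem span_singleton_ne_top {A : Type u} [CommRing A] [IsLocalRing A] (x : A)
    (hx : x ∈ maximalIdeal A) : Ideal.span {x} ≠ ⊤ := by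
  intro h
  rw [Ideal.span_singleton_eq_top] at h
  exact hx h

theorem quot_local {A : Type u} [CommRing A] [IsLocalRing A] (x : A)
    (hx : x ∈ maximalIdeal A) : IsLocalRing (A ⧸ Ideal.span {x}) := by
  have : Nontrivial (A ⧸ Ideal.span {x}) :=
    Ideal.Quotient.nontrivial_iff.mpr (span_singleton_ne_top x hx)
  exact IsLocalRing.of_surjective' _ Ideal.Quotient.mk_surjective

theorem quot_max {A : Type u} [CommRing A] [IsLocalRing A] (x : A) (l : List A)
    (h : maximalIdeal A = Ideal.ofList (x :: l)) [IsLocalRing (A ⧸ Ideal.span {x})] :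
    maximalIdeal (A ⧸ Ideal.span {x}) = Ideal.ofList (l.map (Ideal.Quotient.mk (Ideal.span {x}))) := by
  rw [← Ideal.map_ofList]
  have h1 : (maximalIdeal A).map (Ideal.Quotient.mk (Ideal.span {x})) =
      maximalIdeal (A ⧸ Ideal.span {x}) := by
    have hl : IsLocalHom (Ideal.Quotient.mk (Ideal.span {x})) :=
      IsLocalHom.of_surjective _ Ideal.Quotient.mk_surjective
    rw [← IsLocalRing.maximalIdeal_comap (Ideal.Quotient.mk (Ideal.span {x}))]
    exact Ideal.map_comap_of_surjective _ Ideal.Quotient.mk_surjective _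
  rw [← h1, h, Ideal.ofList_cons, Ideal.map_sup, Ideal.map_span]
  have : (Ideal.Quotient.mk (Ideal.span {x})) x = 0 :=
    Ideal.Quotient.eq_zero_iff_mem.mpr (Ideal.mem_span_singleton_self x)
  simp [this]

theorem quot_dim {A : Type u} [CommRing A] [IsNoetherianRing A] [IsLocalRing A] (x : A) (n : ℕ)
    (hx : x ∈ maximalIdeal A) (hd : ((n + 1 : ℕ) : WithBot ℕ∞) ≤ ringKrullDim A) :
    (n : WithBot ℕ∞) ≤ ringKrullDim (A ⧸ Ideal.span {x}) := by
  have := hd.trans (dim_quot x hx)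
  push_cast at this
  exact (ENat.WithBot.add_le_add_one_right_iff).mp this

theorem domain_of_not_minimal {A : Type u} [CommRing A] [IsNoetherianRing A] [IsLocalRing A] (x : A)
    (hx : x ∈ maximalIdeal A) (hP : (Ideal.span {x}).IsPrime)
    (hm : Ideal.span {x} ∉ minimalPrimes A) : IsDomain A := by
  obtain ⟨p, hp, hle⟩ := Ideal.exists_minimalPrimes_le (I := ⊥) (J := Ideal.span {x}) bot_le
  have hpp : p.IsPrime := hp.1.1
  have hxp : x ∉ p := by
    intro h
    apply hm
    have : p = Ideal.span {x} := le_antisymm hle ((Ideal.span_singleton_le_iff_mem p).2 h)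
    rw [← this]; exact hp
  have : p = ⊥ := by
    refine Submodule.eq_bot_of_le_smul_of_le_jacobson_bot (Ideal.span {x}) p
      (IsNoetherian.noetherian p) ?_ ?_
    · intro z hz
      obtain ⟨w, rfl⟩ := Ideal.mem_span_singleton.1 (hle hz)
      have hw : w ∈ p := (hpp.mem_or_mem hz).resolve_left hxp
      exact Submodule.smul_mem_smul (Ideal.mem_span_singleton_self x) hw
    · rw [IsLocalRing.jacobson_eq_maximalIdeal _ bot_ne_top]
      exact (Ideal.span_singleton_le_iff_mem _).2 hx
  rw [this] at hpp
  exact IsDomain.of_bot_isPrime A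

theorem regular_domain (n : ℕ) : ∀ (A : Type u) [CommRing A] [IsNoetherianRing A] [IsLocalRing A]
    (l : List A), l.length = n → maximalIdeal A = Ideal.ofList l →
    (n : WithBot ℕ∞) ≤ ringKrullDim A → IsDomain A := by
  induction n with
  | zero =>
    intro A _ _ _ l hl h _
    obtain rfl := List.length_eq_zero_iff.1 hl
    rw [Ideal.ofList_nil] at h
    exact ((IsLocalRing.isField_iff_maximalIdeal_eq).2 h).isDomain
  | succ n ih =>
    intro A _ _ _ l hl h hd
    have key : ∀ (x : A) (l' : List A), l'.length = n → maximalIdeal A = Ideal.ofList (x :: l') →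
        x ∈ maximalIdeal A ∧ (Ideal.span {x}).IsPrime := by
      intro x l' hl' h'
      have hx : x ∈ maximalIdeal A := by
        rw [h', Ideal.ofList_cons]
        exact Ideal.mem_sup_left (Ideal.mem_span_singleton_self x)
      refine ⟨hx, ?_⟩
      have := quot_local x hx
      have := ih (A ⧸ Ideal.span {x}) (l'.map (Ideal.Quotient.mk (Ideal.span {x}))) (by simpa using hl')
        (quot_max x l' h') (quot_dim x n hx hd)
      exact (Ideal.Quotient.isDomain_iff_prime _).1 this
    match l, hl with
    | [x], hl =>
      obtain ⟨hx, hP⟩ := key x [] (by simp at hl ⊢; omega) h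
      refine domain_of_not_minimal x hx hP fun hmin => ?_
      have e : maximalIdeal A = Ideal.span {x} := by simpa using h
      have h0 : (maximalIdeal A).height = 0 := by
        rw [Ideal.height_eq_zero_iff, e]; exact hmin
      rw [← maximalIdeal_height_eq_ringKrullDim, h0] at hd
      have : (n + 1 : ℕ) ≤ 0 := by exact_mod_cast hd
      omega
    | x :: y :: l', hl =>
      by_contra hnd
      have hk : ∀ k : ℕ, maximalIdeal A = Ideal.ofList ((x + y ^ (k + 1)) :: y :: l') := by
        intro k
        rw [h]
        simp only [Ideal.ofList_cons, ← sup_assoc]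
        congr 1
        rw [← Ideal.span_union, ← Ideal.span_union]
        apply le_antisymm <;> rw [Ideal.span_le]
        · rintro z (rfl | rfl)
          · have h1 : (z + y ^ (k+1)) ∈ Ideal.span ({z + y ^ (k+1)} ∪ {y} : Set A) := Ideal.subset_span (by simp)
            have h2 := sub_mem h1 (Ideal.mul_mem_left _ _ (Ideal.subset_span (show y ∈ _ by simp)) : y ^ k * y ∈ Ideal.span ({z + y ^ (k+1)} ∪ {y} : Set A))
            have h3 : (z + y ^ (k+1)) - y ^ k * y = z := by ring
            rwa [h3] at h2
          · exact Ideal.subset_span (by simp)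
        · rintro z (rfl | rfl)
          · rw [pow_succ]
            exact add_mem (Ideal.subset_span (by simp)) (Ideal.mul_mem_left _ _ (Ideal.subset_span (by simp)))
          · exact Ideal.subset_span (by simp)
      have hmin : ∀ k : ℕ, Ideal.span {x + y ^ (k + 1)} ∈ minimalPrimes A := by
        intro k
        by_contra hc
        obtain ⟨h1, h2⟩ := key _ _ (by simpa using hl) (hk k)
        exact hnd (domain_of_not_minimal _ h1 h2 hc)
      have hfin := minimalPrimes.finite_of_isNoetherianRing A
      have : ∃ k j : ℕ, k < j ∧ Ideal.span {x + y ^ (k + 1)} = Ideal.span {x + y ^ (j + 1)} := by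
        by_contra! hne
        refine Set.infinite_of_injective_forall_mem (f := fun k : ℕ => Ideal.span {x + y ^ (k + 1)})
          ?_ hmin hfin
        intro k j hkj
        rcases lt_trichotomy k j with h1 | h1 | h1
        · exact (hne _ _ h1 hkj).elim
        · exact h1
        · exact (hne _ _ h1 hkj.symm).elim
      obtain ⟨k, j, hkj, he⟩ := this
      obtain ⟨h1, hP⟩ := key _ _ (by simpa using hl) (hk k)
      have hy : y ∈ maximalIdeal A := by
        rw [h]; exact Ideal.subset_span (by simp)
      have hyP : y ∈ Ideal.span {x + y ^ (k + 1)} := by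
        have m1 : x + y ^ (j+1) ∈ Ideal.span {x + y ^ (k + 1)} := he ▸ Ideal.mem_span_singleton_self _
        have m2 := sub_mem (Ideal.mem_span_singleton_self (x + y ^ (k + 1))) m1
        obtain ⟨e, rfl⟩ := Nat.exists_eq_add_of_lt hkj
        have : x + y ^ (k + 1) - (x + y ^ (k + e + 1 + 1)) = y ^ (k+1) * (1 - y ^ (e+1)) := by ring
        rw [this] at m2
        rcases hP.mem_or_mem m2 with m | m
        · exact hP.mem_of_pow_mem _ m
        · exfalso
          have hle : Ideal.span {x + y ^ (k + 1)} ≤ maximalIdeal A :=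
            (Ideal.span_singleton_le_iff_mem _).2 h1
          have h3 := add_mem (hle m) (Ideal.pow_mem_of_mem _ hy (e+1) (by omega))
          rw [sub_add_cancel] at h3
          exact (Ideal.ne_top_iff_one _).1 (maximalIdeal.isMaximal A).ne_top h3
      have hfinal : maximalIdeal A = Ideal.ofList ((x + y ^ (k+1)) :: l') := by
        rw [hk k]
        simp only [Ideal.ofList_cons, ← sup_assoc]
        congr 1
        exact sup_eq_left.2 ((Ideal.span_singleton_le_iff_mem _).2 hyP)
      have h4 := hd.trans (dim_le_length _ hfinal)
      have h5 : n + 1 ≤ ((x + y ^ (k+1)) :: l').length := by exact_mod_cast h4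
      simp at hl h5
      omega


theorem regular_pair {A : Type u} [CommRing A] [IsNoetherianRing A] [IsLocalRing A] (p q : A)
    (l : List A) (h : maximalIdeal A = Ideal.ofList (p :: q :: l))
    (hd : ((l.length + 2 : ℕ) : WithBot ℕ∞) ≤ ringKrullDim A) :
    IsDomain A ∧ Prime p ∧ ¬ p ∣ q := by
  have hp : p ∈ maximalIdeal A := by rw [h]; exact Ideal.subset_span (by simp)
  have hdom := regular_domain (l.length + 2) A _ (by simp) h hd
  have := quot_local p hp
  have hdom2 := regular_domain (l.length + 1) (A ⧸ Ideal.span {p}) _ (by simp) (quot_max p _ h)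
    (quot_dim p _ hp hd)
  have hprime := (Ideal.Quotient.isDomain_iff_prime _).1 hdom2
  have hp0 : p ≠ 0 := by
    rintro rfl
    have h' : maximalIdeal A = Ideal.ofList (q :: l) := by
      rw [h, Ideal.ofList_cons]; simp
    have h1 := hd.trans (dim_le_length _ h')
    have h2 : l.length + 2 ≤ (q :: l).length := by exact_mod_cast h1
    simp at h2
  refine ⟨hdom, (Ideal.span_singleton_prime hp0).1 hprime, fun hpq => ?_⟩
  have h' : maximalIdeal A = Ideal.ofList (p :: l) := by
    rw [h]
    simp only [Ideal.ofList_cons, ← sup_assoc]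
    congr 1
    exact sup_eq_left.2 ((Ideal.span_singleton_le_iff_mem _).2 (Ideal.mem_span_singleton.2 hpq))
  have h1 := hd.trans (dim_le_length _ h')
  have h2 : l.length + 2 ≤ (p :: l).length := by exact_mod_cast h1
  simp at h2

theorem ofList_perm {A : Type u} [CommRing A] {l l' : List A} (h : ∀ z, z ∈ l ↔ z ∈ l') :
    Ideal.ofList l = Ideal.ofList l' := by
  unfold Ideal.ofList
  congr 1
  ext z; exact h z

theorem exists_quot {A : Type u} [CommRing A] [IsNoetherianRing A] [IsLocalRing A] (x : A)
    (l : List A) (h : maximalIdeal A = Ideal.ofList (x :: l)) (n : ℕ)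
    (hd : ((n + 1 : ℕ) : WithBot ℕ∞) ≤ ringKrullDim A) :
    ∃ (B : Type u) (_ : CommRing B) (_ : IsNoetherianRing B) (_ : IsLocalRing B) (f : A →+* B),
      f x = 0 ∧ maximalIdeal B = Ideal.ofList (l.map f) ∧ (n : WithBot ℕ∞) ≤ ringKrullDim B := by
  have m1 : x ∈ maximalIdeal A := by rw [h]; exact Ideal.subset_span (by simp)
  have loc1 := quot_local _ m1
  exact ⟨A ⧸ Ideal.span {x}, inferInstance, inferInstance, loc1, Ideal.Quotient.mk _,
    Ideal.Quotient.eq_zero_iff_mem.mpr (Ideal.mem_span_singleton_self _), quot_max _ _ h,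
    quot_dim _ _ m1 hd⟩

theorem exists_T {S : Type u} [CommRing S] [IsNoetherianRing S] [IsLocalRing S] (x y u v : S)
    (hgen : maximalIdeal S = Ideal.span {x, y, u, v}) (hdim : ringKrullDim S = 4) :
    ∃ (T : Type u) (_ : CommRing T) (_ : IsNoetherianRing T) (_ : IsLocalRing T) (_ : IsDomain T)
      (f : S →+* T), f u = f y ∧ f v = - f x ∧ Prime (f u) ∧ Prime (f v) ∧ ¬ f u ∣ f v ∧
        ¬ f v ∣ f u := by
  have h1 : maximalIdeal S = Ideal.ofList [u - y, v + x, u, v] := by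
    rw [hgen, Ideal.ofList]
    apply le_antisymm <;> rw [Ideal.span_le]
    · have hu : u ∈ Ideal.span {r | r ∈ [u - y, v + x, u, v]} := Ideal.subset_span (by simp)
      have hv : v ∈ Ideal.span {r | r ∈ [u - y, v + x, u, v]} := Ideal.subset_span (by simp)
      have huy : u - y ∈ Ideal.span {r | r ∈ [u - y, v + x, u, v]} := Ideal.subset_span (by simp)
      have hvx : v + x ∈ Ideal.span {r | r ∈ [u - y, v + x, u, v]} := Ideal.subset_span (by simp)
      rintro z (rfl | rfl | rfl | rfl)
      · simpa using sub_mem hvx hv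
      · simpa using sub_mem hu huy
      · exact hu
      · exact hv
    · have hx : x ∈ Ideal.span {x, y, u, v} := Ideal.subset_span (by simp)
      have hy : y ∈ Ideal.span {x, y, u, v} := Ideal.subset_span (by simp)
      have hu : u ∈ Ideal.span {x, y, u, v} := Ideal.subset_span (by simp)
      have hv : v ∈ Ideal.span {x, y, u, v} := Ideal.subset_span (by simp)
      intro z hz
      simp only [List.mem_cons, List.not_mem_nil, or_false, Set.mem_ofPred_eq] at hz
      rcases hz with (rfl | rfl | rfl | rfl)
      · exact sub_mem hu hy
      · exact add_mem hv hx
      · exact hu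
      · exact hv
  obtain ⟨A, _, _, _, f1, k1, h2, d2⟩ := exists_quot (u - y) _ h1 3 (by rw [hdim]; rfl)
  simp only [List.map_cons, List.map_nil] at h2
  obtain ⟨B, _, _, _, f2, k2, h3, d3⟩ := exists_quot _ _ h2 2 d2
  simp only [List.map_cons, List.map_nil] at h3
  obtain ⟨dom, p1, p2⟩ := regular_pair _ _ [] h3 d3
  obtain ⟨-, p3, p4⟩ := regular_pair (f2 (f1 v)) (f2 (f1 u)) []
    (h3.trans (ofList_perm (by intro z; simp [or_comm]))) d3
  refine ⟨B, inferInstance, inferInstance, inferInstance, dom, f2.comp f1, ?_, ?_, p1, p3, p2, p4⟩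
  · rw [map_sub, sub_eq_zero] at k1
    simp [k1]
  · rw [map_add, map_add] at k2
    exact eq_neg_of_add_eq_zero_left k2

open TensorProduct in
theorem exists_functional {S T : Type u} [CommRing S] [CommRing T] [IsDomain T] (f : S →+* T)
    (N : Type u) [AddCommGroup N] [Module S N] [Module.Finite S N]
    (h : (⟨RingHom.ker f, RingHom.ker_isPrime f⟩ : PrimeSpectrum S) ∈ Module.support S N) :
    ∃ φ : N → T, (∀ z w, φ (z + w) = φ z + φ w) ∧ (∀ (s : S) z, φ (s • z) = f s * φ z) ∧
      ∃ z, φ z ≠ 0 := by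
  set P := RingHom.ker f
  have hP : P.IsPrime := RingHom.ker_isPrime f
  rw [Module.mem_support_iff_nontrivial_residueField_tensorProduct] at h
  change Nontrivial (P.ResidueField ⊗[S] N) at h
  obtain ⟨w, hw⟩ := exists_ne (0 : P.ResidueField ⊗[S] N)
  obtain ⟨ℓ, hℓ⟩ : ∃ ℓ : Module.Dual P.ResidueField (P.ResidueField ⊗[S] N), ℓ w ≠ 0 := by
    by_contra! hc
    exact hw ((Module.forall_dual_apply_eq_zero_iff _ w).1 hc)
  let g : N →ₗ[S] P.ResidueField :=
    (ℓ.restrictScalars S) ∘ₗ (TensorProduct.mk S P.ResidueField N 1)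
  have hg : ∃ z, g z ≠ 0 := by
    by_contra! hc
    apply hℓ
    have : ∀ w, ℓ w = 0 := by
      intro w
      induction w with
      | zero => simp
      | add a b ha hb => rw [map_add, ha, hb, add_zero]
      | tmul a z =>
        have e : a ⊗ₜ[S] z = a • ((1 : P.ResidueField) ⊗ₜ[S] z) := by
          rw [TensorProduct.smul_tmul', smul_eq_mul, mul_one]
        rw [e, map_smul]
        have : ℓ ((1 : P.ResidueField) ⊗ₜ[S] z) = 0 := hc z
        rw [this, smul_zero]
    exact this w
  obtain ⟨z0, hz0⟩ := hg
  obtain ⟨G, hG⟩ := Module.Finite.fg_top (R := S) (M := N)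
  obtain ⟨d, hd⟩ := IsLocalization.exist_integer_multiples (nonZeroDivisors (S ⧸ P)) G g
  have alg_smul : ∀ (r : S) (s : S ⧸ P), algebraMap (S ⧸ P) P.ResidueField (r • s) =
      r • algebraMap (S ⧸ P) P.ResidueField s := fun r s =>
    (Algebra.linearMap (S ⧸ P) P.ResidueField).map_smul_of_tower r s
  have hall : ∀ z, ∃ t : S ⧸ P, algebraMap (S ⧸ P) P.ResidueField t = (d : S ⧸ P) • g z := by
    intro z
    have hz : z ∈ Submodule.span S (G : Set N) := by rw [hG]; trivial
    induction hz using Submodule.span_induction with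
    | mem z hz => exact hd z hz
    | zero => exact ⟨0, by simp⟩
    | add a b _ _ ha hb =>
      obtain ⟨s, hs⟩ := ha
      obtain ⟨t, ht⟩ := hb
      exact ⟨s + t, by rw [map_add, hs, ht, map_add, smul_add]⟩
    | smul r a _ ha =>
      obtain ⟨s, hs⟩ := ha
      exact ⟨r • s, by rw [alg_smul, hs, map_smul, smul_comm]⟩
  choose ψ hψ using hall
  have inj := IsFractionRing.injective (S ⧸ P) P.ResidueField
  let k : S ⧸ P →+* T := Ideal.Quotient.lift P f (fun a ha => ha)
  have hk : Function.Injective k := RingHom.lift_injective_of_ker_le_ideal P _ le_rfl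
  refine ⟨fun z => k (ψ z), ?_, ?_, z0, ?_⟩
  · intro z w
    change k (ψ (z + w)) = k (ψ z) + k (ψ w)
    rw [← map_add]
    congr 1
    apply inj
    rw [map_add, hψ, hψ, hψ, map_add, smul_add]
  · intro s z
    have e : f s = k (Ideal.Quotient.mk P s) := rfl
    change k (ψ (s • z)) = f s * k (ψ z)
    rw [e, ← map_mul]
    congr 1
    apply inj
    have e2 : Ideal.Quotient.mk P s * ψ z = s • ψ z := by rw [Algebra.smul_def]; rfl
    rw [e2, alg_smul, hψ, hψ, map_smul, smul_comm]
  · intro h0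
    have : ψ z0 = 0 := hk (h0.trans (map_zero k).symm)
    have h1 := hψ z0
    rw [this, map_zero, Algebra.smul_def] at h1
    rcases mul_eq_zero.1 h1.symm with h2 | h2
    · have := inj (h2.trans (map_zero _).symm)
      exact nonZeroDivisors.ne_zero d.2 this
    · exact hz0 h2

theorem cancel_pow {T : Type u} [CommRing T] [IsDomain T] (p q b c d : T) (hp : Prime p)
    (hq : Prime q) (hpq : ¬ p ∣ q) (hqp : ¬ q ∣ p) (n k : ℕ)
    (h : (p * q) ^ k * b = p ^ (n + k) * c + q ^ (n + k) * d) :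
    b ∈ Ideal.span {p ^ n, q ^ n} := by
  have h1 : p ^ k ∣ d := by
    refine hp.pow_dvd_of_dvd_mul_left k (a := q ^ (n+k)) (fun hh => hpq (hp.dvd_of_dvd_pow hh)) ?_
    exact ⟨q ^ k * b - p ^ n * c, by linear_combination (-1 : T) * h⟩
  have h2 : q ^ k ∣ c := by
    refine hq.pow_dvd_of_dvd_mul_left k (a := p ^ (n+k)) (fun hh => hqp (hq.dvd_of_dvd_pow hh)) ?_
    exact ⟨p ^ k * b - q ^ n * d, by linear_combination (-1 : T) * h⟩
  obtain ⟨d, rfl⟩ := h1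
  obtain ⟨c, rfl⟩ := h2
  have h3 : (p * q) ^ k * b = (p * q) ^ k * (c * p ^ n + d * q ^ n) := by rw [h]; ring
  have h4 := mul_left_cancel₀ (pow_ne_zero k (mul_ne_zero hp.ne_zero hq.ne_zero)) h3
  exact Ideal.mem_span_pair.2 ⟨c, d, h4.symm⟩

theorem nonvanishing {S : Type u} [CommRing S] [IsNoetherianRing S] [IsLocalRing S] (x y u v : S)
    (hgen : maximalIdeal S = Ideal.span {x, y, u, v}) (hdim : ringKrullDim S = 4)
    (N : Type u) [AddCommGroup N] [Module S N] [Module.Finite S N]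
    (hsupp : Module.support S N =
      PrimeSpectrum.zeroLocus (Ideal.span {x * u + y * v} : Set S))
    (hvan : ∀ (n : ℕ) (z : N), ∃ (k : ℕ) (z1 z2 : N),
      (u * v) ^ k • z = u ^ (n + k) • z1 + v ^ (n + k) • z2) : False := by
  obtain ⟨T, _, _, _, _, f, e1, e2, p1, p2, p3, p4⟩ := exists_T x y u v hgen hdim
  obtain ⟨φ, hadd, hsmul, z, hz⟩ := exists_functional f N (by
    rw [hsupp, PrimeSpectrum.mem_zeroLocus, SetLike.coe_subset_coe,
      Ideal.span_singleton_le_iff_mem]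
    change f _ = 0
    rw [map_add, map_mul, map_mul, e1, e2]; ring)
  apply hz
  have hm : ∀ n, φ z ∈ maximalIdeal T ^ n := by
    intro n
    obtain ⟨k, z1, z2, h⟩ := hvan n z
    have h' := congrArg φ h
    rw [hadd, hsmul, hsmul, hsmul, map_pow, map_mul, map_pow, map_pow] at h'
    refine (Ideal.span_le.2 ?_) (cancel_pow _ _ _ _ _ p1 p2 p3 p4 n k h')
    rintro w (rfl | rfl)
    · exact Ideal.pow_mem_pow ((mem_maximalIdeal _).2 p1.not_isUnit) n
    · exact Ideal.pow_mem_pow ((mem_maximalIdeal _).2 p2.not_isUnit) n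
  have := Ideal.iInf_pow_eq_bot_of_isLocalRing (maximalIdeal T) (maximalIdeal.isMaximal T).ne_top
  have h2 : φ z ∈ ⨅ i, maximalIdeal T ^ i := by simpa [Ideal.mem_iInf] using hm
  rw [this] at h2
  exact h2


end Work

noncomputable section

open CategoryTheory Limits Opposite

namespace Work

variable {S : Type u} [CommRing S]

/-- Terms of the Koszul complex on two elements. -/
def kosX (S : Type u) [CommRing S] : ℕ → ModuleCat.{u} S
  | 0 => ModuleCat.of S S
  | 1 => ModuleCat.of S (S × S)
  | 2 => ModuleCat.of S S
  | _ + 3 => ModuleCat.of S PUnit.{u + 1}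

def kosD1 (p q : S) : S × S →ₗ[S] S :=
  p • LinearMap.fst S S S + q • LinearMap.snd S S S

def kosD2 (p q : S) : S →ₗ[S] S × S :=
  LinearMap.prod (q • LinearMap.id) (-(p • LinearMap.id))

def kosd (p q : S) : ∀ i j, kosX S i ⟶ kosX S j
  | 1, 0 => ModuleCat.ofHom (kosD1 p q)
  | 2, 1 => ModuleCat.ofHom (kosD2 p q)
  | _, _ => 0

/-- The Koszul complex on two elements. -/
def kos (p q : S) : ChainComplex (ModuleCat.{u} S) ℕ where
  X := kosX S
  d := kosd p q
  shape i j h := by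
    match i, j, h with
    | 1, 0, h => exact (h rfl).elim
    | 2, 1, h => exact (h rfl).elim
    | 0, _, _ => rfl
    | 1, _ + 1, _ => rfl
    | 2, 0, _ => rfl
    | 2, _ + 2, _ => rfl
    | _ + 3, _, _ => rfl
  d_comp_d' i j k hij hjk := by
    obtain rfl : j + 1 = i := hij
    obtain rfl : k + 1 = j := hjk
    match k with
    | 0 =>
      change ModuleCat.ofHom (kosD2 p q) ≫ ModuleCat.ofHom (kosD1 p q) = 0
      rw [← ModuleCat.ofHom_comp]
      ext
      simp [kosD1, kosD2]
      ring
    | k + 1 =>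
      change (0 : kosX S (k+3) ⟶ _) ≫ _ = 0
      simp

/-- Map of Koszul complexes. -/
def kosMap (p q a b : S) : kos (a * p) (b * q) ⟶ kos p q where
  f i := match i with
    | 0 => 𝟙 (ModuleCat.of S S)
    | 1 => ModuleCat.ofHom (LinearMap.prodMap (a • LinearMap.id) (b • LinearMap.id))
    | 2 => ModuleCat.ofHom ((a * b) • (LinearMap.id : S →ₗ[S] S))
    | _ + 3 => 0
  comm' i j hij := by
    obtain rfl : j + 1 = i := hij
    match j with
    | 0 =>
      change ModuleCat.ofHom _ ≫ ModuleCat.ofHom (kosD1 p q) = ModuleCat.ofHom (kosD1 _ _) ≫ 𝟙 _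
      rw [Category.comp_id, ← ModuleCat.ofHom_comp]
      congr 1
      ext <;> simp [kosD1, mul_comm]
    | 1 =>
      change ModuleCat.ofHom _ ≫ ModuleCat.ofHom (kosD2 p q) = ModuleCat.ofHom (kosD2 _ _) ≫ ModuleCat.ofHom _
      rw [← ModuleCat.ofHom_comp, ← ModuleCat.ofHom_comp]
      congr 1
      ext <;> simp [kosD2] <;> ring
    | k + 2 =>
      change (0 : kosX S (k+3) ⟶ kosX S (k + 3)) ≫ _ = (0 : kosX S (k+3) ⟶ kosX S (k+2)) ≫ _
      exact zero_comp.trans zero_comp.symm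

/-- The augmentation. -/
def kosAug (p q : S) : (kos p q).X 0 ⟶ ModuleCat.of S (S ⧸ Ideal.span {p, q}) :=
  (ModuleCat.ofHom (Submodule.mkQ (Ideal.span {p, q})) :
    ModuleCat.of S S ⟶ ModuleCat.of S (S ⧸ Ideal.span {p, q}))

instance kosProj (p q : S) (n : ℕ) : Projective ((kos p q).X n) := by
  match n with
  | 0 => exact inferInstanceAs (Projective (ModuleCat.of S S))
  | 1 => exact inferInstanceAs (Projective (ModuleCat.of S (S × S)))
  | 2 => exact inferInstanceAs (Projective (ModuleCat.of S S))
  | _ + 3 => exact inferInstanceAs (Projective (ModuleCat.of S PUnit.{u + 1}))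

theorem kos_exact_succ [IsDomain S] (p q : S) (hp : p ≠ 0) (h : ∀ t, p ∣ q * t → p ∣ t) (n : ℕ) :
    (kos p q).ExactAt (n + 1) := by
  rw [HomologicalComplex.exactAt_iff' _ (n + 1 + 1) (n + 1) n (by simp) (by simp)]
  match n with
  | 0 =>
    rw [ShortComplex.moduleCat_exact_iff]
    rintro ⟨s, t⟩ (hst : kosD1 p q (s, t) = 0)
    replace hst : p * s + q * t = 0 := by simpa [kosD1] using hst
    obtain ⟨w, rfl⟩ := h t ⟨-s, by linear_combination hst⟩
    refine ⟨(-w : S), ?_⟩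
    change kosD2 p q (-w) = (s, p * w)
    have : s = - (q * w) := mul_left_cancel₀ hp (by linear_combination hst)
    ext <;> simp [kosD2, this]
  | 1 =>
    rw [ShortComplex.moduleCat_exact_iff]
    rintro (s : S) (hs : kosD2 p q s = 0)
    refine ⟨(0 : kosX S 3), ?_⟩
    change (0 : S) = s
    have := congrArg Prod.snd hs
    have h2 : p * s = 0 := by simpa [kosD2] using this
    exact ((mul_eq_zero.1 h2).resolve_left hp).symm
  | n + 2 =>
    apply ShortComplex.exact_of_isZero_X₂
    exact ModuleCat.isZero_of_subsingleton (ModuleCat.of S PUnit)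

theorem kos_d_aug (p q : S) : (kos p q).d 1 0 ≫ kosAug p q = 0 := by
  change ModuleCat.ofHom (kosD1 p q) ≫ ModuleCat.ofHom _ = 0
  rw [← ModuleCat.ofHom_comp]
  have : (Submodule.mkQ (Ideal.span {p, q})) ∘ₗ (kosD1 p q) = 0 := by
    apply LinearMap.ext
    rintro ⟨s, t⟩
    simp only [LinearMap.comp_apply, Submodule.mkQ_apply, LinearMap.zero_apply]
    rw [Submodule.Quotient.mk_eq_zero]
    exact Ideal.mem_span_pair.2 ⟨s, t, by simp [kosD1, mul_comm]⟩
  rw [this]; rfl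

def kosRes [IsDomain S] (p q : S) (hp : p ≠ 0) (h : ∀ t, p ∣ q * t → p ∣ t) :
    ProjectiveResolution (ModuleCat.of S (S ⧸ Ideal.span {p, q})) where
  complex := kos p q
  π := (ChainComplex.toSingle₀Equiv _ _).symm ⟨kosAug p q, kos_d_aug p q⟩
  quasiIso := ⟨fun n => by
    cases n
    · rw [ChainComplex.quasiIsoAt₀_iff, ShortComplex.quasiIso_iff_of_zeros']
      · refine (ShortComplex.exact_and_epi_g_iff_of_iso
          (S₂ := ShortComplex.mk _ _ (kos_d_aug p q)) ?_).2 ⟨?_, ?_⟩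
        · exact ShortComplex.isoMk (Iso.refl _) (Iso.refl _) (Iso.refl _) 
            ((Category.id_comp _).trans (Category.comp_id _).symm)
            (by simp; exact (Category.id_comp _).trans (Category.comp_id _).symm)
        · rw [ShortComplex.moduleCat_exact_iff]
          rintro (s : S) hs
          have hs' : s ∈ Ideal.span {p, q} := (Submodule.Quotient.mk_eq_zero _).1 hs
          obtain ⟨a, b, hab⟩ := Ideal.mem_span_pair.1 hs'
          refine ⟨(a, b), ?_⟩
          change kosD1 p q (a, b) = s
          rw [← hab]
          simp [kosD1, mul_comm]
        · dsimp
          rw [ModuleCat.epi_iff_surjective]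
          exact Submodule.mkQ_surjective _
      all_goals rfl
    · rw [quasiIsoAt_iff_exactAt']
      · exact kos_exact_succ p q hp h _
      · apply ChainComplex.exactAt_succ_single_obj⟩


section Iota

variable {D : Type*} [Category D] [Abelian D]

theorem isIso_pOp (K : ChainComplex D ℕ) (h : K.d 3 2 = 0) : IsIso (K.pOpcycles 2) :=
  K.isIso_pOpcycles 3 2 (by simp) h

/-- Top homology embeds in the top term. -/
def homIota (K : ChainComplex D ℕ) (h : K.d 3 2 = 0) : K.homology 2 ⟶ K.X 2 :=
  haveI := isIso_pOp K h
  K.homologyι 2 ≫ inv (K.pOpcycles 2)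

theorem homIota_p (K : ChainComplex D ℕ) (h : K.d 3 2 = 0) :
    homIota K h ≫ K.pOpcycles 2 = K.homologyι 2 := by
  have := isIso_pOp K h
  simp [homIota]

theorem homIota_d (K : ChainComplex D ℕ) (h : K.d 3 2 = 0) : homIota K h ≫ K.d 2 1 = 0 := by
  rw [← K.p_fromOpcycles 2 1, ← Category.assoc, homIota_p]
  simp

theorem homIota_mono (K : ChainComplex D ℕ) (h : K.d 3 2 = 0) : Mono (homIota K h) := by
  have := isIso_pOp K h
  unfold homIota
  infer_instance

theorem homIota_exact (K : ChainComplex D ℕ) (h : K.d 3 2 = 0) :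
    (ShortComplex.mk _ _ (homIota_d K h)).Exact := by
  have := isIso_pOp K h
  have h1 := ShortComplex.exact_of_f_is_kernel
    (ShortComplex.mk _ _ (K.homologyι_comp_fromOpcycles 2 1)) (K.homologyIsKernel 2 1 (by simp))
  let e : ShortComplex.mk _ _ (homIota_d K h) ≅
      ShortComplex.mk _ _ (K.homologyι_comp_fromOpcycles 2 1) :=
    ShortComplex.isoMk (Iso.refl _) (asIso (K.pOpcycles 2)) (Iso.refl _)
      (by simp [homIota_p]) (by simp)
  exact (ShortComplex.exact_iff_of_iso e).2 h1

theorem homIota_nat (K L : ChainComplex D ℕ) (h : K.d 3 2 = 0) (h' : L.d 3 2 = 0) (φ : K ⟶ L) :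
    HomologicalComplex.homologyMap φ 2 ≫ homIota L h' = homIota K h ≫ φ.f 2 := by
  have := isIso_pOp L h'
  rw [← cancel_mono (L.pOpcycles 2), Category.assoc, homIota_p, Category.assoc,
    ← HomologicalComplex.p_opcyclesMap, ← Category.assoc, homIota_p]
  simp

end Iota

section Ext2

/-- The contravariant Hom functor into `N`, with values in the opposite category. -/
abbrev yF (N : ModuleCat.{u} S) : ModuleCat.{u} S ⥤ (ModuleCat.{u} S)ᵒᵖ :=
  ((linearYoneda S (ModuleCat.{u} S)).obj N).rightOp

theorem map_d32 (F : ModuleCat.{u} S ⥤ (ModuleCat.{u} S)ᵒᵖ) [F.Additive]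
    {K : ChainComplex (ModuleCat.{u} S) ℕ} (hK : K.d 3 2 = 0) :
    ((F.mapHomologicalComplex (ComplexShape.down ℕ)).obj K).d 3 2 = 0 := by
  change F.map (K.d 3 2) = 0
  rw [hK, F.map_zero]

section gen

variable (F : ModuleCat.{u} S ⥤ (ModuleCat.{u} S)ᵒᵖ) [F.Additive] {X Y : ModuleCat.{u} S}
  (P : ProjectiveResolution X) (Q : ProjectiveResolution Y)
  (hP : P.complex.d 3 2 = 0) (hQ : Q.complex.d 3 2 = 0)

/-- The quotient map onto Ext, in the opposite category. -/
def qop : (F.leftDerived 2).obj X ⟶ F.obj (P.complex.X 2) :=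
  (P.isoLeftDerivedObj F 2).hom ≫ homIota _ (map_d32 F hP)

theorem qop_d : qop F P hP ≫ F.map (P.complex.d 2 1) = 0 := by
  unfold qop
  refine (Category.assoc _ _ _).trans ?_
  refine (congrArg _ (homIota_d _ (map_d32 F hP))).trans comp_zero

theorem qop_mono : Mono (qop F P hP) := by
  have := homIota_mono _ (map_d32 F hP)
  unfold qop
  exact @mono_comp _ _ _ _ _ _ inferInstance _ this

theorem qop_exact : (ShortComplex.mk _ _ (qop_d F P hP)).Exact := by
  let e : ShortComplex.mk _ _ (qop_d F P hP) ≅ ShortComplex.mk _ _ (homIota_d _ (map_d32 F hP)) :=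
    ShortComplex.isoMk (P.isoLeftDerivedObj F 2) (Iso.refl _) (Iso.refl _)
      (Category.comp_id _).symm ((Category.id_comp _).trans (Category.comp_id _).symm)
  exact (ShortComplex.exact_iff_of_iso e).2 (homIota_exact _ (map_d32 F hP))

theorem qop_nat (f : X ⟶ Y) (φ : P.complex ⟶ Q.complex)
    (comm : φ.f 0 ≫ Q.π.f 0 = P.π.f 0 ≫ f) :
    (F.leftDerived 2).map f ≫ qop F Q hQ = qop F P hP ≫ F.map (φ.f 2) := by
  have key := ProjectiveResolution.isoLeftDerivedObj_hom_naturality f P Q φ comm F 2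
  unfold qop
  refine (Category.assoc _ _ _).symm.trans ?_
  refine (congrArg (· ≫ homIota _ (map_d32 F hQ)) key).trans ?_
  refine (Category.assoc _ _ _).trans ?_
  refine Eq.trans ?_ (Category.assoc _ _ _).symm
  exact congrArg ((P.isoLeftDerivedObj F 2).hom ≫ ·)
    (homIota_nat _ _ (map_d32 F hP) (map_d32 F hQ) ((F.mapHomologicalComplex _).map φ))

end gen

/-- The conditions on a pair for the Koszul complex to be a resolution. -/
structure Good (p q : S) : Prop where
  ne : p ≠ 0
  reg : ∀ t, p ∣ q * t → p ∣ t

/-- The Ext module of interest. -/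
abbrev E2 (N : ModuleCat.{u} S) (p q : S) : ModuleCat.{u} S :=
  ((Ext S (ModuleCat.{u} S) 2).obj (op (ModuleCat.of S (S ⧸ Ideal.span {p, q})))).obj N

theorem span_le (p q a b : S) : Ideal.span {a * p, b * q} ≤ Ideal.span {p, q} := by
  rw [Ideal.span_le]
  rintro z (rfl | rfl)
  · exact Ideal.mul_mem_left _ _ (Ideal.subset_span (by simp))
  · exact Ideal.mul_mem_left _ _ (Ideal.subset_span (by simp))

/-- The quotient map. -/
def quotMap {I J : Ideal S} (h : I ≤ J) : ModuleCat.of S (S ⧸ I) ⟶ ModuleCat.of S (S ⧸ J) :=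
  ModuleCat.ofHom (Submodule.mapQ _ _ LinearMap.id h)

variable (N : ModuleCat.{u} S)

/-- The element of Hom(S, N) attached to `z`. -/
def elt : N →ₗ[S] (ModuleCat.of S S ⟶ N) where
  toFun z := (ModuleCat.ofHom (LinearMap.toSpanSingleton S N z) : ModuleCat.of S S ⟶ N)
  map_add' z w := by
    ext
    simp
  map_smul' s z := by
    ext
    simp

theorem elt_surj (g : ModuleCat.of S S ⟶ N) : elt N (g.hom (1 : S)) = g := by
  ext
  simp [elt]

theorem elt_one (z : N) : (elt N z).hom (1 : S) = z := by
  simp [elt]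

variable [IsDomain S]

/-- The map `N → Ext²`. -/
def psi (p q : S) (h : Good p q) : N →ₗ[S] E2 N p q :=
  (ModuleCat.Hom.hom (qop (yF N) (kosRes p q h.ne h.reg) rfl).unop) ∘ₗ elt N

theorem psi_surj (p q : S) (h : Good p q) : Function.Surjective (psi N p q h) := by
  have h1 := qop_mono (yF N) (kosRes p q h.ne h.reg) rfl
  have h2 : Epi (qop (yF N) (kosRes p q h.ne h.reg) rfl).unop := inferInstance
  rw [ModuleCat.epi_iff_surjective] at h2
  intro w
  obtain ⟨g, hg⟩ := h2 w
  change ModuleCat.of S S ⟶ N at g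
  refine ⟨g.hom (1 : S), ?_⟩
  rw [← hg]
  exact congrArg (ModuleCat.Hom.hom (qop (yF N) (kosRes p q h.ne h.reg) rfl).unop) (elt_surj N g)

theorem psi_eq_zero (p q : S) (h : Good p q) (z : N) :
    psi N p q h z = 0 ↔ ∃ z1 z2 : N, z = p • z1 + q • z2 := by
  have h1 := (qop_exact (yF N) (kosRes p q h.ne h.reg) rfl).unop
  replace h1 := (ShortComplex.ShortExact.moduleCat_exact_iff_function_exact _).1 h1
  refine (h1 (elt N z)).trans ?_
  constructor
  · rintro ⟨g, hg⟩
    change ModuleCat.of S (S × S) ⟶ N at g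
    have hg' : ModuleCat.ofHom (kosD2 p q) ≫ g = elt N z := hg
    refine ⟨- g.hom ((0, 1) : S × S), g.hom ((1, 0) : S × S), ?_⟩
    rw [← elt_one N z, ← hg']
    change g.hom (kosD2 p q 1) = _
    have : kosD2 p q 1 = p • (-(0, 1)) + q • (1, 0) := by
      ext <;> simp [kosD2]
    rw [this, map_add, map_smul, map_smul, map_neg]
  · rintro ⟨z1, z2, rfl⟩
    refine ⟨(ModuleCat.ofHom (LinearMap.coprod (LinearMap.toSpanSingleton S N z2)
      (LinearMap.toSpanSingleton S N (-z1))) : ModuleCat.of S (S × S) ⟶ N), ?_⟩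
    change ModuleCat.ofHom (kosD2 p q) ≫ _ = elt N _
    ext
    simp [kosD2, elt]
    rw [add_comm]

theorem psi_nat (p q a b : S) (h : Good p q) (h' : Good (a * p) (b * q)) (z : N) :
    (((Ext S (ModuleCat.{u} S) 2).map (quotMap (span_le p q a b)).op).app N).hom (psi N p q h z) =
      psi N (a * p) (b * q) h' ((a * b) • z) := by
  have key := qop_nat (yF N) (kosRes (a * p) (b * q) h'.ne h'.reg) (kosRes p q h.ne h.reg)
    rfl rfl (quotMap (span_le p q a b)) (kosMap p q a b) rfl
  have k2 := congrArg Quiver.Hom.unop key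
  have k3 := congrArg (fun f => ModuleCat.Hom.hom f (elt N z)) k2
  refine k3.trans ?_
  have hh : ModuleCat.ofHom ((a * b) • (LinearMap.id : S →ₗ[S] S)) ≫ elt N z =
      elt N ((a * b) • z) := by
    ext
    simp [elt]
  exact congrArg (ModuleCat.Hom.hom (qop (yF N) (kosRes (a * p) (b * q) h'.ne h'.reg) rfl).unop) hh

end Ext2


section LC

open localCohomology

/-- Powers, with convenient definitional unfolding. -/
def pw (a : S) : ℕ → S
  | 0 => 1
  | n + 1 => a * pw a n

theorem pw_eq (a : S) (n : ℕ) : pw a n = a ^ n := by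
  induction n with
  | zero => simp [pw]
  | succ n ih => simp [pow_succ', pw, ih]

/-- The ideal generated by the `n`th powers. -/
def Jn (a b : S) (n : ℕ) : Ideal S := Ideal.span {pw a n, pw b n}

theorem Jn_anti (a b : S) : Antitone (Jn a b) :=
  antitone_nat_of_succ_le fun n => span_le (pw a n) (pw b n) a b

theorem Jn_le_pow (a b : S) (n : ℕ) : Jn a b n ≤ (Ideal.span {a, b}) ^ n := by
  unfold Jn
  rw [Ideal.span_le]
  rintro z (rfl | rfl)
  · rw [pw_eq]; exact Ideal.pow_mem_pow (Ideal.subset_span (by simp)) n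
  · rw [pw_eq]; exact Ideal.pow_mem_pow (Ideal.subset_span (by simp)) n

theorem Jn_rad (a b : S) (n : ℕ) : Ideal.span {a, b} ≤ (Jn a b n).radical := by
  rw [Ideal.span_le]
  rintro z (rfl | rfl)
  · exact ⟨n, by rw [← pw_eq]; exact Ideal.subset_span (by simp)⟩
  · exact ⟨n, by rw [← pw_eq]; exact Ideal.subset_span (by simp)⟩

/-- The diagram of ideals. -/
def Jdiag (a b : S) : ℕᵒᵖ ⥤ Ideal S where
  obj t := Jn a b (unop t)
  map w := ⟨⟨Jn_anti a b w.unop.down.down⟩⟩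

/-- The lifted diagram. -/
def Jlift (a b : S) : ℕᵒᵖ ⥤ SelfLERadical (Ideal.span {a, b}) :=
  ObjectProperty.lift _ (Jdiag a b) fun k => Jn_rad a b (unop k)

theorem Jlift_initial [hR : IsNoetherianRing S] (a b : S) : Functor.Initial (Jlift a b) where
  out J' := by
    apply +allowSynthFailures zigzag_isConnected
    · obtain ⟨k, hk⟩ := Ideal.exists_pow_le_of_le_radical_of_fg J'.2 (isNoetherian_def.mp hR _)
      exact ⟨CostructuredArrow.mk (⟨⟨⟨(Jn_le_pow a b k).trans hk⟩⟩⟩ :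
        (Jlift a b).obj (op k) ⟶ J')⟩
    · intro j1 j2
      apply Relation.ReflTransGen.single
      rcases le_total (unop j1.left) (unop j2.left) with h | h
      · right; exact ⟨CostructuredArrow.homMk (homOfLE h).op rfl⟩
      · left; exact ⟨CostructuredArrow.homMk (homOfLE h).op rfl⟩

/-- Local cohomology via the new diagram. -/
def lcIso [IsNoetherianRing S] (a b : S) :
    ofDiagram.{u, 0} (Jdiag a b) 2 ≅ localCohomology (Ideal.span {a, b}) 2 :=
  haveI := Jlift_initial a b
  (localCohomology.isoOfFinal.{u, u, 0} (Jlift a b) (selfLERadicalDiagram (Ideal.span {a, b})) 2 :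
    _ ≅ localCohomology.ofSelfLERadical (Ideal.span {a, b}) 2) ≪≫
    isoSelfLERadical (Ideal.span {a, b}) 2

variable (N : ModuleCat.{u} S)

/-- The diagram of Ext modules. -/
def Dg (a b : S) : (ℕᵒᵖ)ᵒᵖ ⥤ ModuleCat.{u} S :=
  diagram (Jdiag a b) 2 ⋙ (evaluation _ _).obj N

theorem exists_colim (a b : S) : ∃ c : Cocone (Dg N a b), Nonempty (IsColimit c) ∧
    c.pt = (ofDiagram.{u, 0} (Jdiag a b) 2).obj N :=
  ⟨((evaluation _ _).obj N).mapCocone (colimit.cocone (diagram (Jdiag a b) 2)),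
    ⟨isColimitOfPreserves _ (colimit.isColimit _)⟩, rfl⟩

/-- The canonical arrows. -/
def arr {m n : ℕ} (h : m ≤ n) : (op (op m) : (ℕᵒᵖ)ᵒᵖ) ⟶ op (op n) := (homOfLE h).op.op

variable [IsDomain S]

theorem Dg_step (a b : S) (hg : ∀ n, Good (pw a n) (pw b n)) (n : ℕ) (z : N) :
    ((Dg N a b).map (arr (Nat.le_succ n))).hom (psi N (pw a n) (pw b n) (hg n) z) =
      psi N (pw a (n + 1)) (pw b (n + 1)) (hg (n + 1)) ((a * b) • z) :=
  psi_nat N (pw a n) (pw b n) a b (hg n) (hg (n + 1)) z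

theorem Dg_steps (a b : S) (hg : ∀ n, Good (pw a n) (pw b n)) (n : ℕ) (z : N) (k : ℕ) :
    ((Dg N a b).map (arr (Nat.le_add_right n k))).hom (psi N (pw a n) (pw b n) (hg n) z) =
      psi N (pw a (n + k)) (pw b (n + k)) (hg (n + k)) ((a * b) ^ k • z) := by
  induction k with
  | zero =>
    have : arr (Nat.le_add_right n 0) = 𝟙 _ := rfl
    rw [this, (Dg N a b).map_id, pow_zero, one_smul]
    rfl
  | succ k ih =>
    have : arr (Nat.le_add_right n (k + 1)) =
      arr (Nat.le_add_right n k) ≫ arr (Nat.le_succ (n + k)) := rfl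
    rw [this, (Dg N a b).map_comp]
    refine (congrArg ((Dg N a b).map (arr (Nat.le_succ (n + k)))).hom ih).trans ?_
    refine (Dg_step N a b hg (n + k) _).trans ?_
    rw [← mul_smul, ← pow_succ']
    rfl

theorem interface [IsNoetherianRing S] (a b : S) (hg : ∀ n, Good (pw a n) (pw b n)) :
    ∃ ψ : ℕ → N →ₗ[S] ((localCohomology (Ideal.span {a, b}) 2).obj N),
      (∀ h, ∃ n z, ψ n z = h) ∧
      (∀ n k z, ψ (n + k) ((a * b) ^ k • z) = ψ n z) ∧
      (∀ n z1 z2, ψ n (a ^ n • z1 + b ^ n • z2) = 0) ∧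
      (∀ n z, ψ n z = 0 → ∃ (k : ℕ) (z1 z2 : N),
        (a * b) ^ k • z = a ^ (n + k) • z1 + b ^ (n + k) • z2) := by
  obtain ⟨c, ⟨hc⟩, hpt⟩ := exists_colim N a b
  let e : c.pt ≅ (localCohomology (Ideal.span {a, b}) 2).obj N :=
    eqToIso hpt ≪≫ (lcIso a b).app N
  let E := e.toLinearEquiv
  have hE : IsFiltered (ℕᵒᵖ)ᵒᵖ := inferInstance
  have hpf : PreservesFilteredColimitsOfSize.{0, 0} (forget (ModuleCat.{u} S)) :=
    preservesFilteredColimitsOfSize_shrink.{0, u, 0, u} _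
  have hpc : PreservesColimitsOfShape (ℕᵒᵖ)ᵒᵖ (forget (ModuleCat.{u} S)) :=
    hpf.preserves_filtered_colimits _
  refine ⟨fun n => E.toLinearMap ∘ₗ (c.ι.app (op (op n))).hom ∘ₗ
    psi N (pw a n) (pw b n) (hg n), ?_, ?_, ?_, ?_⟩
  · intro h
    obtain ⟨⟨⟨n⟩⟩, w, hw⟩ := Concrete.isColimit_exists_rep (Dg N a b) hc (E.symm h)
    obtain ⟨z, rfl⟩ := psi_surj N (pw a n) (pw b n) (hg n) w
    refine ⟨n, z, ?_⟩
    change E ((c.ι.app (op (op n))).hom (psi N (pw a n) (pw b n) (hg n) z)) = h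
    rw [← E.eq_symm_apply]
    exact hw
  · intro n k z
    change E ((c.ι.app (op (op (n + k)))).hom (psi N _ _ (hg (n + k)) _)) =
      E ((c.ι.app (op (op n))).hom (psi N (pw a n) (pw b n) (hg n) z))
    congr 1
    rw [← c.w (arr (Nat.le_add_right n k))]
    exact congrArg (c.ι.app (op (op (n + k)))).hom (Dg_steps N a b hg n z k).symm
  · intro n z1 z2
    change E ((c.ι.app (op (op n))).hom (psi N (pw a n) (pw b n) (hg n) _)) = 0
    have : psi N (pw a n) (pw b n) (hg n) (a ^ n • z1 + b ^ n • z2) = 0 :=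
      (psi_eq_zero N _ _ (hg n) _).2 ⟨z1, z2, by rw [pw_eq, pw_eq]⟩
    rw [this]
    exact (congrArg E (map_zero (c.ι.app (op (op n))).hom)).trans (map_zero E)
  · intro n z hz
    replace hz : (c.ι.app (op (op n))).hom (psi N (pw a n) (pw b n) (hg n) z) = 0 :=
      (LinearEquiv.map_eq_zero_iff E).1 hz
    obtain ⟨⟨⟨m⟩⟩, f, g, hfg⟩ := (Concrete.isColimit_rep_eq_iff_exists (Dg N a b) hc
      (i := op (op n)) (j := op (op n)) (psi N (pw a n) (pw b n) (hg n) z) 0).1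
      (hz.trans (map_zero (c.ι.app (op (op n))).hom).symm)
    have hnm : n ≤ m := f.unop.unop.down.down
    obtain ⟨k, rfl⟩ := Nat.exists_eq_add_of_le hnm
    have h2 : psi N _ _ (hg (n + k)) ((a * b) ^ k • z) = 0 := by
      rw [← Dg_steps N a b hg n z k]
      exact hfg.trans (map_zero ((Dg N a b).map g).hom)
    obtain ⟨z1, z2, h3⟩ := (psi_eq_zero N _ _ _ _).1 h2
    exact ⟨k, z1, z2, by rw [h3, pw_eq, pw_eq]⟩

end LC


section Final

theorem good_powers {u v : S} [IsDomain S] (hu : Prime u) (huv : ¬ u ∣ v) (n : ℕ) :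
    Good (pw u n) (pw v n) := by
  rw [pw_eq, pw_eq]
  refine ⟨pow_ne_zero _ hu.ne_zero, fun t ht => ?_⟩
  exact hu.pow_dvd_of_dvd_mul_left n (fun h => huv (hu.dvd_of_dvd_pow h)) ht

theorem kill_aux {N : Type*} [AddCommGroup N] [Module S N] (x y u v : S) (e n : ℕ)
    (he : ∀ z : N, (x * u + y * v) ^ e • z = 0) (z : N) :
    ∃ w : N, (x ^ (n + e)) • (u * v) ^ (n + e) • z = v ^ (n + (n + e)) • w := by
  have hm : (x * u) ^ (n + e) ∈ Ideal.span {(x * u + y * v) ^ e, v ^ n} := by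
    have h0 : x * u = (x * u + y * v) + (- (y * v)) := by ring
    rw [h0]
    refine Ideal.add_pow_mem_of_pow_mem_of_le (m := e) (n := n) _
      (Ideal.subset_span (by simp)) ?_ (by omega)
    have h1 : (-(y * v)) ^ n = (-y) ^ n * v ^ n := by rw [← mul_pow]; ring
    rw [h1]
    exact Ideal.mul_mem_left _ _ (Ideal.subset_span (by simp))
  obtain ⟨c, d, hcd⟩ := Ideal.mem_span_pair.1 hm
  refine ⟨d • z, ?_⟩
  have h2 : x ^ (n + e) * (u * v) ^ (n + e) =
      (v ^ (n + e) * c) * (x * u + y * v) ^ e + v ^ (n + (n + e)) * d := by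
    have : x ^ (n + e) * (u * v) ^ (n + e) = v ^ (n + e) * (x * u) ^ (n + e) := by
      rw [← mul_pow, ← mul_pow]; ring
    rw [this, ← hcd]; ring
  rw [← mul_smul, h2, add_smul, mul_smul, he, smul_zero, zero_add, mul_smul]

end Final

end Work

end

/-- Let `(S, n)` be a regular local ring of dimension 4 with regular system of
parameters `x, y, u, v`, and set `a := x*u + y*v`.  Then for every finitely generated `S`-module
`N` with `Supp N = V(aS)`, the support of the `S`-module `H^2_{(u,v)S}(N)` is exactly `{n}`
(the closed point of `Spec S`). -/
theorem support_localCohomology_two_eq_closedPoint_of_support_eq {S : Type u} [CommRing S]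
    [IsNoetherianRing S] [IsLocalRing S] (x y u v : S)
    (hgen : IsLocalRing.maximalIdeal S = Ideal.span {x, y, u, v})
    (hdim : ringKrullDim S = 4)
    (N : ModuleCat.{u} S) (hfg : Module.Finite S N)
    (hsupp : Module.support S N =
      PrimeSpectrum.zeroLocus (Ideal.span {x * u + y * v} : Set S)) :
    Module.support S ((localCohomology (Ideal.span {u, v}) 2).obj N) =
      {IsLocalRing.closedPoint S} := by
  classical
  have hgen' : ∀ l : List S, (∀ z, z ∈ l ↔ z ∈ [x, y, u, v]) →
      IsLocalRing.maximalIdeal S = Ideal.ofList l := by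
    intro l hl
    rw [Work.ofList_perm hl, hgen]
    unfold Ideal.ofList
    congr 1
    ext z
    simp
  obtain ⟨hdom, hu, huv⟩ := Work.regular_pair u v [x, y]
    (hgen' _ (by intro z; simp; tauto)) (by rw [hdim]; rfl)
  obtain ⟨ψ, hsurj, hstep, hzero, hinj⟩ :=
    Work.interface N u v (fun n => Work.good_powers hu huv n)
  obtain ⟨e, he⟩ : ∃ e : ℕ, ∀ z : N, (x * u + y * v) ^ e • z = 0 := by
    rw [Module.support_eq_zeroLocus, PrimeSpectrum.zeroLocus_eq_iff] at hsupp
    have : x * u + y * v ∈ (Module.annihilator S N).radical := by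
      rw [hsupp]
      exact Ideal.le_radical (Ideal.subset_span (by simp))
    obtain ⟨e, he⟩ := this
    exact ⟨e, fun z => Module.mem_annihilator.1 he z⟩
  have he' : ∀ z : N, (y * v + x * u) ^ e • z = 0 := by
    intro z; rw [add_comm]; exact he z
  apply Set.Subset.antisymm
  · intro p hp
    rw [Module.mem_support_iff_exists_annihilator] at hp
    obtain ⟨h, hh⟩ := hp
    obtain ⟨n, z, rfl⟩ := hsurj h
    have key : ∀ (s : S) (k : ℕ), s ^ k • ψ n z = 0 → s ∈ p.asIdeal := by
      intro s k hs
      apply p.isPrime.mem_of_pow_mem k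
      apply hh
      rw [Submodule.mem_annihilator_span_singleton]
      exact hs
    have hx : x ∈ p.asIdeal := by
      apply key x (n + e)
      rw [← hstep n (n + e) z, ← map_smul]
      obtain ⟨w, hw⟩ := Work.kill_aux x y u v e n he z
      rw [hw]
      have := hzero (n + (n + e)) 0 w
      rwa [smul_zero, zero_add] at this
    have hy : y ∈ p.asIdeal := by
      apply key y (n + e)
      rw [← hstep n (n + e) z, ← map_smul]
      obtain ⟨w, hw⟩ := Work.kill_aux y x v u e n he' z
      rw [mul_comm u v, hw]
      have := hzero (n + (n + e)) w 0
      rwa [smul_zero, add_zero] at this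
    have hu' : u ∈ p.asIdeal := by
      apply key u n
      rw [← map_smul]
      have := hzero n z 0
      rwa [smul_zero, add_zero] at this
    have hv' : v ∈ p.asIdeal := by
      apply key v n
      rw [← map_smul]
      have := hzero n 0 z
      rwa [smul_zero, zero_add] at this
    rw [Set.mem_singleton_iff]
    apply PrimeSpectrum.ext
    have hle : IsLocalRing.maximalIdeal S ≤ p.asIdeal := by
      rw [hgen, Ideal.span_le]
      rintro z (rfl | rfl | rfl | rfl) <;> assumption
    exact ((IsLocalRing.maximalIdeal.isMaximal S).eq_of_le p.isPrime.ne_top hle).symm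
  · rintro _ rfl
    rw [Module.mem_support_iff_exists_annihilator]
    by_contra hcon
    push Not at hcon
    refine Work.nonvanishing x y u v hgen hdim N hsupp (fun n z => hinj n z ?_)
    by_contra hne
    refine hcon (ψ n z) (IsLocalRing.le_maximalIdeal ?_)
    rw [Ne, Ideal.eq_top_iff_one, Submodule.mem_annihilator_span_singleton, one_smul]
    exact hne
end

section
/- Let (S, n, k) be a regular local ring of dimension 4, let x, y, u, v be a regular system of parameters for S, and set a := x·u + y·v. Then for every finitely generated S-module N with Supp N = V(aS), the socle Soc_S H^2_{(u,v)S}(N) = (0 :_{H^2_{(u,v)S}(N)} n) is an infinite dimensional k-vector space. -/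
universe u

section Part0
open IsLocalRing Ideal

theorem SL.dim_le {R : Type*} [CommRing R] [IsLocalRing R] [IsNoetherianRing R] (l : List R)
    (h : maximalIdeal R = Ideal.ofList l) : ringKrullDim R ≤ l.length := by
  classical
  refine (ringKrullDim_le_spanFinrank_maximalIdeal R).trans ?_
  rw [h]
  have h1 : {r | r ∈ l} = (l.toFinset : Set R) := by ext; simp
  have h2 : (Ideal.ofList l).spanFinrank ≤ l.length := by
    refine (Submodule.spanFinrank_span_le_ncard_of_finite (by rw [h1]; exact l.toFinset.finite_toSet)).trans ?_
    rw [h1, Set.ncard_coe_finset]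
    exact List.toFinset_card_le l
  exact_mod_cast h2

theorem SL.max_quot {R : Type*} [CommRing R] [IsLocalRing R] (I : Ideal R) (hI : I ≠ ⊤) :
    ∃ _ : IsLocalRing (R ⧸ I), maximalIdeal (R ⧸ I) = (maximalIdeal R).map (Ideal.Quotient.mk I) := by
  have : Nontrivial (R ⧸ I) := Ideal.Quotient.nontrivial_iff.mpr hI
  have hl := IsLocalRing.of_surjective' (Ideal.Quotient.mk I) Ideal.Quotient.mk_surjective
  refine ⟨hl, ?_⟩
  have := IsLocalRing.local_hom_TFAE (Ideal.Quotient.mk I)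
  apply le_antisymm
  · intro z hz
    obtain ⟨z, rfl⟩ := Ideal.Quotient.mk_surjective z
    refine Ideal.mem_map_of_mem _ ?_
    rw [mem_maximalIdeal] at hz ⊢
    exact fun hu => hz (hu.map _)
  · rw [Ideal.map_le_iff_le_comap]
    intro z hz
    rw [Ideal.mem_comap, mem_maximalIdeal]
    intro hu
    obtain ⟨w, hw⟩ := hu.exists_right_inv
    obtain ⟨w, rfl⟩ := Ideal.Quotient.mk_surjective w
    rw [← map_mul, ← map_one (Ideal.Quotient.mk I), Ideal.Quotient.eq] at hw
    have : z * w - 1 ∈ maximalIdeal R := le_maximalIdeal hI hw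
    have h1 : (1:R) ∈ maximalIdeal R := by
      have := (maximalIdeal R).sub_mem ((maximalIdeal R).mul_mem_right w hz) this
      rwa [sub_sub_cancel] at this
    exact (Ideal.ne_top_iff_one _).1 (IsLocalRing.maximalIdeal.isMaximal R).ne_top h1

theorem SL.exists_prime {R : Type*} [CommRing R] (d : ℕ) (h : (d : WithBot ℕ∞) ≤ ringKrullDim R) :
    ∃ P : Ideal R, P.IsPrime ∧ (d : WithBot ℕ∞) ≤ ringKrullDim (R ⧸ P) := by
  obtain ⟨l, hl⟩ := Order.le_krullDim_iff.1 h
  refine ⟨l.head.asIdeal, l.head.2, ?_⟩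
  have e : PrimeSpectrum.zeroLocus (l.head.asIdeal : Set R) = Set.Ici l.head := by
    ext q; simp [PrimeSpectrum.mem_zeroLocus]
  rw [ringKrullDim_quotient, e, ← Order.coheight_eq_krullDim_Ici]
  have := Order.length_le_coheight_head (p := l)
  rw [hl] at this
  exact_mod_cast this

theorem SL.map_cons {R : Type*} [CommRing R] [IsLocalRing R] (r : R) (l : List R)
   (h : maximalIdeal R = Ideal.ofList (r :: l)) :
    (maximalIdeal R).map (Ideal.Quotient.mk (span {r})) =
      Ideal.ofList (l.map (Ideal.Quotient.mk (span {r}))) := by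
  rw [h, Ideal.ofList_cons, Ideal.map_sup, Ideal.map_ofList, Ideal.map_quotient_self, bot_sup_eq]

theorem SL.dim_quot {R : Type*} [CommRing R] [IsLocalRing R] [IsNoetherianRing R] (r : R)
    (hr : r ∈ maximalIdeal R) {d : ℕ} (hd : ((d + 1 : ℕ) : WithBot ℕ∞) ≤ ringKrullDim R) :
    (d : WithBot ℕ∞) ≤ ringKrullDim (R ⧸ span {r}) := by
  have := ringKrullDim_le_ringKrullDim_quotient_add_encard {r}
    (by rw [IsLocalRing.ringJacobson_eq_maximalIdeal]; simpa using hr)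
  have h2 := hd.trans this
  rw [Set.encard_singleton] at h2
  push_cast at h2
  exact (ENat.WithBot.add_le_add_one_right_iff).1 h2

theorem SL.isDomain (d : ℕ) : ∀ {R : Type u} [CommRing R] [IsLocalRing R] [IsNoetherianRing R] (l : List R)
    (_ : l.length = d)
    (_ : maximalIdeal R = Ideal.ofList l) (_ : (l.length : WithBot ℕ∞) ≤ ringKrullDim R),
    IsDomain R := by
  induction d with
  | zero =>
    intro R _ _ _ l hl h _
    rw [List.length_eq_zero_iff] at hl
    subst hl
    have := IsLocalRing.isField_iff_maximalIdeal_eq.2 (h.trans Ideal.ofList_nil)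
    exact this.isDomain
  | succ d ih =>
    intro R _ _ _ l hl h hd
    match l, hl with
    | r :: l, hl =>
    have hl : l.length = d := by simpa using hl
    have hr : r ∈ maximalIdeal R := by rw [h]; exact Ideal.subset_span (by simp)
    have hne : span {r} ≠ ⊤ := fun e => (IsLocalRing.maximalIdeal.isMaximal R).ne_top
      (top_le_iff.1 (e ▸ (Ideal.span_singleton_le_iff_mem _).2 hr))
    obtain ⟨hloc, hmax⟩ := SL.max_quot _ hne
    rw [SL.map_cons r l h] at hmax
    have hdq := SL.dim_quot r hr (d := l.length) (by simpa using hd)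
    have hdom : IsDomain (R ⧸ span {r}) := ih (l.map _) (by simpa using hl) hmax (by simpa using hdq)
    have hle : ringKrullDim (R ⧸ span {r}) ≤ l.length := by
      simpa using SL.dim_le _ hmax
    obtain ⟨P, hP, hPd⟩ := SL.exists_prime (l.length + 1) (by simpa using hd)
    -- r ∉ P
    have hrP : r ∉ P := by
      intro hrP
      have h1 := ringKrullDim_le_of_surjective (Ideal.Quotient.factor
        ((Ideal.span_singleton_le_iff_mem _).2 hrP)) (Ideal.Quotient.factor_surjective _)
      have := hPd.trans (h1.trans hle)
      norm_cast at this
      omega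
    have hPr : P ≤ span {r} := by
      intro f hf
      by_contra hfr
      obtain ⟨hlocP, hmaxP⟩ := SL.max_quot P hP.ne_top
      have hd2 := SL.dim_quot (Ideal.Quotient.mk P r) (by rw [hmaxP]; exact mem_map_of_mem _ hr) hPd
      have hf0 : Ideal.Quotient.mk (span {r}) f ≠ 0 := by
        rwa [Ne, Ideal.Quotient.eq_zero_iff_mem]
      let g : R ⧸ span {r} →+* (R ⧸ P) ⧸ span {Ideal.Quotient.mk P r} :=
        Ideal.Quotient.lift _ ((Ideal.Quotient.mk _).comp (Ideal.Quotient.mk P)) (by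
          intro a ha
          obtain ⟨b, rfl⟩ := Ideal.mem_span_singleton.1 ha
          rw [RingHom.comp_apply, Ideal.Quotient.eq_zero_iff_mem, map_mul]
          exact Ideal.mul_mem_right _ _ (Ideal.mem_span_singleton_self _))
      have hg : Function.Surjective g := Ideal.Quotient.lift_surjective_of_surjective _ _
        (Ideal.Quotient.mk_surjective.comp Ideal.Quotient.mk_surjective)
      have h3 := ringKrullDim_succ_le_of_surjective g hg (mem_nonZeroDivisors_of_ne_zero hf0) (by
        change Ideal.Quotient.mk _ (Ideal.Quotient.mk P f) = 0
        rw [Ideal.Quotient.eq_zero_iff_mem.2 hf, map_zero])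
      have h4 : ((l.length : WithBot ℕ∞) + 1) ≤ l.length :=
        (add_le_add_left hd2 1).trans (h3.trans hle)
      norm_cast at h4
      omega
    have hP0 : P ≤ maximalIdeal R • P := by
      intro f hf
      obtain ⟨b, rfl⟩ := Ideal.mem_span_singleton.1 (hPr hf)
      exact Submodule.smul_mem_smul hr ((hP.mem_or_mem hf).resolve_left hrP)
    have hbot : P = ⊥ := Submodule.eq_bot_of_le_smul_of_le_jacobson_bot _ P (IsNoetherian.noetherian P) hP0
      (IsLocalRing.maximalIdeal_le_jacobson _)
    subst hbot
    have : NoZeroDivisors R := ⟨fun h => by simpa using hP.mem_or_mem (by simpa using h)⟩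
    exact NoZeroDivisors.to_isDomain R


/-- `l` is a regular system of parameters. -/
def SL.Par {R : Type u} [CommRing R] [IsLocalRing R] (l : List R) : Prop :=
  maximalIdeal R = Ideal.ofList l ∧ (l.length : WithBot ℕ∞) ≤ ringKrullDim R

theorem SL.Par.perm {R : Type u} [CommRing R] [IsLocalRing R] {l l' : List R} (h : SL.Par l)
    (p : l.Perm l') : SL.Par l' := by
  refine ⟨h.1.trans ?_, p.length_eq ▸ h.2⟩
  unfold Ideal.ofList
  congr 1
  ext r
  exact p.mem_iff

def SL.Reg {R : Type u} [CommRing R] (w : R) (J : Ideal R) : Prop := ∀ z, w * z ∈ J → z ∈ J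

theorem SL.Par.reg {R : Type u} [CommRing R] [IsLocalRing R] [IsNoetherianRing R] (pre : List R)
    (w : R) (post : List R) (h : SL.Par (pre ++ w :: post)) : SL.Reg w (Ideal.ofList pre) := by
  classical
  obtain ⟨h1, h2⟩ := h
  have hle : Ideal.ofList pre ≤ maximalIdeal R := by
    rw [h1, Ideal.ofList_append]; exact le_sup_left
  have hne : Ideal.ofList pre ≠ ⊤ := fun e => (IsLocalRing.maximalIdeal.isMaximal R).ne_top
    (top_le_iff.1 (e ▸ hle))
  obtain ⟨hloc, hmax⟩ := SL.max_quot _ hne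
  have hmax' : maximalIdeal (R ⧸ Ideal.ofList pre) =
      Ideal.ofList ((w :: post).map (Ideal.Quotient.mk _)) := by
    rw [hmax, h1, Ideal.ofList_append, Ideal.map_sup, Ideal.map_quotient_self, bot_sup_eq,
      Ideal.map_ofList]
  have hdim : ((w :: post).length : WithBot ℕ∞) ≤ ringKrullDim (R ⧸ Ideal.ofList pre) := by
    have e : {r | r ∈ pre} = (pre.toFinset : Set R) := by ext; simp
    have h3 := ringKrullDim_le_ringKrullDim_quotient_add_card pre.toFinset
      (by rw [IsLocalRing.ringJacobson_eq_maximalIdeal, ← e]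
          exact Ideal.span_le.1 hle)
    rw [← e] at h3
    have h4 : ((pre.length + (w :: post).length : ℕ) : WithBot ℕ∞) ≤
        ringKrullDim (R ⧸ Ideal.ofList pre) + (pre.length : WithBot ℕ∞) := by
      rw [← List.length_append]
      refine h2.trans (h3.trans ?_)
      gcongr
      exact List.toFinset_card_le _
    have h5 := SL.dim_le _ hmax'
    generalize ringKrullDim (R ⧸ Ideal.ofList pre) = D at h4 h5 ⊢
    induction D using WithBot.recBotCoe with
    | bot => simp at h4
    | coe D =>
      induction D using ENat.recTopCoe with
      | top => exact le_top
      | coe D =>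
        norm_cast at h4 ⊢
        have h6 : pre.length + (w :: post).length ≤ D + pre.length := by exact_mod_cast h4
        have : (w :: post).length ≤ D := by omega
        exact_mod_cast this
  have hdom := SL.isDomain _ _ rfl hmax' (by simpa using hdim)
  have hw : w ∉ Ideal.ofList pre := by
    intro hw
    have : maximalIdeal (R ⧸ Ideal.ofList pre) =
      Ideal.ofList (post.map (Ideal.Quotient.mk _)) := by
      rw [hmax', List.map_cons, Ideal.ofList_cons, Ideal.Quotient.eq_zero_iff_mem.2 hw]
      simp
    have := hdim.trans (SL.dim_le _ this)
    rw [List.length_map] at this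
    norm_cast at this
    simp at this
  have hprime : (Ideal.ofList pre).IsPrime := (Ideal.Quotient.isDomain_iff_prime _).1 hdom
  exact fun z hz => (hprime.mem_or_mem hz).resolve_left hw

theorem SL.reg_pow {R : Type u} [CommRing R] {w b : R} {J : Ideal R} (h1 : SL.Reg w (span {b} ⊔ J))
    (h2 : SL.Reg b J) (k : ℕ) : SL.Reg w (span {b ^ k} ⊔ J) := by
  have h3 : ∀ k z, b ^ k * z ∈ J → z ∈ J := by
    intro k
    induction k with
    | zero => intro z hz; simpa using hz
    | succ k ih => intro z hz; exact h2 _ (ih _ (by rwa [← mul_assoc, ← pow_succ]))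
  induction k with
  | zero => intro z _; simp
  | succ k ih =>
    intro z hz
    obtain ⟨r, j, hj, e⟩ := Ideal.mem_span_singleton_sup.1 hz
    have : w * z ∈ span {b ^ k} ⊔ J := by
      refine Ideal.mem_span_singleton_sup.2 ⟨r * b, j, hj, ?_⟩
      rw [← e]; ring
    obtain ⟨r', j', hj', e'⟩ := Ideal.mem_span_singleton_sup.1 (ih z this)
    have h4 : w * r' - b * r ∈ J := by
      apply h3 k
      have : b ^ k * (w * r' - b * r) = j - w * j' := by
        linear_combination w * e' - e
      rw [this]
      exact J.sub_mem hj (J.mul_mem_left _ hj')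
    have h5 : w * r' ∈ span {b} ⊔ J :=
      Ideal.mem_span_singleton_sup.2 ⟨r, _, h4, by ring⟩
    obtain ⟨r'', j'', hj'', e''⟩ := Ideal.mem_span_singleton_sup.1 (h1 _ h5)
    refine Ideal.mem_span_singleton_sup.2 ⟨r'', b ^ k * j'' + j', J.add_mem (J.mul_mem_left _ hj'') hj', ?_⟩
    rw [← e', ← e'']; ring

theorem SL.Par.reg_pows {R : Type u} [CommRing R] [IsLocalRing R] [IsNoetherianRing R]
    (A : List (R × ℕ)) : ∀ (B : List R)
    (w : R) (post : List R) (_ : SL.Par (A.map Prod.fst ++ (B ++ w :: post))),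
     SL.Reg w (Ideal.ofList (A.map (fun p => p.1 ^ p.2)) ⊔ Ideal.ofList B) := by
  induction A with
  | nil => intro B w post h; simpa using SL.Par.reg B w post h
  | cons p A ih =>
    intro B w post h
    have h1 := ih (p.1 :: B) w post (h.perm (by
      simp only [List.map_cons, List.cons_append]
      exact List.perm_middle.symm))
    have h2 := ih B p.1 (w :: post) (h.perm (by
      simp only [List.map_cons, List.cons_append]
      rw [← List.append_assoc, ← List.append_assoc]
      exact List.perm_middle.symm))
    rw [Ideal.ofList_cons, ← sup_assoc, sup_comm _ (span {p.1}), sup_assoc] at h1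
    rw [List.map_cons, Ideal.ofList_cons, sup_assoc]
    exact SL.reg_pow h1 h2 p.2

theorem SL.cancel {R : Type u} [CommRing R] {w : R} {J : Ideal R} (h : SL.Reg w J) (k : ℕ) (z : R)
    (hz : w ^ k * z ∈ span {w ^ (k + 1)} ⊔ J) : z ∈ span {w} ⊔ J := by
  have h3 : ∀ k z, w ^ k * z ∈ J → z ∈ J := by
    intro k
    induction k with
    | zero => intro z hz; simpa using hz
    | succ k ih => intro z hz; exact h _ (ih _ (by rwa [← mul_assoc, ← pow_succ]))
  obtain ⟨r, j, hj, e⟩ := Ideal.mem_span_singleton_sup.1 hz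
  refine Ideal.mem_span_singleton_sup.2 ⟨r, z - r * w, h3 k _ ?_, by simp⟩
  have : w ^ k * (z - r * w) = j := by linear_combination -e
  rwa [this]

theorem SL.monomial {R : Type u} [CommRing R] [IsLocalRing R] [IsNoetherianRing R] {x y u v : R}
    (h : SL.Par [x, y, u, v]) (M s : ℕ) : x ^ M * (y ^ M * (u ^ s * v ^ s)) ∉
      span {x ^ (M+1)} ⊔ (span {y ^ (M+1)} ⊔ (span {u ^ (s+1)} ⊔ span {v ^ (s+1)})) := by
  intro hm
  have h1 := SL.Par.reg_pows [(y, M+1), (u, s+1), (v, s+1)] [] x []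
    (h.perm (by simpa using (List.perm_append_comm (l₁ := [x]) (l₂ := [y,u,v]))))
  have h2 := SL.Par.reg_pows [(x, 1), (u, s+1), (v, s+1)] [] y []
    (h.perm (by simpa using ((List.perm_append_comm (l₁ := [y]) (l₂ := [u,v])).cons x)))
  have h3 := SL.Par.reg_pows [(x, 1), (y, 1), (v, s+1)] [] u []
    (h.perm (by simpa using (((List.perm_append_comm (l₁ := [u]) (l₂ := [v])).cons y).cons x)))
  have h4 := SL.Par.reg_pows [(x, 1), (y, 1), (u, 1)] [] v [] h
  simp only [List.map_cons, List.map_nil, Ideal.ofList_cons, Ideal.ofList_nil, sup_bot_eq, pow_one]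
    at h1 h2 h3 h4
  have g1 := SL.cancel h1 _ _ hm
  have g2 := SL.cancel h2 M (u ^ s * v ^ s) (by rw [sup_left_comm]; exact g1)
  have g3 := SL.cancel h3 s (v ^ s) (by
    convert g2 using 1; ac_rfl)
  have g4 := SL.cancel h4 s 1 (by
    rw [mul_one]
    convert g3 using 1; ac_rfl)
  have hne := (IsLocalRing.maximalIdeal.isMaximal R).ne_top
  rw [Ideal.ne_top_iff_one] at hne
  apply hne
  rw [h.1]
  simp only [Ideal.ofList_cons, Ideal.ofList_nil, sup_bot_eq]
  convert g4 using 1; ac_rfl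

/-- Koszul exactness for powers of `u, v`. -/
theorem SL.koszul {R : Type u} [CommRing R] [IsLocalRing R] [IsNoetherianRing R] {x y u v : R}
    (h : SL.Par [x, y, u, v]) (t : ℕ) :
    (∀ z : R, u ^ t * z = 0 → z = 0) ∧
    ∀ α β : R, α * u ^ t + β * v ^ t = 0 → ∃ γ, α = γ * v ^ t ∧ β = - (γ * u ^ t) := by
  have hu := SL.Par.reg_pows [] [] u [x, y, v] (h.perm (by
    simpa using (List.perm_append_comm (l₁ := [x, y]) (l₂ := [u])).append_right [v]))
  have hv := SL.Par.reg_pows [(u, t)] [] v [x, y] (h.perm (by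
    simpa using (List.perm_append_comm (l₁ := [x, y]) (l₂ := [u, v]))))
  simp only [List.map_cons, List.map_nil, Ideal.ofList_cons, Ideal.ofList_nil, sup_bot_eq] at hu hv
  have hu' : ∀ t, ∀ z : R, u ^ t * z = 0 → z = 0 := by
    intro t
    induction t with
    | zero => intro z hz; simpa using hz
    | succ k ih => intro z hz; exact hu _ (ih _ (by rwa [← mul_assoc, ← pow_succ]))
  have hv' : ∀ k z, v ^ k * z ∈ span {u ^ t} → z ∈ span {u ^ t} := by
    intro k
    induction k with
    | zero => intro z hz; simpa using hz
    | succ k ih => intro z hz; exact hv _ (ih _ (by rwa [← mul_assoc, ← pow_succ]))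
  refine ⟨hu' t, fun α β e => ?_⟩
  obtain ⟨γ, hγ⟩ := Ideal.mem_span_singleton'.1 (hv' t β (Ideal.mem_span_singleton'.2
    ⟨-α, by linear_combination -e⟩))
  refine ⟨-γ, ?_, by rw [← hγ]; ring⟩
  have := hu' t (α + γ * v ^ t) (by rw [← hγ] at e; linear_combination e)
  linear_combination this
end Part0

section Part1
open IsLocalRing Ideal

theorem SL.artin_one {R : Type*} [CommRing R] {M : Type*} [AddCommGroup M] [Module R M] (w : R)
    (ht : ∀ z : M, ∃ k : ℕ, w ^ k • z = 0) (hA : IsArtinian R (Submodule.torsionBy R M w)) :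
    IsArtinian R M := by
  rw [← monotone_stabilizes_iff_artinian]
  intro f
  let L : ℕ → Submodule R M := fun n => OrderDual.ofDual (f n)
  have hL : ∀ {m n}, m ≤ n → L n ≤ L m := fun h => f.monotone h
  let g : ℕ → ℕ → Submodule R (Submodule.torsionBy R M w) := fun k n =>
    { carrier := {z | ∃ z' ∈ L n, w ^ k • z' = (z : M)}
      add_mem' := by
        rintro a b ⟨a', ha, ea⟩ ⟨b', hb, eb⟩
        exact ⟨a' + b', (L n).add_mem ha hb, by simp [ea, eb]⟩
      zero_mem' := ⟨0, (L n).zero_mem, by simp⟩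
      smul_mem' := by
        rintro c a ⟨a', ha, ea⟩
        exact ⟨c • a', (L n).smul_mem c ha, by rw [smul_comm, ea]; rfl⟩ }
  have hg : ∀ {k k' n n'}, k ≤ k' → n ≤ n' → g k' n' ≤ g k n := by
    rintro k k' n n' hk hn z ⟨z', hz', e⟩
    refine ⟨w ^ (k' - k) • z', (L n).smul_mem _ (hL hn hz'), ?_⟩
    rw [← mul_smul, ← pow_add, Nat.add_sub_cancel' hk, e]
  have stab : ∀ h : ℕ → Submodule R (Submodule.torsionBy R M w), (∀ {m n}, m ≤ n → h n ≤ h m) →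
      ∃ n, ∀ m, n ≤ m → h n = h m := by
    intro h hh
    exact monotone_stabilizes_iff_artinian.2 hA ⟨fun n => OrderDual.toDual (h n), fun _ _ h => hh h⟩
  obtain ⟨n0, h0⟩ := stab (fun n => g n n) (fun h => hg h h)
  have h1 : ∀ k, ∃ n, ∀ m, n ≤ m → g k n = g k m := fun k => stab (g k) (fun h => hg le_rfl h)
  choose s hs using h1
  let N := max n0 ((Finset.range n0).sup s)
  have hN : ∀ k m, N ≤ m → g k N ≤ g k m := by
    intro k m hm
    by_cases hk : k < n0
    · have h2 : s k ≤ N := le_trans (Finset.le_sup (f := s) (Finset.mem_range.2 hk)) (le_max_right _ _)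
      rw [← hs k N h2, ← hs k m (h2.trans hm)]
    · have h3 : n0 ≤ N := le_max_left _ _
      calc g k N ≤ g n0 n0 := hg (by omega) h3
        _ = g (max k m) (max k m) := h0 _ (by omega)
        _ ≤ g k m := hg (le_max_left _ _) (le_max_right _ _)
  refine ⟨N, fun m hm => ?_⟩
  change L N = L m
  refine le_antisymm ?_ (hL hm)
  have key : ∀ j : ℕ, ∀ z ∈ L N, w ^ j • z = 0 → z ∈ L m := by
    intro j
    induction j with
    | zero => intro z _ hz; rw [pow_zero, one_smul] at hz; rw [hz]; exact zero_mem _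
    | succ j ih =>
      intro z hz e
      have hz2 : w ^ j • z ∈ Submodule.torsionBy R M w := by
        rw [Submodule.mem_torsionBy_iff, ← mul_smul, ← pow_succ', e]
      obtain ⟨z', hz', e'⟩ := hN j m hm (show (⟨_, hz2⟩ : Submodule.torsionBy R M w) ∈ g j N from ⟨z, hz, rfl⟩)
      have := ih (z - z') ((L N).sub_mem hz (hL hm hz')) (by rw [smul_sub, e', sub_self])
      have := (L m).add_mem this hz'
      rwa [sub_add_cancel] at this
  intro z hz
  obtain ⟨j, hj⟩ := ht z
  exact key j z hz hj

theorem SL.artin_list {R : Type*} [CommRing R] (l : List R) : ∀ {M : Type u} [AddCommGroup M] [Module R M]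
    (_ : ∀ w ∈ l, ∀ z : M, ∃ k : ℕ, w ^ k • z = 0)
    (_ : IsArtinian R (Submodule.torsionBySet R M {r | r ∈ l})), IsArtinian R M := by
  induction l with
  | nil =>
    intro M _ _ _ h
    refine isArtinian_of_injective (LinearMap.codRestrict (Submodule.torsionBySet R M {r | r ∈ []})
      LinearMap.id (fun z => by simp [Submodule.mem_torsionBySet_iff])) ?_
    intro a b h
    simpa using congrArg Subtype.val h
  | cons w l ih =>
    intro M _ _ ht h
    refine SL.artin_one w (ht w (by simp)) (ih ?_ ?_)
    · intro w' hw' z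
      obtain ⟨k, hk⟩ := ht w' (by simp [hw']) z.1
      exact ⟨k, Subtype.ext hk⟩
    · let S1 := Submodule.torsionBySet R (Submodule.torsionBy R M w) {r | r ∈ l}
      refine isArtinian_of_injective (LinearMap.codRestrict (Submodule.torsionBySet R M {r | r ∈ w :: l})
        ((Submodule.torsionBy R M w).subtype ∘ₗ S1.subtype) (fun z => ?_)) ?_
      · rw [Submodule.mem_torsionBySet_iff]
        rintro ⟨r, hr⟩
        rcases List.mem_cons.1 hr with rfl | hr
        · exact z.1.2
        · exact congrArg Subtype.val ((Submodule.mem_torsionBySet_iff _ _).1 z.2 ⟨r, hr⟩)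
      · intro a b h
        have h' : ((a : Submodule.torsionBy R M w) : M) = ((b : Submodule.torsionBy R M w) : M) :=
          congrArg (fun z => z.1) h
        exact Subtype.ext (Subtype.ext h')

theorem SL.artin_of_socle {R : Type u} [CommRing R] [IsLocalRing R] {M : Type u} [AddCommGroup M] [Module R M]
    (l : List R) (hl : maximalIdeal R = Ideal.ofList l)
    (ht : ∀ w ∈ l, ∀ z : M, ∃ k : ℕ, w ^ k • z = 0)
    (hf : Module.Finite (R ⧸ maximalIdeal R) (Submodule.torsionBySet R M (maximalIdeal R : Set R))) :
    IsArtinian R M := by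
  refine SL.artin_list l ht ?_
  have e : Submodule.torsionBySet R M {r | r ∈ l} =
      Submodule.torsionBySet R M (maximalIdeal R : Set R) := by
    rw [hl]; exact Submodule.torsionBySet_eq_torsionBySet_span _
  rw [e]
  obtain ⟨n, f, hf⟩ := Module.Finite.exists_fin' (R ⧸ maximalIdeal R) (Submodule.torsionBySet R M (maximalIdeal R : Set R))
  have : IsSimpleModule R (R ⧸ maximalIdeal R) := isSimpleModule_iff_isCoatom.2
    (Ideal.isMaximal_def.1 (IsLocalRing.maximalIdeal.isMaximal R))
  exact isArtinian_of_surjective _ (f.restrictScalars R) hf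
end Part1

section Part2
section Gruson
open TensorProduct
variable {S : Type u} [CommRing S]

theorem SL.exists_hom [IsNoetherianRing S] {N : Type u} [AddCommGroup N] [Module S N] [Module.Finite S N]
    (P : PrimeSpectrum S) (hP : P ∈ Module.support S N) : ∃ φ : N →ₗ[S] (S ⧸ P.asIdeal), φ ≠ 0 := by
  rw [Module.mem_support_iff_nontrivial_residueField_tensorProduct] at hP
  obtain ⟨p, hp⟩ := P
  change Nontrivial (p.ResidueField ⊗[S] N) at hP
  change ∃ φ : N →ₗ[S] (S ⧸ p), φ ≠ 0
  have hloc : IsLocalizedModule p.primeCompl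
      (IsScalarTower.toAlgHom S (S ⧸ p) p.ResidueField).toLinearMap := by
    rw [isLocalizedModule_iff_isLocalization]
    have : Algebra.algebraMapSubmonoid (S ⧸ p) p.primeCompl = nonZeroDivisors (S ⧸ p) := by
      ext z
      rw [mem_nonZeroDivisors_iff_ne_zero]
      constructor
      · rintro ⟨w, hw, rfl⟩ h
        exact hw (Ideal.Quotient.eq_zero_iff_mem.1 h)
      · intro h
        obtain ⟨w, rfl⟩ := Ideal.Quotient.mk_surjective z
        exact ⟨w, fun hw => h (Ideal.Quotient.eq_zero_iff_mem.2 hw), rfl⟩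
    rw [this]; infer_instance
  have hex : ∃ g : N →ₗ[S] p.ResidueField, g ≠ 0 := by
    by_contra hcon
    push Not at hcon
    obtain ⟨v, hv⟩ := exists_ne (0 : p.ResidueField ⊗[S] N)
    apply hv
    rw [← Module.forall_dual_apply_eq_zero_iff p.ResidueField]
    intro φ
    have h0 : ∀ n : N, φ (1 ⊗ₜ n) = 0 := fun n =>
      LinearMap.congr_fun (hcon ((φ.restrictScalars S) ∘ₗ (TensorProduct.mk S p.ResidueField N 1))) n
    induction v with
    | zero => simp
    | add a b ha hb => 
      rw [map_add]
      by_cases h1 : a = 0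
      · subst h1
        rw [map_zero, zero_add]; exact hb (by simpa using hv)
      · by_cases h2 : b = 0
        · subst h2
          rw [map_zero, add_zero]; exact ha h1
        · rw [ha h1, hb h2, add_zero]
    | tmul k n =>
      have : k ⊗ₜ[S] n = k • ((1 : p.ResidueField) ⊗ₜ[S] n) := by
        rw [TensorProduct.smul_tmul', smul_eq_mul, mul_one]
      rw [this, map_smul, h0, smul_zero]
  obtain ⟨g, hg⟩ := hex
  have : Module.FinitePresentation S N := Module.finitePresentation_of_finite S N
  obtain ⟨h, s, hs⟩ := Module.FinitePresentation.exists_lift_of_isLocalizedModule p.primeCompl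
    (IsScalarTower.toAlgHom S (S ⧸ p) p.ResidueField).toLinearMap g
  refine ⟨h, fun h0 => hg ?_⟩
  subst h0
  rw [LinearMap.comp_zero] at hs
  ext n
  have h1 := LinearMap.congr_fun hs n
  have h2 : (s : S) • g n = 0 := h1.symm
  rw [Algebra.smul_def] at h2
  rcases mul_eq_zero.1 h2 with h3 | h3
  · exfalso
    have h4 : (s : S) ∈ p := by simpa using h3
    exact s.2 h4
  · exact h3

theorem SL.artin_mid {M1 M2 M3 A : Type u} [AddCommGroup M1] [Module S M1] [AddCommGroup M2] [Module S M2]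
    [AddCommGroup M3] [Module S M3] [AddCommGroup A] [Module S A] (f : M1 →ₗ[S] M2) (g : M2 →ₗ[S] M3)
    (hfg : Function.Exact f g) (hg : Function.Surjective g) (h1 : IsArtinian S (M1 ⊗[S] A))
    (h3 : IsArtinian S (M3 ⊗[S] A)) : IsArtinian S (M2 ⊗[S] A) :=
  isArtinian_of_range_eq_ker (f.rTensor A) (g.rTensor A)
    (LinearMap.exact_iff.1 (rTensor_exact A hfg hg)).symm

theorem SL.gruson [IsNoetherianRing S] {N : Type u} [AddCommGroup N] [Module S N] [Module.Finite S N]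
    {A : Type u} [AddCommGroup A] [Module S A] (hA : IsArtinian S (N ⊗[S] A)) (b : Ideal S) :
    PrimeSpectrum.zeroLocus (b : Set S) ⊆ Module.support S N → IsArtinian S ((S ⧸ b) ⊗[S] A) := by
  induction b using IsNoetherian.induction with
  | _ b ih =>
  intro hb
  have ih' : ∀ J > b, IsArtinian S ((S ⧸ J) ⊗[S] A) := fun J hJ => ih J hJ
    ((PrimeSpectrum.zeroLocus_anti_mono (SetLike.coe_subset_coe.2 hJ.le)).trans hb)
  by_cases htop : b = ⊤
  · subst htop
    have : Subsingleton (S ⧸ (⊤ : Ideal S)) := Ideal.Quotient.subsingleton_iff.2 rfl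
    have : Subsingleton ((S ⧸ (⊤ : Ideal S)) ⊗[S] A) := inferInstance
    infer_instance
  by_cases hprime : Ideal.IsPrime b
  · obtain ⟨φ, hφ⟩ := SL.exists_hom (N := N) ⟨b, hprime⟩ (hb (by simp [PrimeSpectrum.mem_zeroLocus]))
    change N →ₗ[S] (S ⧸ b) at φ
    let b' : Ideal S := Submodule.comap (Submodule.mkQ b) (LinearMap.range φ)
    have hle : b ≤ b' := fun z hz => by
      change Submodule.mkQ b z ∈ LinearMap.range φ
      have : Submodule.mkQ b z = 0 := by simpa using Ideal.Quotient.eq_zero_iff_mem.2 hz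
      rw [this]; exact zero_mem _
    have hlt : b < b' := by
      refine lt_of_le_of_ne hle fun e => hφ ?_
      ext n
      obtain ⟨z, hz⟩ := Submodule.mkQ_surjective b (φ n)
      have : z ∈ b' := by
        change Submodule.mkQ b z ∈ LinearMap.range φ
        rw [hz]; exact ⟨n, rfl⟩
      rw [← e] at this
      rw [← hz]
      exact Ideal.Quotient.eq_zero_iff_mem.2 this
    refine SL.artin_mid φ (Submodule.factor hle) ?_ (Submodule.factor_surjective hle) hA (ih' b' hlt)
    intro w
    obtain ⟨z, rfl⟩ := Submodule.mkQ_surjective b w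
    exact Ideal.Quotient.eq_zero_iff_mem (I := b') (a := z)
  · have : ∃ f g, f * g ∈ b ∧ f ∉ b ∧ g ∉ b := by
      by_contra hcon
      push Not at hcon
      exact hprime (Ideal.isPrime_iff.2 ⟨htop, fun {f g} h => by
        by_cases hf : f ∈ b
        · exact Or.inl hf
        · exact Or.inr (hcon f g h hf)⟩)
    obtain ⟨f, g, hfg, hf, hg⟩ := this
    have lt : ∀ f, f ∉ b → b < b ⊔ Ideal.span {f} := fun f hf => by
      refine lt_of_le_of_ne le_sup_left fun e => hf ?_
      rw [e]; exact Ideal.mem_sup_right (Ideal.mem_span_singleton_self f)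
    have hle : b ≤ b ⊔ Ideal.span {f} := le_sup_left
    have hm : b ⊔ Ideal.span {g} ≤ Submodule.comap (LinearMap.lsmul S S f) b := by
      refine sup_le (fun z hz => Ideal.mul_mem_left b f hz) ?_
      rw [Ideal.span_singleton_le_iff_mem]
      exact hfg
    refine SL.artin_mid (Submodule.mapQ _ b (LinearMap.lsmul S S f) hm) (Submodule.factor hle) ?_
      (Submodule.factor_surjective hle) (ih' _ (lt g hg)) (ih' _ (lt f hf))
    intro w
    obtain ⟨z, rfl⟩ := Submodule.mkQ_surjective b w
    refine (Ideal.Quotient.eq_zero_iff_mem (I := b ⊔ Ideal.span {f}) (a := z)).trans ?_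
    constructor
    · intro hz
      obtain ⟨z1, h1, z2, h2, rfl⟩ := Submodule.mem_sup.1 hz
      obtain ⟨c, rfl⟩ := Ideal.mem_span_singleton'.1 h2
      refine ⟨Submodule.mkQ _ c, ?_⟩
      refine (Ideal.Quotient.eq (I := b)).2 ?_
      have : f * c - (z1 + c * f) = - z1 := by ring
      exact this ▸ b.neg_mem h1
    · rintro ⟨w, hw⟩
      obtain ⟨c, rfl⟩ := Submodule.mkQ_surjective _ w
      have h1 : f * c - z ∈ b := (Ideal.Quotient.eq (I := b)).1 hw
      have : z = f * c - (f * c - z) := by ring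
      rw [this]
      exact sub_mem (Ideal.mem_sup_right (Ideal.mem_span_singleton.2 (dvd_mul_right f c))) (Ideal.mem_sup_left h1)
end Gruson
end Part2

section Part3
section P4
open TensorProduct
variable {S : Type u} [CommRing S]

structure SL.IsLoc (p q : S) {N H : Type u} [AddCommGroup N] [Module S N] [AddCommGroup H] [Module S H]
    (κ : ℕ → (N →ₗ[S] H)) : Prop where
  tr : ∀ t s n, κ t n = κ (t + s) ((p ^ s * q ^ s) • n)
  zero : ∀ t a b, κ t (p ^ t • a + q ^ t • b) = 0
  surj : ∀ z, ∃ t n, κ t n = z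
  ker : ∀ t n, κ t n = 0 → ∃ s, ∃ a b, (p ^ s * q ^ s) • n = p ^ (t + s) • a + q ^ (t + s) • b

section
variable {p q : S} {N H : Type u} [AddCommGroup N] [Module S N] [AddCommGroup H] [Module S H]
    {κ : ℕ → (N →ₗ[S] H)}

theorem SL.IsLoc.zp (h : SL.IsLoc p q κ) (t : ℕ) (a : N) : κ t (p ^ t • a) = 0 := by
  simpa using h.zero t a 0

theorem SL.IsLoc.zq (h : SL.IsLoc p q κ) (t : ℕ) (a : N) : κ t (q ^ t • a) = 0 := by
  simpa using h.zero t 0 a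

theorem SL.IsLoc.tr' (h : SL.IsLoc p q κ) {t t' s : ℕ} (e : t + s = t') (n : N) : κ t n = κ t' ((p ^ s * q ^ s) • n) := by
  subst e; exact h.tr t s n

theorem SL.pow_decomp (A B : S) (k t : ℕ) : ∃ c d, (A + B) ^ (k + t) = c * A ^ k + d * B ^ t := by
  have : (A + B) ^ (k + t) ∈ Ideal.span {A ^ k, B ^ t} :=
    Ideal.add_pow_mem_of_pow_mem_of_le _ (Ideal.subset_span (by simp)) (Ideal.subset_span (by simp)) (Nat.le_succ _)
  obtain ⟨c, d, e⟩ := Ideal.mem_span_pair.1 this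
  exact ⟨c, d, e.symm⟩

theorem SL.IsLoc.torsion {u v : S} {κ : ℕ → (N →ₗ[S] H)} (h : SL.IsLoc u v κ) (x y : S) (k : ℕ)
    (hk : ∀ n : N, (x * u + y * v) ^ k • n = 0) :
    ∀ w ∈ [x, y, u, v], ∀ z : H, ∃ j : ℕ, w ^ j • z = 0 := by
  intro w hw z
  obtain ⟨t, n, rfl⟩ := h.surj z
  simp only [List.mem_cons, List.not_mem_nil, or_false] at hw
  rcases hw with rfl | rfl | rfl | rfl
  · refine ⟨k + t, ?_⟩
    obtain ⟨c, d, e⟩ := SL.pow_decomp (w * u + y * v) (-(y * v)) k t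
    rw [h.tr t (k + t), ← map_smul, smul_smul]
    have : w ^ (k + t) * (u ^ (k + t) * v ^ (k + t)) =
        (v ^ (k + t) * c) * (w * u + y * v) ^ k + v ^ (t + (k + t)) * (d * (-y) ^ t) := by
      have e2 : w ^ (k + t) * u ^ (k + t) = c * (w * u + y * v) ^ k + d * (-(y * v)) ^ t := by
        rw [← e, ← mul_pow]; ring
      rw [← mul_assoc, e2, neg_mul_eq_neg_mul, mul_pow]; ring
    rw [this, add_smul, mul_smul, hk, smul_zero, zero_add, mul_smul, h.zq]
  · refine ⟨k + t, ?_⟩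
    obtain ⟨c, d, e⟩ := SL.pow_decomp (x * u + w * v) (-(x * u)) k t
    rw [h.tr t (k + t), ← map_smul, smul_smul]
    have : w ^ (k + t) * (u ^ (k + t) * v ^ (k + t)) =
        (u ^ (k + t) * c) * (x * u + w * v) ^ k + u ^ (t + (k + t)) * (d * (-x) ^ t) := by
      have e2 : w ^ (k + t) * v ^ (k + t) = c * (x * u + w * v) ^ k + d * (-(x * u)) ^ t := by
        rw [← e, ← mul_pow]; ring
      rw [mul_left_comm, e2, neg_mul_eq_neg_mul, mul_pow]; ring
    rw [this, add_smul, mul_smul, hk, smul_zero, zero_add, mul_smul, h.zp]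
  · exact ⟨t, by rw [← map_smul, h.zp]⟩
  · exact ⟨t, by rw [← map_smul, h.zq]⟩

theorem SL.IsLoc.desc (h : SL.IsLoc p q κ) {Q : Type u} [AddCommGroup Q] [Module S Q] (μ : ℕ → (N →ₗ[S] Q))
    (hμ : ∀ t s n, μ t n = μ (t + s) ((p ^ s * q ^ s) • n)) (h0 : ∀ t n, κ t n = 0 → μ t n = 0) :
    ∃ f : H →ₗ[S] Q, ∀ t n, f (κ t n) = μ t n := by
  choose T R hTR using h.surj
  have wd : ∀ t n t' n', κ t n = κ t' n' → μ t n = μ t' n' := by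
    intro t n t' n' e
    rw [h.tr t t', h.tr t' t, add_comm t' t, ← sub_eq_zero, ← map_sub] at e
    have := h0 _ _ e
    rw [map_sub, sub_eq_zero] at this
    rw [hμ t t', hμ t' t, add_comm t' t, this]
  refine ⟨{ toFun := fun z => μ (T z) (R z), map_add' := ?_, map_smul' := ?_ }, ?_⟩
  · intro a b
    rw [hμ (T a) (T b) (R a), hμ (T b) (T a) (R b), add_comm (T b) (T a), ← map_add]
    apply wd
    rw [map_add, ← h.tr, hTR, hTR, add_comm (T a) (T b), ← h.tr, hTR]
  · intro c a
    rw [RingHom.id_apply, ← map_smul]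
    apply wd
    rw [map_smul, hTR, hTR]
  · intro t n
    exact wd _ _ _ _ (hTR _)

theorem SL.IsLoc.embed (h : SL.IsLoc p q κ) {A : Type u} [AddCommGroup A] [Module S A] {α : ℕ → (S →ₗ[S] A)}
    (hα : SL.IsLoc p q α) : ∃ f : (N ⊗[S] A) →ₗ[S] H, Function.Injective f := by
  obtain ⟨f, hf⟩ := hα.desc (Q := N →ₗ[S] H) (fun t => (LinearMap.lsmul S (N →ₗ[S] H)).flip (κ t)) (by
      intro t s z
      ext n
      change z • κ t n = ((p ^ s * q ^ s) • z) • κ (t + s) n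
      rw [h.tr t s n, map_smul, smul_smul, smul_eq_mul, mul_comm]) (by
      intro t z hz
      obtain ⟨s, a, b, e⟩ := hα.ker t z hz
      ext n
      change z • κ t n = 0
      have e2 : z * (p ^ s * q ^ s) = p ^ (t + s) * a + q ^ (t + s) * b := by
        rw [mul_comm]; exact e
      rw [h.tr t s n, ← map_smul, smul_smul, e2, add_smul, mul_smul, mul_smul, h.zero])
  have hf' : ∀ t z n, f (α t z) n = z • κ t n := fun t z n => by rw [hf]; rfl
  let Φ : (N ⊗[S] A) →ₗ[S] H := TensorProduct.lift f.flip
  have rep : ∀ w : N ⊗[S] A, ∃ n t, w = n ⊗ₜ α t 1 := by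
    intro w
    induction w with
    | zero => exact ⟨0, 0, by simp⟩
    | tmul n a =>
      obtain ⟨t, z, rfl⟩ := hα.surj a
      refine ⟨z • n, t, ?_⟩
      rw [TensorProduct.smul_tmul, ← map_smul, smul_eq_mul, mul_one]
    | add w w' hw hw' =>
      obtain ⟨n, t, rfl⟩ := hw
      obtain ⟨n', t', rfl⟩ := hw'
      refine ⟨(p ^ t' * q ^ t') • n + (p ^ t * q ^ t) • n', t + t', ?_⟩
      rw [TensorProduct.add_tmul, TensorProduct.smul_tmul, TensorProduct.smul_tmul, ← map_smul, ← map_smul,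
        ← hα.tr, add_comm t t', ← hα.tr]
  refine ⟨Φ, (injective_iff_map_eq_zero Φ).2 ?_⟩
  intro w hw
  obtain ⟨n, t, rfl⟩ := rep w
  have : κ t n = 0 := by
    have h2 : Φ (n ⊗ₜ α t 1) = f (α t 1) n := rfl
    rw [hw, hf', one_smul] at h2
    exact h2.symm
  obtain ⟨s, a, b, e⟩ := h.ker t n this
  rw [hα.tr t s, map_smul, ← TensorProduct.smul_tmul, e, TensorProduct.add_tmul, TensorProduct.smul_tmul,
    TensorProduct.smul_tmul, ← map_smul, ← map_smul, hα.zp, hα.zq, TensorProduct.tmul_zero,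
    TensorProduct.tmul_zero, add_zero]

theorem SL.geom (X Y : S) (M : ℕ) : ∃ E E', E * (X - Y) = X ^ (M + 1) - Y ^ (M + 1) ∧ E = X ^ M + Y * E' := by
  induction M with
  | zero => exact ⟨1, 0, by ring, by ring⟩
  | succ M ih =>
    obtain ⟨E, E', h1, h2⟩ := ih
    refine ⟨X ^ (M + 1) + Y * E, E, ?_, rfl⟩
    linear_combination Y * h1

theorem SL.not_artin {x y u v : S} {A : Type u} [AddCommGroup A] [Module S A] {α : ℕ → (S →ₗ[S] A)}
    (hα : SL.IsLoc u v α)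
    (hmon : ∀ M s : ℕ, x ^ M * (y ^ M * (u ^ s * v ^ s)) ∉ Ideal.span {x ^ (M+1)} ⊔
      (Ideal.span {y ^ (M+1)} ⊔ (Ideal.span {u ^ (s+1)} ⊔ Ideal.span {v ^ (s+1)})))
    (hA : IsArtinian S ((S ⧸ Ideal.span {x * u + y * v}) ⊗[S] A)) : False := by
  set a := x * u + y * v with ha
  let I : Ideal S := Ideal.span {a}
  let B := A ⧸ (I • ⊤ : Submodule S A)
  have hB : IsArtinian S B := isArtinian_of_surjective _ (TensorProduct.quotTensorEquivQuotSMul A I).toLinearMap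
    (TensorProduct.quotTensorEquivQuotSMul A I).surjective
  let L : ℕ → Submodule S B := fun n => LinearMap.range (LinearMap.lsmul S B (x ^ n))
  have hL : ∀ {m n}, m ≤ n → L n ≤ L m := by
    rintro m n hmn _ ⟨z, rfl⟩
    obtain ⟨k, rfl⟩ := Nat.exists_eq_add_of_le hmn
    refine ⟨x ^ k • z, ?_⟩
    change x ^ m • x ^ k • z = x ^ (m + k) • z
    rw [smul_smul, pow_add]
  obtain ⟨M, hM⟩ := monotone_stabilizes_iff_artinian.2 hB
    ⟨fun n => OrderDual.toDual (L n), fun _ _ h => hL h⟩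
  have hM1 : L M = L (M + 1) := hM (M + 1) (Nat.le_succ M)
  have hmem : x ^ M • Submodule.Quotient.mk (u ^ M • α (1 + M) 1) ∈ L M :=
    ⟨Submodule.Quotient.mk (u ^ M • α (1 + M) 1), rfl⟩
  rw [hM1] at hmem
  obtain ⟨β0, hβ0⟩ := hmem
  obtain ⟨β, rfl⟩ := Submodule.Quotient.mk_surjective _ β0
  have hβ1 : x ^ M • u ^ M • α (1 + M) 1 - x ^ (M + 1) • β ∈ (I • ⊤ : Submodule S A) := by
    rw [← Submodule.Quotient.mk_eq_zero, Submodule.Quotient.mk_sub, sub_eq_zero]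
    exact hβ0.symm
  rw [Submodule.ideal_span_singleton_smul] at hβ1
  obtain ⟨γ, -, hγ⟩ := (Submodule.mem_smul_pointwise_iff_exists _ _ _).1 hβ1
  obtain ⟨E, E', hE1, hE2⟩ := SL.geom (v * y) (-(u * x)) M
  have key : α 1 (x ^ M * y ^ M) = x ^ (M + 1) • (E • β - (-u) ^ (M + 1) • γ) + y ^ (M + 1) • (v ^ (M + 1) • γ) := by
    have hE3 : E * a = y ^ (M + 1) * v ^ (M + 1) - x ^ (M + 1) * (-u) ^ (M + 1) := by
      have : a = v * y - -(u * x) := by rw [ha]; ring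
      rw [this, hE1, neg_mul_eq_neg_mul, mul_pow, mul_pow]; ring
    have e1 : E • (x ^ M • u ^ M • α (1 + M) 1) = α 1 (x ^ M * y ^ M) := by
      rw [hα.tr 1 M, ← map_smul, ← map_smul, ← map_smul, smul_eq_mul, smul_eq_mul, smul_eq_mul, smul_eq_mul]
      have : E * (x ^ M * (u ^ M * 1)) = (u ^ M * v ^ M) * (x ^ M * y ^ M) +
          u ^ (1 + M) • (- (x * E' * x ^ M)) := by
        rw [hE2, smul_eq_mul, mul_pow]; ring
      rw [this, map_add, hα.zp, add_zero]
    have e2 : x ^ M • u ^ M • α (1 + M) 1 = x ^ (M + 1) • β + a • γ := by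
      rw [hγ]; abel
    rw [← e1, e2, smul_add, smul_smul E a, hE3, sub_smul, smul_sub, smul_comm E, mul_smul, mul_smul]
    abel
  generalize E • β - (-u) ^ (M + 1) • γ = β' at key
  generalize v ^ (M + 1) • γ = γ' at key
  obtain ⟨t, b, rfl⟩ := hα.surj β'
  obtain ⟨t', c, rfl⟩ := hα.surj γ'
  rw [hα.tr' (show 1 + (t + t') = 1 + (t + t') from rfl), hα.tr' (show t + (1 + t') = 1 + (t + t') by omega) b,
    hα.tr' (show t' + (1 + t) = 1 + (t + t') by omega) c, ← map_smul, ← map_smul, ← map_add, ← sub_eq_zero,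
    ← map_sub] at key
  obtain ⟨s, a1, a2, e⟩ := hα.ker _ _ key
  refine hmon M (t + t' + s) ?_
  simp only [smul_eq_mul] at e
  have hs : 1 + (t + t') + s = t + t' + s + 1 := by omega
  rw [hs] at e
  have fin : x ^ M * (y ^ M * (u ^ (t + t' + s) * v ^ (t + t' + s))) =
      x ^ (M + 1) * (u ^ s * v ^ s * (u ^ (1 + t') * v ^ (1 + t') * b)) +
      (y ^ (M + 1) * (u ^ s * v ^ s * (u ^ (1 + t) * v ^ (1 + t) * c)) +
      (u ^ (t + t' + s + 1) * a1 + v ^ (t + t' + s + 1) * a2)) := by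
    rw [← e]; ring
  rw [fin]
  exact add_mem (Ideal.mem_sup_left (Ideal.mem_span_singleton.2 (dvd_mul_right _ _)))
    (Ideal.mem_sup_right (add_mem (Ideal.mem_sup_left (Ideal.mem_span_singleton.2 (dvd_mul_right _ _)))
      (Ideal.mem_sup_right (add_mem (Ideal.mem_sup_left (Ideal.mem_span_singleton.2 (dvd_mul_right _ _)))
        (Ideal.mem_sup_right (Ideal.mem_span_singleton.2 (dvd_mul_right _ _)))))))
end
end P4
end Part3

section Part4
open CategoryTheory Limits

section
variable {D : Type*} [Category D] [Abelian D]

noncomputable def SL.iota (K : ChainComplex D ℕ) (hK : K.d 3 2 = 0) : K.homology 2 ⟶ K.X 2 :=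
  K.homologyι 2 ≫ (K.pOpcyclesIso 3 2 (by simp) hK).inv

theorem SL.iota_mono (K : ChainComplex D ℕ) (hK : K.d 3 2 = 0) : Mono (SL.iota K hK) := by
  unfold SL.iota; infer_instance

theorem SL.iota_p (K : ChainComplex D ℕ) (hK : K.d 3 2 = 0) :
    SL.iota K hK ≫ K.pOpcycles 2 = K.homologyι 2 := by
  have := (K.pOpcyclesIso 3 2 (by simp) hK).inv_hom_id
  rw [HomologicalComplex.pOpcyclesIso_hom] at this
  rw [SL.iota, Category.assoc, this, Category.comp_id]

theorem SL.iota_d (K : ChainComplex D ℕ) (hK : K.d 3 2 = 0) : SL.iota K hK ≫ K.d 2 1 = 0 := by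
  rw [← K.p_fromOpcycles 2 1, ← Category.assoc, SL.iota_p, K.homologyι_comp_fromOpcycles]

theorem SL.iota_exact (K : ChainComplex D ℕ) (hK : K.d 3 2 = 0) :
    (ShortComplex.mk _ _ (SL.iota_d K hK)).Exact := by
  let T := ShortComplex.mk _ _ (K.homologyι_comp_fromOpcycles 2 1)
  have hT : T.Exact := T.exact_of_f_is_kernel (K.homologyIsKernel 2 1 (by simp))
  let T' := ShortComplex.mk _ _ (SL.iota_d K hK)
  have e : T' ≅ T := ShortComplex.isoMk (Iso.refl _) (K.pOpcyclesIso 3 2 (by simp) hK) (Iso.refl _)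
    (by simp [T, T', SL.iota_p]) (by simp [T, T'])
  exact (ShortComplex.exact_iff_of_iso e).2 hT

theorem SL.iso_exact {H K2 K1 H' : D} (i : H ⟶ K2) (d : K2 ⟶ K1) (h : i ≫ d = 0)
    (hE : (ShortComplex.mk i d h).Exact) (e : H' ≅ H) (h' : (e.hom ≫ i) ≫ d = 0) :
    (ShortComplex.mk (e.hom ≫ i) d h').Exact := by
  let T := ShortComplex.mk _ _ h
  let T' := ShortComplex.mk _ _ h'
  have e : T' ≅ T := ShortComplex.isoMk e (Iso.refl _) (Iso.refl _)
    (by simp [T, T']) (by simp [T, T'])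
  exact (ShortComplex.exact_iff_of_iso e).2 hE

theorem SL.iota_nat {K L : ChainComplex D ℕ} (hK : K.d 3 2 = 0) (hL : L.d 3 2 = 0) (φ : K ⟶ L) :
    HomologicalComplex.homologyMap φ 2 ≫ SL.iota L hL = SL.iota K hK ≫ φ.f 2 := by
  have : IsIso (L.pOpcycles 2) := L.isIso_pOpcycles 3 2 (by simp) hL
  rw [← cancel_mono (L.pOpcycles 2), Category.assoc, SL.iota_p,
    HomologicalComplex.homologyι_naturality, Category.assoc, ← HomologicalComplex.p_opcyclesMap,
    ← Category.assoc, SL.iota_p]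

variable {C : Type*} [Category C] [Abelian C] [EnoughProjectives C] (G : C ⥤ D) [G.Additive]

theorem SL.map_d {X : C} (P : ProjectiveResolution X) (h : P.complex.d 3 2 = 0) :
    ((G.mapHomologicalComplex (ComplexShape.down ℕ)).obj P.complex).d 3 2 = 0 := by
  rw [Functor.mapHomologicalComplex_obj_d, h, G.map_zero]; rfl

noncomputable def SL.e0 {X : C} (P : ProjectiveResolution X) :
    (G.leftDerived 2).obj X ≅
      HomologicalComplex.homology ((G.mapHomologicalComplex (ComplexShape.down ℕ)).obj P.complex) 2 :=
  P.isoLeftDerivedObj G 2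

noncomputable def SL.jota0 {X : C} (P : ProjectiveResolution X) (h : P.complex.d 3 2 = 0) :
    (G.leftDerived 2).obj X ⟶ ((G.mapHomologicalComplex (ComplexShape.down ℕ)).obj P.complex).X 2 :=
  (SL.e0 G P).hom ≫ SL.iota _ (SL.map_d G P h)

noncomputable def SL.jota {X : C} (P : ProjectiveResolution X) (h : P.complex.d 3 2 = 0) :
    (G.leftDerived 2).obj X ⟶ G.obj (P.complex.X 2) := SL.jota0 G P h

theorem SL.jota_mono {X : C} (P : ProjectiveResolution X) (h : P.complex.d 3 2 = 0) :
    Mono (SL.jota G P h) := by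
  have := SL.iota_mono _ (SL.map_d G P h)
  have : Mono (SL.jota0 G P h) := by unfold SL.jota0; exact mono_comp _ _
  exact this

theorem SL.jota0_d {X : C} (P : ProjectiveResolution X) (h : P.complex.d 3 2 = 0) :
    SL.jota0 G P h ≫ ((G.mapHomologicalComplex (ComplexShape.down ℕ)).obj P.complex).d 2 1 = 0 := by
  rw [SL.jota0, Category.assoc, SL.iota_d, comp_zero]

theorem SL.jota_d {X : C} (P : ProjectiveResolution X) (h : P.complex.d 3 2 = 0) :
    SL.jota G P h ≫ G.map (P.complex.d 2 1) = 0 := SL.jota0_d G P h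

theorem SL.jota_exact {X : C} (P : ProjectiveResolution X) (h : P.complex.d 3 2 = 0) :
    (ShortComplex.mk _ _ (SL.jota_d G P h)).Exact :=
  SL.iso_exact _ _ _ (SL.iota_exact _ (SL.map_d G P h)) (SL.e0 G P) (SL.jota0_d G P h)

theorem SL.jota_nat {X Y : C} (f : X ⟶ Y) (P : ProjectiveResolution X) (Q : ProjectiveResolution Y)
    (h : P.complex.d 3 2 = 0) (h' : Q.complex.d 3 2 = 0)
    (φ : P.complex ⟶ Q.complex) (comm : φ.f 0 ≫ Q.π.f 0 = P.π.f 0 ≫ f) :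
    (G.leftDerived 2).map f ≫ SL.jota G Q h' = SL.jota G P h ≫ G.map (φ.f 2) := by
  have e := SL.iota_nat (SL.map_d G P h) (SL.map_d G Q h') ((G.mapHomologicalComplex _).map φ)
  have n : (G.leftDerived 2).map f ≫ (SL.e0 G Q).hom = (SL.e0 G P).hom ≫
    HomologicalComplex.homologyMap ((G.mapHomologicalComplex _).map φ) 2 :=
    ProjectiveResolution.isoLeftDerivedObj_hom_naturality f P Q φ comm G 2
  change (G.leftDerived 2).map f ≫ SL.jota0 G Q h' = SL.jota0 G P h ≫ ((G.mapHomologicalComplex _).map φ).f 2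
  unfold SL.jota0
  rw [← Category.assoc, n, Category.assoc, Category.assoc, e]

end

section Res
variable {C : Type*} [Category C] [Abelian C] {X0 X1 X2 Z : C} (d1 : X1 ⟶ X0) (d2 : X2 ⟶ X1)
  (π : X0 ⟶ Z) (h21 : d2 ≫ d1 = 0) (h10 : d1 ≫ π = 0)

open ZeroObject

variable (X0 X1 X2) in
noncomputable def SL.cX : ℕ → C
  | 0 => X0
  | 1 => X1
  | 2 => X2
  | _ + 3 => 0

noncomputable def SL.cd : ∀ n, SL.cX X0 X1 X2 (n + 1) ⟶ SL.cX X0 X1 X2 n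
  | 0 => d1
  | 1 => d2
  | _ + 2 => 0

theorem SL.csq (h21 : d2 ≫ d1 = 0) : ∀ n, SL.cd d1 d2 (n + 1) ≫ SL.cd d1 d2 n = 0
  | 0 => h21
  | 1 => zero_comp
  | _ + 2 => zero_comp

noncomputable def SL.cx : ChainComplex C ℕ := ChainComplex.of (SL.cX X0 X1 X2) (SL.cd d1 d2) (SL.csq d1 d2 h21)

noncomputable def SL.cπ : SL.cx d1 d2 h21 ⟶ (ChainComplex.single₀ C).obj Z :=
  (ChainComplex.toSingle₀Equiv _ _).symm ⟨π, by
    have : (SL.cx d1 d2 h21).d 1 0 = d1 := ChainComplex.of_d (SL.cX X0 X1 X2) (SL.cd d1 d2) 0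
    rw [this]; exact h10⟩

theorem SL.exact_congr {X0 X1 X2 : C} {f f' : X0 ⟶ X1} {g g' : X1 ⟶ X2} (hf : f = f') (hg : g = g')
    (h : f ≫ g = 0) (h' : f' ≫ g' = 0) (e : (ShortComplex.mk f g h).Exact) :
    (ShortComplex.mk f' g' h').Exact := by
  subst hf hg; exact e

theorem SL.mono_congr {X0 X1 : C} {f f' : X0 ⟶ X1} (hf : f = f') (h : Mono f) : Mono f' := hf ▸ h

theorem SL.cπ_f : (SL.cπ d1 d2 π h21 h10).f 0 = π := by
  unfold SL.cπ
  exact ChainComplex.toSingle₀Equiv_symm_apply_f_zero _ _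

theorem SL.cquasi [Mono d2] [Epi π] (e1 : (ShortComplex.mk d2 d1 h21).Exact) (e0 : (ShortComplex.mk d1 π h10).Exact) :
    QuasiIso (SL.cπ d1 d2 π h21 h10) := ⟨fun n => by
  have D0 : (SL.cx d1 d2 h21).d 1 0 = d1 := ChainComplex.of_d (SL.cX X0 X1 X2) (SL.cd d1 d2) 0
  have D1 : (SL.cx d1 d2 h21).d 2 1 = d2 := ChainComplex.of_d (SL.cX X0 X1 X2) (SL.cd d1 d2) 1
  have D2 : (SL.cx d1 d2 h21).d 3 2 = 0 := ChainComplex.of_d (SL.cX X0 X1 X2) (SL.cd d1 d2) 2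
  have CP := SL.cπ_f d1 d2 π h21 h10
  have Z0 : ∀ n, (SL.cx d1 d2 h21).ExactAt (n + 3) := fun n => by
    rw [HomologicalComplex.exactAt_iff' _ (n + 4) (n + 3) (n + 2) (by simp) (by simp)]
    exact ShortComplex.exact_of_isZero_X₂ _ (isZero_zero C)
  match n with
  | 0 =>
    rw [ChainComplex.quasiIsoAt₀_iff, ShortComplex.quasiIso_iff_of_zeros']
    · refine (ShortComplex.exact_and_epi_g_iff_of_iso ?_).2 ⟨e0, ‹_›⟩
      exact ShortComplex.isoMk (Iso.refl _) (Iso.refl _) (Iso.refl _) 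
        ((Category.id_comp _).trans (D0.symm.trans (Category.comp_id _).symm))
        ((Category.id_comp _).trans (CP.symm.trans (Category.comp_id _).symm))
    all_goals rfl
  | 1 => 
    rw [quasiIsoAt_iff_exactAt']
    · rw [HomologicalComplex.exactAt_iff' _ 2 1 0 (by simp) (by simp)]
      exact SL.exact_congr D1.symm D0.symm _ (HomologicalComplex.d_comp_d _ _ _ _) e1
    · exact HomologicalComplex.exactAt_single_obj _ _ _ _ (by simp)
  | 2 => 
    rw [quasiIsoAt_iff_exactAt']
    · rw [HomologicalComplex.exactAt_iff' _ 3 2 1 (by simp) (by simp)]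
      refine (ShortComplex.exact_iff_mono _ D2).2 ?_
      change Mono ((SL.cx d1 d2 h21).d 2 1)
      exact SL.mono_congr D1.symm ‹_›
    · exact HomologicalComplex.exactAt_single_obj _ _ _ _ (by simp)
  | n + 3 => 
    rw [quasiIsoAt_iff_exactAt']
    · exact Z0 n
    · exact HomologicalComplex.exactAt_single_obj _ _ _ _ (by simp)⟩

noncomputable def SL.cres [Projective X0] [Projective X1] [Projective X2] [Mono d2] [Epi π]
    (e1 : (ShortComplex.mk d2 d1 h21).Exact) (e0 : (ShortComplex.mk d1 π h10).Exact) :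
    ProjectiveResolution Z where
  complex := SL.cx d1 d2 h21
  projective n := match n with
    | 0 => inferInstanceAs (Projective X0)
    | 1 => inferInstanceAs (Projective X1)
    | 2 => inferInstanceAs (Projective X2)
    | _ + 3 => inferInstanceAs (Projective (0 : C))
  π := SL.cπ d1 d2 π h21 h10
  quasiIso := SL.cquasi d1 d2 π h21 h10 e1 e0

theorem SL.cx_d32 : (SL.cx d1 d2 h21).d 3 2 = 0 :=
  ChainComplex.of_d (SL.cX X0 X1 X2) (SL.cd d1 d2) 2

theorem SL.cx_d21 : (SL.cx d1 d2 h21).d 2 1 = d2 :=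
  ChainComplex.of_d (SL.cX X0 X1 X2) (SL.cd d1 d2) 1

theorem SL.cx_d10 : (SL.cx d1 d2 h21).d 1 0 = d1 :=
  ChainComplex.of_d (SL.cX X0 X1 X2) (SL.cd d1 d2) 0

section Map
variable {X0' X1' X2' : C} (d1' : X1' ⟶ X0') (d2' : X2' ⟶ X1') (h21' : d2' ≫ d1' = 0)
  (f0 : X0 ⟶ X0') (f1 : X1 ⟶ X1') (f2 : X2 ⟶ X2') (c1 : f1 ≫ d1' = d1 ≫ f0) (c2 : f2 ≫ d2' = d2 ≫ f1)

noncomputable def SL.cf : ∀ n, SL.cX X0 X1 X2 n ⟶ SL.cX X0' X1' X2' n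
  | 0 => f0
  | 1 => f1
  | 2 => f2
  | _ + 3 => 0

noncomputable def SL.cmap : SL.cx d1 d2 h21 ⟶ SL.cx d1' d2' h21' where
  f := SL.cf f0 f1 f2
  comm' := by
    rintro i j (rfl : j + 1 = i)
    have e1 : (SL.cx d1 d2 h21).d (j + 1) j = SL.cd d1 d2 j := ChainComplex.of_d (SL.cX X0 X1 X2) (SL.cd d1 d2) j
    have e2 : (SL.cx d1' d2' h21').d (j + 1) j = SL.cd d1' d2' j := ChainComplex.of_d (SL.cX X0' X1' X2') (SL.cd d1' d2') j
    refine (congrArg (SL.cf f0 f1 f2 (j + 1) ≫ ·) e2).trans (Eq.trans ?_ (congrArg (· ≫ SL.cf f0 f1 f2 j) e1).symm)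
    match j with
    | 0 => exact c1
    | 1 => exact c2
    | j + 2 => exact comp_zero.trans zero_comp.symm
end Map

end Res

section Ext
open CategoryTheory Limits Opposite
variable {S : Type u} [CommRing S]

def SL.Ksz (p q : S) : Prop := (∀ z, p * z = 0 → z = 0) ∧ ∀ α β, α * p + β * q = 0 → ∃ γ, α = γ * q ∧ β = -(γ * p)

def SL.kd1 (p q : S) : ModuleCat.of S (S × S) ⟶ ModuleCat.of S S :=
  ModuleCat.ofHom ((LinearMap.toSpanSingleton S S p).coprod (LinearMap.toSpanSingleton S S q))

def SL.kd2 (p q : S) : ModuleCat.of S S ⟶ ModuleCat.of S (S × S) :=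
  ModuleCat.ofHom (LinearMap.toSpanSingleton S (S × S) (q, -p))

def SL.kπ (p q : S) : ModuleCat.of S S ⟶ ModuleCat.of S (S ⧸ Ideal.span {p, q}) :=
  ModuleCat.ofHom (Submodule.mkQ _)

theorem SL.kd21 (p q : S) : SL.kd2 p q ≫ SL.kd1 p q = 0 := by
  ext
  simp [SL.kd1, SL.kd2]
  ring

theorem SL.kd10 (p q : S) : SL.kd1 p q ≫ SL.kπ p q = 0 := by
  apply ModuleCat.hom_ext
  ext
  · have : Ideal.Quotient.mk (Ideal.span {p, q}) p = 0 :=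
      Ideal.Quotient.eq_zero_iff_mem.2 (Ideal.subset_span (by simp))
    simpa [SL.kd1, SL.kπ] using this
  · have : Ideal.Quotient.mk (Ideal.span {p, q}) q = 0 :=
      Ideal.Quotient.eq_zero_iff_mem.2 (Ideal.subset_span (by simp))
    simpa [SL.kd1, SL.kπ] using this

theorem SL.kex1 {p q : S} (h : SL.Ksz p q) : (ShortComplex.mk _ _ (SL.kd21 p q)).Exact := by
  rw [ShortComplex.moduleCat_exact_iff]
  rintro ⟨α, β⟩ hx
  have : α * p + β * q = 0 := by simpa [SL.kd1] using hx
  obtain ⟨γ, h1, h2⟩ := h.2 α β this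
  refine ⟨γ, ?_⟩
  simp [SL.kd2, h1, h2]

theorem SL.kex0 (p q : S) : (ShortComplex.mk _ _ (SL.kd10 p q)).Exact := by
  rw [ShortComplex.moduleCat_exact_iff]
  intro z hz
  have : z ∈ Ideal.span {p, q} := Ideal.Quotient.eq_zero_iff_mem.1 hz
  obtain ⟨a, b, e⟩ := Ideal.mem_span_pair.1 this
  refine ⟨(a, b), ?_⟩
  simp [SL.kd1, e]

theorem SL.kmono {p q : S} (h : SL.Ksz p q) : Mono (SL.kd2 p q) := by
  rw [ModuleCat.mono_iff_injective]
  refine (injective_iff_map_eq_zero (SL.kd2 p q).hom).2 fun z hz => h.1 z ?_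
  have := congrArg Prod.snd hz
  simpa [SL.kd2, mul_comm] using this

theorem SL.kepi (p q : S) : Epi (SL.kπ p q) := by
  rw [ModuleCat.epi_iff_surjective]
  exact Submodule.mkQ_surjective _

noncomputable def SL.kres {p q : S} (h : SL.Ksz p q) : ProjectiveResolution (ModuleCat.of S (S ⧸ Ideal.span {p, q})) :=
  have := SL.kmono h
  have := SL.kepi p q
  SL.cres _ _ _ _ _ (SL.kex1 h) (SL.kex0 p q)

theorem SL.kres_d32 {p q : S} (h : SL.Ksz p q) : (SL.kres h).complex.d 3 2 = 0 := SL.cx_d32 _ _ (SL.kd21 p q)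

theorem SL.kres_d21 {p q : S} (h : SL.Ksz p q) : (SL.kres h).complex.d 2 1 = SL.kd2 p q := SL.cx_d21 _ _ (SL.kd21 p q)

theorem SL.kres_π {p q : S} (h : SL.Ksz p q) : (SL.kres h).π.f 0 = SL.kπ p q := SL.cπ_f _ _ _ (SL.kd21 p q) (SL.kd10 p q)

noncomputable abbrev SL.G (N : ModuleCat.{u} S) : ModuleCat.{u} S ⥤ (ModuleCat.{u} S)ᵒᵖ :=
  ((linearYoneda S (ModuleCat.{u} S)).obj N).rightOp

noncomputable def SL.kap0 {p q : S} (h : SL.Ksz p q) (N : ModuleCat.{u} S) :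
    ModuleCat.of S (ModuleCat.of S S ⟶ N) ⟶
      ((Ext S (ModuleCat.{u} S) 2).obj (op (ModuleCat.of S (S ⧸ Ideal.span {p, q})))).obj N :=
  (SL.jota (SL.G N) (SL.kres h) (SL.kres_d32 h)).unop

theorem SL.kap0_surj {p q : S} (h : SL.Ksz p q) (N : ModuleCat.{u} S) :
    Function.Surjective (SL.kap0 h N) := by
  rw [← ModuleCat.epi_iff_surjective]
  have := SL.jota_mono (SL.G N) (SL.kres h) (SL.kres_d32 h)
  exact inferInstanceAs (Epi (SL.jota (SL.G N) (SL.kres h) (SL.kres_d32 h)).unop)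

theorem SL.kap0_ker {p q : S} (h : SL.Ksz p q) (N : ModuleCat.{u} S) (f : ModuleCat.of S S ⟶ N) :
    SL.kap0 h N f = 0 ↔ ∃ g : ModuleCat.of S (S × S) ⟶ N, SL.kd2 p q ≫ g = f := by
  have e := (SL.jota_exact (SL.G N) (SL.kres h) (SL.kres_d32 h)).unop
  have z := congrArg Quiver.Hom.unop (SL.jota_d (SL.G N) (SL.kres h) (SL.kres_d32 h))
  rw [ShortComplex.moduleCat_exact_iff] at e
  have d := SL.kres_d21 h
  constructor
  · intro hf
    obtain ⟨g, hg⟩ := e f hf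
    refine ⟨g, ?_⟩
    rw [← d]; exact hg
  · rintro ⟨g, rfl⟩
    rw [← d]
    exact ConcreteCategory.congr_hom z g

noncomputable def SL.kmap {p q p' q' c d : S} (h : SL.Ksz p q) (h' : SL.Ksz p' q') (hp : p' = c * p) (hq : q' = d * q) :
    (SL.kres h').complex ⟶ (SL.kres h).complex :=
  SL.cmap _ _ (SL.kd21 p' q') _ _ (SL.kd21 p q) (𝟙 _) (ModuleCat.ofHom (LinearMap.prodMap (LinearMap.lsmul S S c) (LinearMap.lsmul S S d)))
    (ModuleCat.ofHom (LinearMap.lsmul S S (c * d)))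
    (by
      apply ModuleCat.hom_ext
      ext
      · simp [SL.kd1, hp]
      · simp [SL.kd1, hq])
    (by
      apply ModuleCat.hom_ext
      ext
      · simp [SL.kd2, hp, hq]; ring
      · simp [SL.kd2, hp, hq]; ring)

theorem SL.kap0_nat {p q p' q' c d : S} (h : SL.Ksz p q) (h' : SL.Ksz p' q') (hp : p' = c * p) (hq : q' = d * q)
    (N : ModuleCat.{u} S) (w : ModuleCat.of S (S ⧸ Ideal.span {p', q'}) ⟶ ModuleCat.of S (S ⧸ Ideal.span {p, q}))
    (hw : SL.kπ p' q' ≫ w = SL.kπ p q) (f : ModuleCat.of S S ⟶ N) :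
    ((Ext S (ModuleCat.{u} S) 2).map w.op).app N (SL.kap0 h N f) =
      SL.kap0 h' N (ModuleCat.ofHom (LinearMap.lsmul S S (c * d)) ≫ f) := by
  have e := SL.jota_nat (SL.G N) w (SL.kres h') (SL.kres h) (SL.kres_d32 h') (SL.kres_d32 h)
    (SL.kmap h h' hp hq) (by
      rw [SL.kres_π, SL.kres_π]
      refine Eq.trans ?_ hw.symm
      exact Category.id_comp (SL.kπ p q))
  exact ConcreteCategory.congr_hom (congrArg Quiver.Hom.unop e) f

noncomputable def SL.kap {p q : S} (h : SL.Ksz p q) (N : ModuleCat.{u} S) :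
    N →ₗ[S] ((Ext S (ModuleCat.{u} S) 2).obj (op (ModuleCat.of S (S ⧸ Ideal.span {p, q})))).obj N :=
  (SL.kap0 h N).hom ∘ₗ ({
    toFun := fun n => ModuleCat.ofHom (LinearMap.toSpanSingleton S N n)
    map_add' := fun a b => by ext; simp
    map_smul' := fun a b => by ext; simp } : N →ₗ[S] (ModuleCat.of S S ⟶ N))

theorem SL.kap_apply {p q : S} (h : SL.Ksz p q) (N : ModuleCat.{u} S) (n : N) :
    SL.kap h N n = SL.kap0 h N (ModuleCat.ofHom (LinearMap.toSpanSingleton S N n)) := rfl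

theorem SL.kap_surj {p q : S} (h : SL.Ksz p q) (N : ModuleCat.{u} S) :
    Function.Surjective (SL.kap h N) := by
  intro z
  obtain ⟨f, rfl⟩ := SL.kap0_surj h N z
  refine ⟨f.hom 1, ?_⟩
  rw [SL.kap_apply]
  congr 1
  ext
  simp

theorem SL.kap_ker {p q : S} (h : SL.Ksz p q) (N : ModuleCat.{u} S) (n : N) :
    SL.kap h N n = 0 ↔ ∃ a b : N, n = p • a + q • b := by
  rw [SL.kap_apply, SL.kap0_ker]
  constructor
  · rintro ⟨g, hg⟩
    have := ConcreteCategory.congr_hom hg (1 : S)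
    have e : n = g.hom (q, -p) := by simpa [SL.kd2] using this.symm
    refine ⟨g.hom (0, -1), g.hom (1, 0), ?_⟩
    rw [e, ← map_smul, ← map_smul, ← map_add]
    simp
  · rintro ⟨a, b, rfl⟩
    refine ⟨ModuleCat.ofHom ((LinearMap.toSpanSingleton S N b).coprod (LinearMap.toSpanSingleton S N (-a))), ?_⟩
    ext
    simp [SL.kd2, add_comm]

theorem SL.kap_nat {p q p' q' c d : S} (h : SL.Ksz p q) (h' : SL.Ksz p' q') (hp : p' = c * p) (hq : q' = d * q)
    (N : ModuleCat.{u} S) (w : ModuleCat.of S (S ⧸ Ideal.span {p', q'}) ⟶ ModuleCat.of S (S ⧸ Ideal.span {p, q}))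
    (hw : SL.kπ p' q' ≫ w = SL.kπ p q) (n : N) :
    ((Ext S (ModuleCat.{u} S) 2).map w.op).app N (SL.kap h N n) = SL.kap h' N ((c * d) • n) := by
  rw [SL.kap_apply, SL.kap0_nat h h' hp hq N w hw, SL.kap_apply]
  congr 1
  ext
  simp

end Ext

section Loc
open CategoryTheory Limits Opposite localCohomology
variable {S : Type u} [CommRing S]

theorem SL.span_anti (p q : S) {s t : ℕ} (h : s ≤ t) : Ideal.span {p ^ t, q ^ t} ≤ Ideal.span {p ^ s, q ^ s} := by
  rw [Ideal.span_le]
  rintro z (rfl | rfl)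
  · exact Ideal.mem_of_dvd _ (pow_dvd_pow p h) (Ideal.subset_span (by simp))
  · exact Ideal.mem_of_dvd _ (pow_dvd_pow q h) (Ideal.subset_span (by simp))

def SL.Kd0 (p q : S) : ℕᵒᵖ ⥤ Ideal S where
  obj t := Ideal.span {p ^ unop t, q ^ unop t}
  map w := ⟨⟨SL.span_anti p q w.unop.down.down⟩⟩

def SL.Kd (p q : S) : ℕᵒᵖ ⥤ SelfLERadical (Ideal.span {p, q}) :=
  ObjectProperty.lift _ (SL.Kd0 p q) fun k => by
    change _ ≤ Ideal.radical (Ideal.span {p ^ unop k, q ^ unop k})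
    rw [Ideal.span_le]
    rintro z (rfl | rfl)
    · exact ⟨unop k, Ideal.subset_span (by simp)⟩
    · exact ⟨unop k, Ideal.subset_span (by simp)⟩

instance SL.Kd_initial (p q : S) : Functor.Initial (SL.Kd p q) where
  out J' := by
    apply +allowSynthFailures zigzag_isConnected
    · have hp : p ∈ Ideal.radical J'.1 := J'.2 (Ideal.subset_span (by simp))
      have hq : q ∈ Ideal.radical J'.1 := J'.2 (Ideal.subset_span (by simp))
      obtain ⟨a, ha⟩ := hp
      obtain ⟨b, hb⟩ := hq
      have hk : Ideal.span {p ^ (a + b), q ^ (a + b)} ≤ J'.1 := by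
        rw [Ideal.span_le]
        rintro z (rfl | rfl)
        · exact Ideal.mem_of_dvd _ (pow_dvd_pow p (by omega)) ha
        · exact Ideal.mem_of_dvd _ (pow_dvd_pow q (by omega)) hb
      exact ⟨CostructuredArrow.mk (⟨⟨⟨hk⟩⟩⟩ : (SL.Kd p q).obj (op (a + b)) ⟶ J')⟩
    · intro j1 j2
      apply Relation.ReflTransGen.single
      rcases le_total (unop j1.left) (unop j2.left) with h | h
      · right; exact ⟨CostructuredArrow.homMk (homOfLE h).op rfl⟩
      · left; exact ⟨CostructuredArrow.homMk (homOfLE h).op rfl⟩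

noncomputable def SL.locIso [IsNoetherianRing S] (p q : S) :
    ofDiagram.{u, 0} (SL.Kd p q ⋙ selfLERadicalDiagram _) 2 ≅ localCohomology (Ideal.span {p, q}) 2 :=
  isoOfFinal.{u, u, 0} (SL.Kd p q) (selfLERadicalDiagram _) 2 ≪≫ isoSelfLERadical _ 2

theorem SL.loc_elem [IsNoetherianRing S] (p q : S) (hK : ∀ t : ℕ, SL.Ksz (p ^ t) (q ^ t)) (N : ModuleCat.{u} S) :
    ∃ κ : ℕ → (N →ₗ[S] (localCohomology (Ideal.span {p, q}) 2).obj N),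
      (∀ t s n, κ t n = κ (t + s) ((p ^ s * q ^ s) • n)) ∧ (∀ t a b, κ t (p ^ t • a + q ^ t • b) = 0) ∧
      (∀ z, ∃ t n, κ t n = z) ∧
      (∀ t n, κ t n = 0 → ∃ s, ∃ a b, (p ^ s * q ^ s) • n = p ^ (t + s) • a + q ^ (t + s) • b) := by
  let D0 := diagram (SL.Kd p q ⋙ selfLERadicalDiagram _) 2
  let c : Cocone (D0 ⋙ (evaluation _ _).obj N) := ((evaluation _ _).obj N).mapCocone (colimit.cocone D0)
  have hc : IsColimit c := isColimitOfPreserves _ (colimit.isColimit D0)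
  let e : c.pt ≅ (localCohomology (Ideal.span {p, q}) 2).obj N := (SL.locIso p q).app N
  let κ : ℕ → (N →ₗ[S] (localCohomology (Ideal.span {p, q}) 2).obj N) := fun t =>
    (e.hom.hom ∘ₗ (c.ι.app (op (op t))).hom) ∘ₗ (SL.kap (hK t) N)
  have hκ : ∀ t n, κ t n = e.hom.hom ((c.ι.app (op (op t))).hom (SL.kap (hK t) N n)) := fun _ _ => rfl
  have tr : ∀ (t s : ℕ) (f : op (op t) ⟶ op (op (t + s))) (n : N),
      ((D0 ⋙ (evaluation _ _).obj N).map f).hom (SL.kap (hK t) N n) =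
        SL.kap (hK (t + s)) N ((p ^ s * q ^ s) • n) := by
    intro t s f n
    refine SL.kap_nat (hK t) (hK (t + s)) (by ring) (by ring) N
      ((ringModIdeals (SL.Kd p q ⋙ selfLERadicalDiagram _)).map f.unop) ?_ n
    rfl
  have inj : Function.Injective e.hom.hom := fun a b h => by
    have := congrArg e.inv.hom h
    simpa using this
  have ff : ∀ t s : ℕ, Nonempty ((op (op t) : (ℕᵒᵖ)ᵒᵖ) ⟶ op (op (t + s))) := fun t s =>
    ⟨(homOfLE (Nat.le_add_right t s)).op.op⟩
  have : PreservesFilteredColimitsOfSize.{0,0} (forget (ModuleCat.{u} S)) :=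
    preservesFilteredColimitsOfSize_shrink.{0,u,0,u} _
  refine ⟨κ, ?_, ?_, ?_, ?_⟩
  · intro t s n
    obtain ⟨f⟩ := ff t s
    rw [hκ, hκ, ← tr t s f]
    congr 1
    exact (ConcreteCategory.congr_hom (c.w f) (SL.kap (hK t) N n)).symm
  · intro t a b
    rw [hκ, (SL.kap_ker (hK t) N _).2 ⟨a, b, rfl⟩]
    exact (congrArg e.hom.hom (map_zero (c.ι.app (op (op t))).hom)).trans (map_zero e.hom.hom)
  · intro z
    obtain ⟨⟨⟨t⟩⟩, w, hw⟩ := Concrete.isColimit_exists_rep _ hc (e.inv.hom z)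
    obtain ⟨n, rfl⟩ := SL.kap_surj (hK t) N w
    refine ⟨t, n, ?_⟩
    rw [hκ]
    refine (congrArg e.hom.hom hw).trans ?_
    simp
  · intro t n h
    rw [hκ, ← map_zero e.hom.hom] at h
    have h2 := inj h
    rw [← map_zero (c.ι.app (op (op t))).hom] at h2
    obtain ⟨⟨⟨k⟩⟩, f, g, hfg⟩ := Concrete.isColimit_exists_of_rep_eq _ hc _ _ h2
    have hk : t ≤ k := f.unop.unop.down.down
    obtain ⟨s, rfl⟩ := Nat.exists_eq_add_of_le hk
    refine ⟨s, (SL.kap_ker (hK (t + s)) N _).1 ?_⟩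
    rw [← tr t s f]
    refine Eq.trans hfg (map_zero _)

end Loc
end Part4

/-- Let `(S, n, k)` be a regular local ring of dimension 4 with regular system
of parameters `x, y, u, v`, and set `a := x*u + y*v`.  Then for every finitely generated
`S`-module `N` with `Supp N = V(aS)`, the socle
`Soc_S H^2_{(u,v)S}(N) = (0 :_{H^2_{(u,v)S}(N)} n)` is an infinite dimensional `k`-vector
space, where `k = S/n` is the residue field.  (The socle is realized as
`Submodule.torsionBySet`, which carries a canonical `S/n`-module structure; being infinite
dimensional is expressed as not being a finite `S/n`-module.) -/
theorem socle_localCohomology_infinite_dimensional_of_support_eq {S : Type u} [CommRing S]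
    [IsNoetherianRing S] [IsLocalRing S] (x y u v : S)
    (hgen : IsLocalRing.maximalIdeal S = Ideal.span {x, y, u, v})
    (hdim : ringKrullDim S = 4)
    (N : ModuleCat.{u} S) (hfg : Module.Finite S N)
    (hsupp : Module.support S N =
      PrimeSpectrum.zeroLocus (Ideal.span {x * u + y * v} : Set S)) :
    ¬ Module.Finite (S ⧸ IsLocalRing.maximalIdeal S)
      (Submodule.torsionBySet S ((localCohomology (Ideal.span {u, v}) 2).obj N)
        (IsLocalRing.maximalIdeal S : Set S)) := by
  intro hfin
  have hpar : SL.Par [x, y, u, v] := by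
    refine ⟨?_, ?_⟩
    · rw [hgen, Ideal.ofList]
      congr 1
      ext z
      simp
    · rw [hdim]; exact le_of_eq rfl
  have hK : ∀ t : ℕ, SL.Ksz (u ^ t) (v ^ t) := fun t => SL.koszul hpar t
  obtain ⟨κ, k1, k2, k3, k4⟩ := SL.loc_elem u v hK N
  obtain ⟨α, a1, a2, a3, a4⟩ := SL.loc_elem u v hK (ModuleCat.of S S)
  have hκ : SL.IsLoc u v κ := ⟨k1, k2, k3, k4⟩
  let α' : ℕ → (S →ₗ[S] (localCohomology (Ideal.span {u, v}) 2).obj (ModuleCat.of S S)) := α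
  have hα : SL.IsLoc u v α' := ⟨a1, a2, a3, a4⟩
  have hann : ∃ k : ℕ, ∀ n : N, (x * u + y * v) ^ k • n = 0 := by
    have h1 := hsupp
    rw [Module.support_eq_zeroLocus] at h1
    have h2 := (PrimeSpectrum.zeroLocus_subset_zeroLocus_iff _ _).1 h1.le
    obtain ⟨k, hk⟩ := h2 (Ideal.mem_span_singleton_self _)
    exact ⟨k, fun n => Module.mem_annihilator.1 hk n⟩
  obtain ⟨k, hk⟩ := hann
  have hart := SL.artin_of_socle [x, y, u, v] hpar.1 (hκ.torsion x y k hk) hfin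
  obtain ⟨f, hf⟩ := hκ.embed hα
  have hNA := isArtinian_of_injective f hf
  exact SL.not_artin hα (fun M s => SL.monomial hpar M s)
    (SL.gruson hNA (Ideal.span {x * u + y * v}) hsupp.ge)
end
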